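/- arXiv:0712.0665 — 4 statements merged into one kernel-verified Lean document; each statement's English description precedes it below -/
import Mathlib

section
/- Let A be a commutative Noetherian ring, 𝔞 an ideal of A, and N an A-module such that the local cohomology modules H^s_𝔞(N) vanish for all s ≥ 0. Then Ext^i_A(A/𝔞, N) = 0 for all i ≥ 0. -/
open CategoryTheory

/-- A map of short complexes of modules is injective on homology if and only if every cycle
whose image is a boundary is a boundary. -/
theorem CategoryTheory.ShortComplex.mono_homologyMap_iff_of_moduleCat {R : Type} [Ring R]
    {S T : ShortComplex (ModuleCat.{0} R)} (φ : S ⟶ T) :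
    Mono (ShortComplex.homologyMap φ) ↔
      ∀ x : S.X₂, S.g x = 0 → (∃ y, T.f y = φ.τ₂ x) → ∃ y, S.f y = x := by
  have key : ∀ (U : ShortComplex (ModuleCat.{0} R)) (z : U.cycles),
      U.homologyπ z = 0 ↔ ∃ y, U.f y = U.iCycles z := by
    intro U z
    have hex := (ShortComplex.exact_of_g_is_cokernel
      (ShortComplex.mk U.toCycles U.homologyπ U.toCycles_comp_homologyπ) U.homologyIsCokernel)
    rw [ShortComplex.moduleCat_exact_iff] at hex
    have hi : Function.Injective U.iCycles := (ModuleCat.mono_iff_injective _).1 inferInstance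
    constructor
    · intro h
      obtain ⟨y, hy⟩ := hex z h
      exact ⟨y, by rw [← hy]; exact (ConcreteCategory.congr_hom U.toCycles_i y).symm⟩
    · rintro ⟨y, hy⟩
      have : U.toCycles y = z := hi (by
        rw [← hy]; exact ConcreteCategory.congr_hom U.toCycles_i y)
      rw [← this]
      exact ConcreteCategory.congr_hom U.toCycles_comp_homologyπ y
  have nat : ∀ z : S.cycles, ShortComplex.homologyMap φ (S.homologyπ z) =
      T.homologyπ (ShortComplex.cyclesMap φ z) := fun z =>
    ConcreteCategory.congr_hom (ShortComplex.homologyπ_naturality φ) z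
  have nati : ∀ z : S.cycles, T.iCycles (ShortComplex.cyclesMap φ z) = φ.τ₂ (S.iCycles z) :=
    fun z => ConcreteCategory.congr_hom (ShortComplex.cyclesMap_i φ) z
  have hπ : Function.Surjective S.homologyπ := (ModuleCat.epi_iff_surjective _).1 inferInstance
  rw [ModuleCat.mono_iff_injective, injective_iff_map_eq_zero]
  constructor
  · intro h x hx hy
    obtain ⟨z, rfl⟩ : ∃ z, S.iCycles z = x := by
      refine ⟨S.moduleCatCyclesIso.inv ⟨x, hx⟩, ?_⟩
      exact ConcreteCategory.congr_hom S.moduleCatCyclesIso_inv_iCycles ⟨x, hx⟩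
    refine (key S z).1 (h _ ?_)
    rw [nat, key, nati]
    exact hy
  · intro h a ha
    obtain ⟨z, rfl⟩ := hπ a
    rw [nat, key, nati] at ha
    rw [key]
    exact h _ (ConcreteCategory.congr_hom S.iCycles_g z) ha

/-- Injectivity of `Ext^n(X, Y) → Ext^n(X', Y)` in terms of cocycles on projective resolutions. -/
theorem CategoryTheory.ProjectiveResolution.injective_ext_map_iff {A : Type} [CommRing A]
    {X' X : ModuleCat.{0} A}
    {P' : ProjectiveResolution X'} {P : ProjectiveResolution X} {g : X' ⟶ X}
    (φ : ProjectiveResolution.Hom P' P g) (Y : ModuleCat.{0} A) (n : ℕ) :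
    Function.Injective (((Ext A (ModuleCat A) n).map g.op).app Y) ↔
      ∀ f : P.complex.X n ⟶ Y, P.complex.d ((ComplexShape.down ℕ).prev n) n ≫ f = 0 →
        (∃ h, P'.complex.d n ((ComplexShape.down ℕ).next n) ≫ h = φ.hom.f n ≫ f) →
        ∃ h, P.complex.d n ((ComplexShape.down ℕ).next n) ≫ h = f := by
  let F := ((linearYoneda A (ModuleCat A)).obj Y).rightOp
  have e : Epi ((F.leftDerived n).map g) ↔
      Epi (HomologicalComplex.homologyMap ((F.mapHomologicalComplex _).map φ.hom) n) := by
    rw [F.leftDerived_map_eq n g φ.hom φ.hom_comp_π, epi_comp_iff_of_epi,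
      epi_comp_iff_of_isIso]
    rfl
  rw [← ModuleCat.mono_iff_injective]
  change Mono ((F.leftDerived n).map g).unop ↔ _
  rw [unop_mono_iff, e]
  let ψ := (HomologicalComplex.shortComplexFunctor _ _ n).map
    ((F.mapHomologicalComplex (ComplexShape.down ℕ)).map φ.hom)
  have h2 := ShortComplex.homologyMap_op (ShortComplex.unopMap ψ)
  have h3 : Epi (ShortComplex.homologyMap ψ) ↔
      Mono (ShortComplex.homologyMap (ShortComplex.unopMap ψ)) := by
    rw [← op_epi_iff, h2, epi_comp_iff_of_epi, epi_comp_iff_of_isIso]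
    rfl
  refine h3.trans ((ShortComplex.mono_homologyMap_iff_of_moduleCat _).trans ?_)
  exact Iff.rfl

open Abelian in
/-- A variant of `ProjectiveResolution.extMk_eq_zero_iff` which is also valid in degree zero. -/
theorem CategoryTheory.ProjectiveResolution.extMk_eq_zero_iff_next {C : Type*} [Category C] [Abelian C]
    [HasExt C] {X Y : C} (P : ProjectiveResolution X) (n m : ℕ) (hm : n + 1 = m)
    (f : P.complex.X n ⟶ Y) (hf : P.complex.d m n ≫ f = 0) :
    P.extMk f m hm hf = 0 ↔
      ∃ h, P.complex.d n ((ComplexShape.down ℕ).next n) ≫ h = f := by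
  cases n with
  | succ p =>
    rw [P.extMk_eq_zero_iff f m hm hf p rfl, ChainComplex.next_nat_succ]
  | zero =>
    have hd : P.complex.d 0 ((ComplexShape.down ℕ).next 0) = 0 :=
      P.complex.shape _ _ (by simp)
    simp only [hd, Limits.zero_comp]
    rw [← P.extEquivCohomologyClass.apply_eq_iff_eq, extEquivCohomologyClass_extMk,
      extEquivCohomologyClass_zero, CochainComplex.HomComplex.CohomologyClass.mk_eq_zero_iff,
      CochainComplex.HomComplex.Cocycle.toSingleMk_mem_coboundaries_iff _ _ _ _ _ 1 (by lia)]
    have hz : P.cochainComplex.d (-(0 : ℕ)) 1 = 0 := by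
      refine (Limits.IsZero.eq_of_tgt (CochainComplex.isZero_of_isStrictlyLE _ 0 _ (by lia)) _ _)
    simp only [hz, Limits.zero_comp]
    constructor
    · rintro ⟨-, h⟩
      refine ⟨0, ?_⟩
      rw [← cancel_epi (P.cochainComplexXIso (-(0 : ℕ)) 0 rfl).hom, ← h]
      simp
    · rintro ⟨-, rfl⟩
      exact ⟨0, by simp⟩

open Abelian in
/-- Precomposition with `g` is injective on `Ext` defined by left derived functors if and only if
it is injective on `Ext` defined by the derived category. -/
theorem injective_ext_map_iff_injective_mk₀_comp {A : Type} [CommRing A] {X' X : ModuleCat.{0} A}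
    (g : X' ⟶ X) (Y : ModuleCat.{0} A) (n : ℕ) :
    Function.Injective (((_root_.Ext A (ModuleCat A) n).map g.op).app Y) ↔
      ∀ α : Abelian.Ext.{0} X Y n, (Ext.mk₀ g).comp α (zero_add n) = 0 → α = 0 := by
  let P' := projectiveResolution X'
  let P := projectiveResolution X
  let φ : ProjectiveResolution.Hom P' P g :=
    { hom := ProjectiveResolution.lift g P' P
      hom_f_zero_comp_π_f_zero := ProjectiveResolution.lift_commutes_zero g P' P }
  have hp : (ComplexShape.down ℕ).prev n = n + 1 := by simp
  rw [ProjectiveResolution.injective_ext_map_iff φ]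
  constructor
  · intro H α hα
    obtain ⟨f, hf, rfl⟩ := P.extMk_surjective α _ hp.symm
    rw [ProjectiveResolution.mk₀_comp_extMk f _ hp.symm hf φ, P'.extMk_eq_zero_iff_next] at hα
    rw [P.extMk_eq_zero_iff_next]
    exact H f hf hα
  · intro H f hf hα
    rw [← P.extMk_eq_zero_iff_next n _ hp.symm f hf]
    apply H
    rwa [ProjectiveResolution.mk₀_comp_extMk f _ hp.symm hf φ, P'.extMk_eq_zero_iff_next]

open Abelian in
theorem subsingleton_ext_iff_subsingleton_ext {A : Type} [CommRing A] (X Y : ModuleCat.{0} A)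
    (n : ℕ) :
    Subsingleton (((_root_.Ext A (ModuleCat A) n).obj (Opposite.op X)).obj Y) ↔
      Subsingleton (Abelian.Ext.{0} X Y n) := by
  have h := injective_ext_map_iff_injective_mk₀_comp (0 : X ⟶ X) Y n
  have h0 : (((_root_.Ext A (ModuleCat A) n).map (0 : X ⟶ X).op).app Y) = 0 := by
    change ((((linearYoneda A (ModuleCat A)).obj Y).rightOp.leftDerived n).map 0).unop = 0
    rw [Functor.leftDerived_map_eq _ n (0 : X ⟶ X) (P := projectiveResolution X)
      (Q := projectiveResolution X) 0 (by simp), Functor.map_zero, Limits.zero_comp,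
      Limits.comp_zero]
    rfl
  rw [h0] at h
  simp only [Ext.mk₀_zero, Ext.zero_comp, forall_const] at h
  rw [subsingleton_iff_forall_eq (0 : Abelian.Ext.{0} X Y n), ← h]
  exact ⟨fun _ _ _ _ => Subsingleton.elim _ _, fun H => ⟨fun a b => H rfl⟩⟩

open Abelian in
/-- For a short exact sequence `0 → X₁ → X₂ → X₃ → 0` such that `Ext^k(X₁, Y)` vanishes for `k < n`,
the map `Ext^n(X₃, Y) → Ext^n(X₂, Y)` is injective. -/
theorem CategoryTheory.Abelian.Ext.eq_zero_of_mk₀_comp_eq_zero {C : Type*} [Category C] [Abelian C]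
    [HasExt C] {S : ShortComplex C} (hS : S.ShortExact) {Y : C} {n : ℕ}
    (h : ∀ k < n, Subsingleton (Ext S.X₁ Y k)) (α : Ext S.X₃ Y n)
    (hα : (Ext.mk₀ S.g).comp α (zero_add n) = 0) : α = 0 := by
  cases n with
  | zero =>
    have := hS.epi_g
    exact (injective_iff_map_eq_zero _).1 (Ext.precomp_mk₀_injective_of_epi Y S.g) α hα
  | succ n =>
    obtain ⟨β, rfl⟩ := Ext.contravariant_sequence_exact₃ hS Y α hα (add_comm 1 n)
    have := h n (Nat.lt_succ_self n)
    rw [Subsingleton.elim β 0, Ext.comp_zero]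

theorem subsingleton_ext_pi {A : Type} [CommRing A] (M : Type) [AddCommGroup M]
    [Module A M] (Y : ModuleCat.{0} A) (n m : ℕ)
    [h : Subsingleton (Abelian.Ext.{0} (ModuleCat.of A M) Y n)] :
    Subsingleton (Abelian.Ext.{0} (ModuleCat.of A (Fin m → M)) Y n) := by
  rw [subsingleton_iff_forall_eq 0]
  intro α
  have hid : 𝟙 (ModuleCat.of A (Fin m → M)) = ∑ i : Fin m,
      ModuleCat.ofHom (LinearMap.proj (R := A) (φ := fun _ : Fin m => M) i) ≫
        ModuleCat.ofHom (LinearMap.single A (fun _ : Fin m => M) i) := by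
    ext x j
    simp [ModuleCat.hom_sum, Pi.single_apply]
  rw [← α.mk₀_id_comp, hid, Abelian.Ext.mk₀_sum, Abelian.Ext.sum_comp]
  refine Finset.sum_eq_zero fun i _ => ?_
  rw [← Abelian.Ext.mk₀_comp_mk₀_assoc,
    Subsingleton.elim ((Abelian.Ext.mk₀ (ModuleCat.ofHom _)).comp α _) 0, Abelian.Ext.comp_zero]

theorem Submodule.exists_surjective_pi_quotient {A : Type} [CommRing A] (𝔞 : Ideal A)
    (M : Type) [AddCommGroup M] [Module A M] [Module.Finite A M]
    (hM : ∀ a ∈ 𝔞, ∀ x : M, a • x = 0) :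
    ∃ (m : ℕ) (f : (Fin m → A ⧸ 𝔞) →ₗ[A] M), Function.Surjective f := by
  obtain ⟨m, s, hs⟩ := Module.Finite.exists_fin (R := A) (M := M)
  refine ⟨m, LinearMap.lsum A (fun _ => A ⧸ 𝔞) A fun i =>
    𝔞.liftQ (LinearMap.toSpanSingleton A M (s i)) fun a ha => hM a ha _, ?_⟩
  rw [← LinearMap.range_eq_top, eq_top_iff, ← hs, Submodule.span_le]
  rintro _ ⟨i, rfl⟩
  refine ⟨Pi.single i 1, ?_⟩
  rw [LinearMap.lsum_piSingle]
  exact (Submodule.liftQ_apply 𝔞 _ (1 : A)).trans (one_smul A (s i))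

/-- If `Ext^j(A/𝔞, Y)` vanishes for `j < n`, so does `Ext^j(M, Y)` for every finitely generated
module `M` annihilated by `𝔞`. -/
theorem subsingleton_ext_of_annihilated {A : Type} [CommRing A] [IsNoetherianRing A] (𝔞 : Ideal A)
    (Y : ModuleCat.{0} A) (n : ℕ)
    (h : ∀ j < n, Subsingleton (Abelian.Ext.{0} (ModuleCat.of A (A ⧸ 𝔞)) Y j)) (j : ℕ)
    (hj : j < n) (M : Type) [AddCommGroup M] [Module A M] [Module.Finite A M]
    (hM : ∀ a ∈ 𝔞, ∀ x : M, a • x = 0) :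
    Subsingleton (Abelian.Ext.{0} (ModuleCat.of A M) Y j) := by
  induction j using Nat.strong_induction_on generalizing M with
  | _ j ih =>
    obtain ⟨m, f, hf⟩ := Submodule.exists_surjective_pi_quotient 𝔞 M hM
    have := h j hj
    have := subsingleton_ext_pi (A ⧸ 𝔞) Y j m
    have hS := LinearMap.shortExact_shortComplexKer hf
    rw [subsingleton_iff_forall_eq 0]
    intro α
    refine Abelian.Ext.eq_zero_of_mk₀_comp_eq_zero hS (fun k hk => ?_) α
      (Subsingleton.elim (α := Abelian.Ext.{0} (ModuleCat.of A (Fin m → A ⧸ 𝔞)) Y j) _ _)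
    refine ih k hk (hk.trans hj) (LinearMap.ker f) fun a ha x => ?_
    ext i
    obtain ⟨b, hb⟩ := Ideal.Quotient.mk_surjective (x.1 i)
    have : a • x.1 i = 0 := by
      rw [← hb, ← Ideal.Quotient.mk_eq_mk, ← Submodule.Quotient.mk_smul,
        Submodule.Quotient.mk_eq_zero]
      exact 𝔞.mul_mem_right b ha
    exact this

/-- If `J ≤ I` and `I / J` is annihilated by `𝔞`, then `Ext^n(A/I, Y) → Ext^n(A/J, Y)` is
injective as soon as `Ext^j(A/𝔞, Y)` vanishes for `j < n`. -/
theorem injective_ext_map_mapQ {A : Type} [CommRing A] [IsNoetherianRing A] (𝔞 I J : Ideal A)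
    (hJI : J ≤ I) (haI : 𝔞 * I ≤ J) (Y : ModuleCat.{0} A) (n : ℕ)
    (h : ∀ j < n, Subsingleton (Abelian.Ext.{0} (ModuleCat.of A (A ⧸ 𝔞)) Y j)) :
    Function.Injective (((Ext A (ModuleCat A) n).map (ModuleCat.ofHom
      (Submodule.mapQ J I LinearMap.id hJI)).op).app Y) := by
  rw [injective_ext_map_iff_injective_mk₀_comp]
  have hf : Function.Surjective (Submodule.mapQ J I LinearMap.id hJI) := by
    intro x
    obtain ⟨a, rfl⟩ := Submodule.mkQ_surjective I x
    exact ⟨J.mkQ a, rfl⟩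
  refine fun α => Abelian.Ext.eq_zero_of_mk₀_comp_eq_zero
    (LinearMap.shortExact_shortComplexKer hf) (fun k hk => ?_) α
  refine subsingleton_ext_of_annihilated 𝔞 Y n h k hk
    (LinearMap.ker (Submodule.mapQ J I LinearMap.id hJI)) ?_
  rintro a ha ⟨x, hx⟩
  obtain ⟨b, rfl⟩ := Submodule.mkQ_surjective J x
  ext
  have hb : b ∈ I := (Submodule.Quotient.mk_eq_zero I).1 hx
  exact (Submodule.Quotient.mk_eq_zero J).2 (haI (Ideal.mul_mem_mul ha hb))

open Limits in
/-- If `H^n_𝔞(N)` vanishes, every element of `Ext^n(A/𝔞^t, N)` dies in some `Ext^n(A/𝔞^s, N)`. -/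
theorem localCohomology.exists_map_eq_zero {A : Type} [CommRing A] (𝔞 : Ideal A)
    (N : ModuleCat.{0} A) (n : ℕ) [Subsingleton ((localCohomology 𝔞 n).obj N)] (t : ℕ)
    (x : ((Ext A (ModuleCat A) n).obj (Opposite.op (ModuleCat.of A (A ⧸ 𝔞 ^ t)))).obj N) :
    ∃ (s : ℕ) (hs : t ≤ s), ((Ext A (ModuleCat A) n).map (ModuleCat.ofHom
      (Submodule.mapQ (𝔞 ^ s) (𝔞 ^ t) LinearMap.id (Ideal.pow_le_pow_right hs))).op).app N x
        = 0 := by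
  let D := localCohomology.diagram (localCohomology.idealPowersDiagram 𝔞) n
  have := localCohomology.hasColimitDiagram.{0, 0} (localCohomology.idealPowersDiagram 𝔞) n
  let E : (ModuleCat.{0} A ⥤ ModuleCat.{0} A) ⥤ ModuleCat.{0} A := (evaluation _ _).obj N
  have hc : IsColimit (E.mapCocone (colimit.cocone D)) :=
    isColimitOfPreserves E (colimit.isColimit D)
  obtain ⟨k, f, g, hk⟩ := Concrete.isColimit_exists_of_rep_eq (D ⋙ E) hc (i := ⟨⟨t⟩⟩) (j := ⟨⟨t⟩⟩)
    x 0 (Subsingleton.elim (α := (localCohomology 𝔞 n).obj N) _ _)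
  refine ⟨k.unop.unop, f.unop.unop.down.down, ?_⟩
  exact hk.trans (map_zero ((D ⋙ E).map g).hom)

/-- If `Ext^j(A/𝔞, Y)` vanishes for `j < n`, the transition maps
`Ext^n(A/𝔞^t, Y) → Ext^n(A/𝔞^s, Y)` are injective. -/
theorem localCohomology.injective_diagram_map {A : Type} [CommRing A] [IsNoetherianRing A]
    (𝔞 : Ideal A) (Y : ModuleCat.{0} A) (n : ℕ)
    (h : ∀ j < n, Subsingleton (Abelian.Ext.{0} (ModuleCat.of A (A ⧸ 𝔞)) Y j))
    (t s : ℕ) (hs : t ≤ s) :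
    Function.Injective (((Ext A (ModuleCat A) n).map (ModuleCat.ofHom
      (Submodule.mapQ (𝔞 ^ s) (𝔞 ^ t) LinearMap.id (Ideal.pow_le_pow_right hs))).op).app Y) := by
  induction s, hs using Nat.le_induction with
  | base =>
    exact injective_ext_map_mapQ 𝔞 (𝔞 ^ t) (𝔞 ^ t) le_rfl Ideal.mul_le_right Y n h
  | succ s hs ih =>
    have hstep := injective_ext_map_mapQ 𝔞 (𝔞 ^ s) (𝔞 ^ (s + 1))
      (Ideal.pow_le_pow_right s.le_succ) (pow_succ' 𝔞 s).ge Y n h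
    have hcomp : ModuleCat.ofHom (Submodule.mapQ (𝔞 ^ (s + 1)) (𝔞 ^ t) LinearMap.id
        (Ideal.pow_le_pow_right (hs.trans s.le_succ))) =
        ModuleCat.ofHom (Submodule.mapQ (𝔞 ^ (s + 1)) (𝔞 ^ s) LinearMap.id
          (Ideal.pow_le_pow_right s.le_succ)) ≫
        ModuleCat.ofHom (Submodule.mapQ (𝔞 ^ s) (𝔞 ^ t) LinearMap.id
          (Ideal.pow_le_pow_right hs)) := by
      ext
      rfl
    rw [hcomp, op_comp, Functor.map_comp, NatTrans.comp_app]
    exact hstep.comp ih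

/-- If all local cohomology modules of `N` with support in `𝔞` vanish, then all
`Ext^i_A(A/𝔞, N)` vanish. -/
theorem stmt0 (A : Type) [CommRing A] [IsNoetherianRing A] (𝔞 : Ideal A)
    (N : Type) [AddCommGroup N] [Module A N]
    (hLC : ∀ s : ℕ, Subsingleton ((localCohomology 𝔞 s).obj (ModuleCat.of A N))) :
    ∀ i : ℕ, Subsingleton
      (((Ext A (ModuleCat A) i).obj
        (Opposite.op (ModuleCat.of A (A ⧸ 𝔞)))).obj (ModuleCat.of A N)) := by
  intro i
  induction i using Nat.strong_induction_on with
  | _ i ih =>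
    have h : ∀ j < i, Subsingleton (Abelian.Ext.{0} (ModuleCat.of A (A ⧸ 𝔞))
        (ModuleCat.of A N) j) := fun j hj =>
      (subsingleton_ext_iff_subsingleton_ext _ _ j).1 (ih j hj)
    have h1 : Subsingleton (((Ext A (ModuleCat A) i).obj
        (Opposite.op (ModuleCat.of A (A ⧸ 𝔞 ^ 1)))).obj (ModuleCat.of A N)) := by
      rw [subsingleton_iff_forall_eq 0]
      intro x
      obtain ⟨s, hs, hx⟩ := localCohomology.exists_map_eq_zero 𝔞 (ModuleCat.of A N) i 1 x
      exact localCohomology.injective_diagram_map 𝔞 _ i h 1 s hs (hx.trans (map_zero _).symm)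
    rwa [pow_one] at h1
end

section
/- Let (A, 𝔪) be a Noetherian local ring and M a finitely generated A-module of dimension d. Suppose there exists x ∈ A, outside every minimal prime of Supp(M), such that x · H^i_𝔪(M) = 0 for all i < d. Then M is equidimensional, i.e. dim(A/𝔭) = d for every minimal prime 𝔭 of Supp(M). -/
open CategoryTheory

/-- The Krull dimension of a module: the Krull dimension of its support. -/
noncomputable def moduleDim (A : Type) [CommRing A] (M : Type) [AddCommGroup M] [Module A M] :
    WithBot ℕ∞ :=
  Order.krullDim (Module.support A M)

section

open Opposite Limits

theorem HomologicalComplex.exists_fac_of_homologyι_comp_eq_zero {C ι : Type*} [Category* C]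
    [Abelian C] {c : ComplexShape ι} (K : HomologicalComplex C c) (i : ι) {J : C} [Injective J]
    (f : K.X i ⟶ J) (hf : K.d (c.prev i) i ≫ f = 0)
    (h : K.homologyι i ≫ K.descOpcycles f _ rfl hf = 0) :
    ∃ g : K.X (c.next i) ⟶ J, K.d i (c.next i) ≫ g = f := by
  have hS : (ShortComplex.mk _ _ (K.homologyι_comp_fromOpcycles i (c.next i))).Exact :=
    ShortComplex.exact_of_f_is_kernel _ (K.homologyIsKernel i _ rfl)
  refine ⟨hS.descToInjective _ h, ?_⟩
  have := hS.comp_descToInjective _ h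
  dsimp at this
  rw [← K.p_fromOpcycles, Category.assoc, this, HomologicalComplex.p_descOpcycles]

variable {A : Type} [CommRing A]

/-- Every class in `Abelian.Ext X M i` is represented by an element of the left-derived `Ext` whose
vanishing, up to scalars and after pullback, forces that of the class. -/
theorem Ext.exists_smul_comp_eq_zero_of_map_smul_eq_zero (M X : ModuleCat.{0} A) (i : ℕ) (η : Abelian.Ext X M i) :
    ∃ e : ((Ext A (ModuleCat.{0} A) i).obj (op X)).obj M,
      ∀ (Y : ModuleCat.{0} A) (g : Y ⟶ X) (a : A),
        (((Ext A (ModuleCat.{0} A) i).map g.op).app M) (a • e) = 0 →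
          (Abelian.Ext.mk₀ g).comp (a • η) (zero_add i) = 0 := by
  let F : ModuleCat.{0} A ⥤ (ModuleCat.{0} A)ᵒᵖ := ((linearYoneda A (ModuleCat.{0} A)).obj M).rightOp
  let P := projectiveResolution X
  obtain ⟨f, hf, rfl⟩ := P.extMk_surjective η (i + 1) rfl
  let KP := (F.mapHomologicalComplex (ComplexShape.down ℕ)).obj P.complex
  let f' : KP.X i ⟶ op (ModuleCat.of A A) :=
    (ModuleCat.ofHom (LinearMap.toSpanSingleton A (P.complex.X i ⟶ M) f)).op
  have hf' : KP.d (i + 1) i ≫ f' = 0 := by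
    apply Quiver.Hom.unop_inj
    ext
    change P.complex.d (i + 1) i ≫ ((1 : A) • f) = 0
    simp [hf]
  let h := KP.homologyι i ≫ KP.descOpcycles f' (i + 1) (by simp) hf'
  refine ⟨((P.isoLeftDerivedObj F i).hom ≫ h).unop (1 : A), fun Y g a H ↦ ?_⟩
  let Q := projectiveResolution Y
  let φ := ProjectiveResolution.lift g Q P
  have comm : φ.f 0 ≫ P.π.f 0 = Q.π.f 0 ≫ g := ProjectiveResolution.lift_commutes_zero g Q P
  let ma : op (ModuleCat.of A A) ⟶ op (ModuleCat.of A A) :=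
    (ModuleCat.ofHom (LinearMap.lsmul A A a)).op
  have H1 : (F.leftDerived i).map g ≫ (P.isoLeftDerivedObj F i).hom ≫ h ≫ ma = 0 := by
    apply Quiver.Hom.unop_inj
    ext
    have e1 := ((P.isoLeftDerivedObj F i).hom ≫ h).unop.hom.map_smul a (1 : A)
    refine Eq.trans (congrArg (((F.leftDerived i).map g).unop.hom) ?_) H
    refine Eq.trans ?_ e1
    simp only [ma, unop_comp]
    rfl
  rw [Q.isoLeftDerivedObj_hom_naturality_assoc g P φ comm] at H1
  have H2 := (cancel_epi _).1 (H1.trans comp_zero.symm)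
  let KQ := (F.mapHomologicalComplex (ComplexShape.down ℕ)).obj Q.complex
  let Φ : KQ ⟶ KP := (F.mapHomologicalComplex (ComplexShape.down ℕ)).map φ
  have hd : KQ.d ((ComplexShape.down ℕ).prev i) i ≫ Φ.f i ≫ f' ≫ ma = 0 := by
    rw [← Φ.comm_assoc, show (ComplexShape.down ℕ).prev i = i + 1 by simp, reassoc_of% hf',
      zero_comp, comp_zero]
  have H3 : KQ.homologyι i ≫ KQ.descOpcycles (Φ.f i ≫ f' ≫ ma) _ rfl hd = 0 := by
    refine Eq.trans ?_ H2
    change _ = HomologicalComplex.homologyMap Φ i ≫ h ≫ ma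
    simp only [h, HomologicalComplex.homologyι_naturality_assoc, Category.assoc]
    congr 1
    rw [← cancel_epi (KQ.pOpcycles i)]
    simp
  have : Projective (ModuleCat.of A A) := ModuleCat.projective_of_free (Module.Basis.singleton Unit A)
  obtain ⟨k, hk⟩ := KQ.exists_fac_of_homologyι_comp_eq_zero i _ hd H3
  obtain ⟨l, hl⟩ : ∃ l : Q.complex.X ((ComplexShape.down ℕ).next i) ⟶ M,
      Q.complex.d i _ ≫ l = φ.f i ≫ (a • f) := by
    refine ⟨k.unop.hom (1 : A), (congrArg (fun t ↦ t.unop.hom (1 : A)) hk).trans ?_⟩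
    change φ.f i ≫ ((a * 1) • f) = _
    rw [mul_one]
  have hs : a • P.extMk f (i + 1) rfl hf = P.extMk (a • f) (i + 1) rfl (by simp [hf]) := by
    rw [Abelian.Ext.smul_eq_comp_mk₀, ProjectiveResolution.extMk_comp_mk₀]
    simp
  let ψ : ProjectiveResolution.Hom Q P g := ⟨φ, by simpa using comm⟩
  rw [hs, ProjectiveResolution.mk₀_comp_extMk _ _ _ _ ψ]
  cases i with
  | zero =>
    have h0 : φ.f 0 ≫ (a • f) = 0 := by
      rw [← hl, Q.complex.shape _ _ (by simp), zero_comp]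
    simp [ψ, h0]
  | succ i =>
    rw [ProjectiveResolution.extMk_eq_zero_iff _ _ _ _ _ i rfl]
    have e : (ComplexShape.down ℕ).next (i + 1) = i := by simp
    generalize (ComplexShape.down ℕ).next (i + 1) = p at e l hl
    subst e
    exact ⟨_, hl.trans (by simp [ψ])⟩

/-- If `x` kills the local cohomology `H^i_I(M)`, then for `η ∈ Ext^i(A/I^n, M)` the class `x • η`
vanishes after pullback to some `A/I^m`. -/
theorem localCohomology.exists_pow_comp_eq_zero {I : Ideal A} {i : ℕ} {M : ModuleCat.{0} A} {x : A}
    (hx : x ∈ Module.annihilator A ((localCohomology I i).obj M)) (n : ℕ)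
    (η : Abelian.Ext (ModuleCat.of A (A ⧸ I ^ n)) M i) :
    ∃ m, ∃ h : n ≤ m, (Abelian.Ext.mk₀ (ModuleCat.ofHom
      (Submodule.factor (Ideal.pow_le_pow_right (I := I) h)))).comp (x • η) (zero_add i) = 0 := by
  obtain ⟨e, he⟩ := Ext.exists_smul_comp_eq_zero_of_map_smul_eq_zero M _ i η
  let D := diagram (idealPowersDiagram I) i
  let G : ℕᵒᵖᵒᵖ ⥤ ModuleCat.{0} A := D ⋙ (evaluation _ _).obj M
  have hcol : IsColimit (((evaluation _ _).obj M).mapCocone (colimit.cocone D)) :=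
    isColimitOfPreserves _ (colimit.isColimit D)
  have hz : ((((evaluation _ _).obj M).mapCocone (colimit.cocone D)).ι.app (op (op n))).hom (x • e)
      = 0 := by
    refine (LinearMap.map_smul _ x e).trans ?_
    exact Module.mem_annihilator.1 hx _
  obtain ⟨k, u, v, huv⟩ := Concrete.isColimit_exists_of_rep_eq G hcol (i := op (op n))
    (j := op (op n)) (x • e) 0 (hz.trans (map_zero _).symm)
  refine ⟨k.unop.unop, u.unop.unop.le, he _ _ _ ?_⟩
  rw [map_zero] at huv
  exact huv

theorem Abelian.Ext.pi_eq_zero {n k : ℕ} {M Y : ModuleCat.{0} A}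
    (ζ : Abelian.Ext (ModuleCat.of A (Fin k → Y)) M n)
    (h : ∀ a, (Abelian.Ext.mk₀ (ModuleCat.ofHom
      (LinearMap.single A (fun _ : Fin k ↦ (Y : Type)) a))).comp ζ (zero_add n) = 0) : ζ = 0 := by
  have hid : 𝟙 (ModuleCat.of A (Fin k → Y)) = ∑ a : Fin k,
      ModuleCat.ofHom (LinearMap.proj a) ≫ ModuleCat.ofHom
        (LinearMap.single A (fun _ : Fin k ↦ (Y : Type)) a) := by
    ext1
    rw [ModuleCat.hom_sum]
    refine LinearMap.ext fun v ↦ ?_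
    rw [LinearMap.sum_apply]
    exact (Finset.univ_sum_single v).symm
  rw [← Abelian.Ext.mk₀_id_comp ζ, hid, Abelian.Ext.mk₀_sum, Abelian.Ext.sum_comp]
  refine Finset.sum_eq_zero fun a _ ↦ ?_
  rw [← Abelian.Ext.mk₀_comp_mk₀_assoc, h, Abelian.Ext.comp_zero]

theorem localCohomology.exists_surjective_comp_eq_zero {I : Ideal A} {j : ℕ} {M : ModuleCat.{0} A}
    {x : A} (hx : x ∈ Module.annihilator A ((localCohomology I j).obj M)) {n : ℕ}
    (X : ModuleCat.{0} A) [Module.Finite A X] (hX : I ^ n ≤ Module.annihilator A X)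
    (ξ : Abelian.Ext X M j) :
    ∃ (m k : ℕ) (f : (Fin k → A ⧸ I ^ m) →ₗ[A] X), Function.Surjective f ∧
      (Abelian.Ext.mk₀ (ModuleCat.ofHom f)).comp (x • ξ) (zero_add j) = 0 := by
  obtain ⟨k, s, hs⟩ := Module.Finite.exists_fin (R := A) (M := X)
  let φ (a : Fin k) : (A ⧸ I ^ n) →ₗ[A] X := Submodule.liftQ _ (LinearMap.toSpanSingleton A X (s a))
    fun r hr ↦ by
      rw [LinearMap.mem_ker, LinearMap.toSpanSingleton_apply]
      exact Module.mem_annihilator.1 (hX hr) (s a)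
  choose m hnm hm using fun a ↦ exists_pow_comp_eq_zero hx n
    ((Abelian.Ext.mk₀ (ModuleCat.ofHom (φ a))).comp ξ (zero_add j))
  let N := n ⊔ Finset.univ.sup m
  have hmN a : m a ≤ N := (Finset.le_sup (Finset.mem_univ a)).trans le_sup_right
  let t : (A ⧸ I ^ N) →ₗ[A] A ⧸ I ^ n := Submodule.factor (Ideal.pow_le_pow_right le_sup_left)
  let f : (Fin k → A ⧸ I ^ N) →ₗ[A] X := LinearMap.lsum A _ A fun a ↦ φ a ∘ₗ t
  have hf a : f ∘ₗ LinearMap.single A _ a = φ a ∘ₗ t := by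
    ext
    simp [f, LinearMap.lsum_apply, Pi.single_apply, apply_ite]
  refine ⟨N, k, f, ?_, Abelian.Ext.pi_eq_zero (Y := ModuleCat.of A (A ⧸ I ^ N)) _ fun a ↦ ?_⟩
  · rw [← LinearMap.range_eq_top, ← top_le_iff, ← hs, Submodule.span_le]
    rintro _ ⟨a, rfl⟩
    refine ⟨Pi.single a (Submodule.Quotient.mk 1), ?_⟩
    refine (LinearMap.congr_fun (hf a) (Submodule.Quotient.mk 1)).trans ?_
    simp [φ, t, -Ideal.Quotient.mk_eq_mk]
  · let u : (A ⧸ I ^ N) →ₗ[A] A ⧸ I ^ m a := Submodule.factor (Ideal.pow_le_pow_right (hmN a))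
    have ht : φ a ∘ₗ t =
        φ a ∘ₗ Submodule.factor (Ideal.pow_le_pow_right (I := I) (hnm a)) ∘ₗ u := by
      ext
      simp [t, u, -Ideal.Quotient.mk_eq_mk]
    have := congrArg (fun ζ ↦ (Abelian.Ext.mk₀ (ModuleCat.ofHom u)).comp ζ (zero_add j)) (hm a)
    simp only [← Abelian.Ext.comp_smul, Abelian.Ext.mk₀_comp_mk₀_assoc, Abelian.Ext.comp_zero,
      ← ModuleCat.ofHom_comp] at this
    rw [Abelian.Ext.mk₀_comp_mk₀_assoc, ← this, ← ModuleCat.ofHom_comp, hf, ht]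

/-- If `x` kills `H^i_I(M)` for all `i < d`, then `x ^ (j + 1)` kills `Ext^j(X, M)` for `j < d` and
every finitely generated `I`-power torsion module `X`. -/
theorem Abelian.Ext.pow_smul_eq_zero_of_pow_le_annihilator [IsNoetherianRing A] {I : Ideal A}
    {d : ℕ} {M : ModuleCat.{0} A} {x : A}
    (hx : ∀ i < d, x ∈ Module.annihilator A ((localCohomology I i).obj M)) {j : ℕ} (hj : j < d)
    {n : ℕ} (X : ModuleCat.{0} A) [Module.Finite A X] (hX : I ^ n ≤ Module.annihilator A X)
    (ξ : Abelian.Ext X M j) : x ^ (j + 1) • ξ = 0 := by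
  induction j generalizing n X with
  | zero =>
    obtain ⟨m, k, f, hf, h⟩ := localCohomology.exists_surjective_comp_eq_zero (hx _ hj) X hX ξ
    have : Epi (ModuleCat.ofHom f) := (ModuleCat.epi_iff_surjective _).2 hf
    rw [zero_add, pow_one]
    exact Abelian.Ext.precomp_mk₀_injective_of_epi M (ModuleCat.ofHom f) (h.trans (map_zero _).symm)
  | succ j ih =>
    obtain ⟨m, k, f, hf, h⟩ := localCohomology.exists_surjective_comp_eq_zero (hx _ hj) X hX ξ
    obtain ⟨ζ, hζ⟩ := Abelian.Ext.contravariant_sequence_exact₃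
      (LinearMap.shortExact_shortComplexKer hf) M (x • ξ) h (add_comm 1 j)
    have hK : I ^ m ≤ Module.annihilator A (LinearMap.ker f) := fun r hr ↦ by
      rw [Module.mem_annihilator]
      rintro ⟨v, hv⟩
      ext a
      obtain ⟨b, hb⟩ := Submodule.Quotient.mk_surjective _ (v a)
      change r • v a = 0
      rw [← hb, ← Submodule.Quotient.mk_smul, Submodule.Quotient.mk_eq_zero]
      exact Ideal.mul_mem_right _ _ hr
    have : Module.Finite A (LinearMap.shortComplexKer f).X₁ :=
      inferInstanceAs (Module.Finite A (LinearMap.ker f))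
    rw [pow_succ, mul_smul, ← hζ, ← Abelian.Ext.comp_smul, ih (by lia) _ hK ζ,
      Abelian.Ext.comp_zero]

theorem Abelian.Ext.exists_smul_eq_smul_of_isSMulRegular {M N : ModuleCat.{0} A} {r z : A}
    (hr : IsSMulRegular N r) {j : ℕ}
    (hz : ∀ ξ : Abelian.Ext (ModuleCat.of A (QuotSMulTop r N)) M (j + 1), z • ξ = 0)
    (ζ : Abelian.Ext N M j) : ∃ ζ' : Abelian.Ext N M j, r • ζ' = z • ζ := by
  have hS := hr.smulShortComplex_shortExact
  obtain ⟨ζ' : Abelian.Ext N M j, hζ' : (Abelian.Ext.mk₀ (r • 𝟙 N)).comp ζ' (zero_add j) = z • ζ⟩ :=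
    Abelian.Ext.contravariant_sequence_exact₁ hS M (z • ζ) (add_comm 1 j)
      ((Abelian.Ext.comp_smul hS.extClass ζ (add_comm 1 j) z).trans (hz _))
  rw [Abelian.Ext.mk₀_smul, Abelian.Ext.smul_comp, Abelian.Ext.mk₀_id_comp] at hζ'
  exact ⟨ζ', hζ'⟩

/-- If `x` kills `H^i_𝔪(M)` for all `i < d` and `j + s < d`, then a uniform power of `x` kills
`Ext^j(X, M)` for every finitely generated module `X` having a system of parameters, up to radical,
of length `s`. -/
theorem Abelian.Ext.exists_pow_smul_eq_zero_of_le_radical [IsNoetherianRing A] [IsLocalRing A]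
    {d : ℕ} {M : ModuleCat.{0} A} [Module.Finite A M] {x : A}
    (hx : ∀ i < d, x ∈ Module.annihilator A
      ((localCohomology (IsLocalRing.maximalIdeal A) i).obj M)) (s : ℕ) {j : ℕ} (hj : j + s < d) :
    ∃ c : ℕ, ∀ (l : List A) (_ : l.length = s) (_ : ∀ y ∈ l, y ∈ IsLocalRing.maximalIdeal A)
      (X : ModuleCat.{0} A) [Module.Finite A X]
      (_ : IsLocalRing.maximalIdeal A ≤ (Module.annihilator A X ⊔ Ideal.ofList l).radical)
      (ξ : Abelian.Ext X M j), x ^ c • ξ = 0 := by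
  induction s generalizing j with
  | zero =>
    refine ⟨j + 1, fun l hl _ X _ hX ξ ↦ ?_⟩
    rw [List.length_eq_zero_iff.1 hl, Ideal.ofList_nil, sup_bot_eq] at hX
    obtain ⟨n, hn⟩ := Ideal.exists_pow_le_of_le_radical_of_fg hX (IsNoetherian.noetherian _)
    exact Abelian.Ext.pow_smul_eq_zero_of_pow_le_annihilator hx (by lia) X hn ξ
  | succ s ih =>
    obtain ⟨a, ha⟩ := ih (j := j) (by lia)
    obtain ⟨b, hb⟩ := ih (j := j + 1) (by lia)
    refine ⟨a + b, fun l hl hlm X _ hX ξ ↦ ?_⟩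
    obtain ⟨y, l, rfl⟩ := List.exists_cons_of_length_eq_add_one hl
    have hlm' : ∀ y ∈ l, y ∈ IsLocalRing.maximalIdeal A := fun z hz ↦ hlm z (by simp [hz])
    have hl' : l.length = s := by simpa using hl
    have hle {J : Ideal A} {n : ℕ} (hJ : Module.annihilator A X ≤ J) (hy : y ^ n ∈ J) :
        IsLocalRing.maximalIdeal A ≤ (J ⊔ Ideal.ofList l).radical := by
      refine hX.trans (Ideal.radical_le_radical_iff.2 ?_)
      rw [Ideal.ofList_cons]
      refine sup_le (hJ.trans (le_sup_left.trans Ideal.le_radical)) (sup_le ?_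
        (le_sup_right.trans Ideal.le_radical))
      rw [Ideal.span_singleton_le_iff_mem]
      exact ⟨n, Ideal.mem_sup_left hy⟩
    obtain ⟨n, hn⟩ := monotone_stabilizes_iff_noetherian.2 (inferInstance : IsNoetherian A X)
      (LinearMap.iterateKer (LinearMap.lsmul A X y))
    have hmem (m : ℕ) (v : X) :
        v ∈ (LinearMap.iterateKer (LinearMap.lsmul A X y)) m ↔ y ^ m • v = 0 := by
      change ((Algebra.lsmul A A X y) ^ m) v = 0 ↔ _
      rw [← map_pow]
      rfl
    set K : Submodule A X := LinearMap.iterateKer (LinearMap.lsmul A X y) n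
    have hreg : IsSMulRegular (X ⧸ K) y := by
      refine (isSMulRegular_iff_right_eq_zero_of_smul).2 fun v hv ↦ ?_
      obtain ⟨v, rfl⟩ := K.mkQ_surjective v
      rw [Submodule.mkQ_apply] at hv ⊢
      rw [← Submodule.Quotient.mk_smul, Submodule.Quotient.mk_eq_zero, hmem, smul_smul,
        ← pow_succ, ← hmem, ← hn _ (Nat.le_succ n)] at hv
      rwa [Submodule.Quotient.mk_eq_zero]
    have hann : Module.annihilator A X ≤ Module.annihilator A (X ⧸ K) :=
      LinearMap.annihilator_le_of_surjective _ K.mkQ_surjective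
    have key (ζ : Abelian.Ext (ModuleCat.of A (X ⧸ K)) M j) : x ^ b • ζ = 0 := by
      have : x ^ b • ζ ∈ (⨅ m : ℕ, IsLocalRing.maximalIdeal A ^ m • ⊤ :
          Submodule A (Abelian.Ext (ModuleCat.of A (X ⧸ K)) M j)) := by
        refine Submodule.mem_iInf _ |>.2 fun m ↦ ?_
        have hpow : y ^ m ∈ Module.annihilator A (QuotSMulTop (y ^ m) (X ⧸ K)) := by
          refine Module.mem_annihilator.2 fun v ↦ ?_
          obtain ⟨v, rfl⟩ := Submodule.mkQ_surjective _ v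
          rw [← map_smul, Submodule.mkQ_apply, Submodule.Quotient.mk_eq_zero]
          exact Submodule.smul_mem_pointwise_smul _ _ _ trivial
        obtain ⟨ζ', hζ'⟩ := Abelian.Ext.exists_smul_eq_smul_of_isSMulRegular
          (N := ModuleCat.of A (X ⧸ K)) (hreg.pow m) (hb l hl' hlm'
            (ModuleCat.of A (QuotSMulTop (y ^ m) (X ⧸ K))) (hle (hann.trans
              (LinearMap.annihilator_le_of_surjective _ (Submodule.mkQ_surjective _))) hpow)) ζ
        rw [← hζ']
        exact Submodule.smul_mem_smul (Ideal.pow_mem_pow (hlm y (by simp)) m) trivial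
      rwa [Ideal.iInf_pow_smul_eq_bot_of_isLocalRing _ (IsLocalRing.maximalIdeal.isMaximal A).ne_top]
        at this
    have hS : (ShortComplex.mk (ModuleCat.ofHom K.subtype) (ModuleCat.ofHom K.mkQ)
        (by ext; simp)).ShortExact :=
      ModuleCat.shortComplex_shortExact _ (LinearMap.exact_subtype_mkQ K) K.subtype_injective
        K.mkQ_surjective
    have hK := ha l hl' hlm' (ModuleCat.of A K) (hle (n := n)
        (LinearMap.annihilator_le_of_injective _ K.subtype_injective)
        (Module.mem_annihilator.2 fun v ↦ Subtype.ext ((hmem n v).1 v.2)))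
      ((Abelian.Ext.mk₀ (ModuleCat.ofHom K.subtype)).comp ξ (zero_add j))
    rw [← Abelian.Ext.comp_smul] at hK
    obtain ⟨ζ, hζ⟩ := Abelian.Ext.contravariant_sequence_exact₂ hS _ _ hK
    rw [add_comm, pow_add, mul_smul, ← hζ, ← Abelian.Ext.comp_smul, key, Abelian.Ext.comp_zero]

/-- Systems of parameters of `A/𝔭`, lifted to `A`. -/
theorem IsLocalRing.exists_list_length_eq_ringKrullDim_quotient [IsNoetherianRing A]
    [IsLocalRing A] (𝔭 : Ideal A) [𝔭.IsPrime] :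
    ∃ l : List A, (∀ y ∈ l, y ∈ maximalIdeal A) ∧
      maximalIdeal A ≤ (𝔭 ⊔ Ideal.ofList l).radical ∧ (l.length : ℕ∞) = ringKrullDim (A ⧸ 𝔭) := by
  have : IsLocalHom (Ideal.Quotient.mk 𝔭) := .of_surjective _ Ideal.Quotient.mk_surjective
  have hloc : IsLocalRing (A ⧸ 𝔭) := .of_surjective' _ Ideal.Quotient.mk_surjective
  obtain ⟨s, hs, hcard⟩ := (maximalIdeal (A ⧸ 𝔭)).exists_finset_card_eq_height_of_isNoetherianRing
  have hmk := Ideal.Quotient.mk_surjective (I := 𝔭)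
  have hmap : (s.toList.map (Function.surjInv hmk)).map (Ideal.Quotient.mk 𝔭) = s.toList := by
    simp [Function.comp_def, Function.surjInv_eq]
  have hspan : (Ideal.ofList (s.toList.map (Function.surjInv hmk))).map (Ideal.Quotient.mk 𝔭) =
      Ideal.span s := by
    rw [Ideal.map_ofList, hmap, Ideal.ofList]
    simp
  refine ⟨s.toList.map (Function.surjInv hmk), fun y hy ↦ ?_, fun y hy ↦ ?_, ?_⟩
  · obtain ⟨z, hz, rfl⟩ := List.mem_map.1 hy
    have : z ∈ maximalIdeal (A ⧸ 𝔭) := hs.1.2 (Ideal.subset_span (by simpa using hz))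
    rwa [← Function.surjInv_eq hmk z, ← Ideal.mem_comap, maximalIdeal_comap] at this
  · have hy' : Ideal.Quotient.mk 𝔭 y ∈ (Ideal.span (s : Set (A ⧸ 𝔭))).radical := by
      rw [Ideal.radical_eq_sInf, Ideal.mem_sInf]
      rintro J ⟨hJ, hJp⟩
      refine hs.2 ⟨hJp, hJ⟩ (le_maximalIdeal hJp.ne_top) ?_
      rwa [← Ideal.mem_comap, maximalIdeal_comap]
    rwa [← hspan, ← Ideal.mem_comap, Ideal.comap_radical, Ideal.comap_map_of_surjective _ hmk,
      ← RingHom.ker_eq_comap_bot, Ideal.mk_ker, sup_comm] at hy'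
  · rw [← maximalIdeal_height_eq_ringKrullDim, ← hcard]
    simp

end

/-- Over a Noetherian local ring, a finitely generated module of dimension `d` admitting a
uniform local cohomological annihilator `x` is equidimensional. -/
theorem stmt6 (A : Type) [CommRing A] [IsNoetherianRing A] [IsLocalRing A]
    (M : Type) [AddCommGroup M] [Module A M] [Module.Finite A M]
    (d : ℕ) (hd : moduleDim A M = (d : ℕ∞))
    (x : A) (hxmin : ∀ 𝔭 ∈ (Module.annihilator A M).minimalPrimes, x ∉ 𝔭)
    (hxlc : ∀ i < d, x ∈ Module.annihilator A
      ((localCohomology (IsLocalRing.maximalIdeal A) i).obj (ModuleCat.of A M))) :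
    ∀ 𝔭 ∈ (Module.annihilator A M).minimalPrimes,
      ringKrullDim (A ⧸ 𝔭) = ((d : ℕ∞) : WithBot ℕ∞) := by
  intro 𝔭 h𝔭
  have hprime := h𝔭.isPrime
  refine le_antisymm ?_ (le_of_not_gt fun hlt ↦ hxmin 𝔭 h𝔭 ?_)
  · rw [← hd]
    change _ ≤ Module.supportDim A M
    rw [Module.supportDim_eq_ringKrullDim_quotient_annihilator]
    exact ringKrullDim_le_of_surjective _ (Ideal.Quotient.factor_surjective h𝔭.1.2)
  obtain ⟨l, hlm, hl, hlen⟩ := IsLocalRing.exists_list_length_eq_ringKrullDim_quotient 𝔭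
  rw [← hlen] at hlt
  have hlt' : 0 + l.length < d := by
    rw [zero_add]
    exact_mod_cast hlt
  obtain ⟨c, hc⟩ := Abelian.Ext.exists_pow_smul_eq_zero_of_le_radical hxlc l.length hlt'
  obtain ⟨-, f, hf⟩ := (isAssociatedPrime_iff_exists_injective_linearMap 𝔭 M).1
    (Module.associatedPrimes.minimalPrimes_annihilator_subset_associatedPrimes A M h𝔭)
  have hzero := hc l rfl hlm (ModuleCat.of A (A ⧸ 𝔭))
    (hl.trans_eq (congrArg (fun I ↦ (I ⊔ Ideal.ofList l).radical) Ideal.annihilator_quotient.symm))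
    (Abelian.Ext.mk₀ (ModuleCat.ofHom f))
  rw [← Abelian.Ext.mk₀_smul, Abelian.Ext.mk₀_eq_zero_iff] at hzero
  have hone : x ^ c • f (Submodule.Quotient.mk 1) = 0 :=
    LinearMap.congr_fun (congrArg ModuleCat.Hom.hom hzero) (Submodule.Quotient.mk 1)
  rw [← map_smul, map_eq_zero_iff f hf, ← Submodule.Quotient.mk_smul,
    Submodule.Quotient.mk_eq_zero, smul_eq_mul, mul_one] at hone
  exact hprime.mem_of_pow_mem c hone
end

section
/- Let A be a Noetherian ring, M a finitely generated A-module, and 𝔞 an ideal with 𝔞M ≠ M. Set h = ht_M(𝔞). Then the annihilator 0 :_A H^h_𝔞(M) is contained in the union of the minimal primes of Supp(M). -/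
open CategoryTheory

/-- The dimension `dim_{A_𝔭}(M_𝔭)` of the localization of `M` at a prime `𝔭`. -/
noncomputable def moduleDimAt (A : Type) [CommRing A] (M : Type) [AddCommGroup M] [Module A M]
    (𝔭 : Ideal A) (h𝔭 : 𝔭.IsPrime) : WithBot ℕ∞ :=
  letI := h𝔭
  Order.krullDim
    (Module.support (Localization.AtPrime 𝔭) (LocalizedModule 𝔭.primeCompl M))

/-- The `M`-height of an ideal `𝔞`: `inf {dim M_𝔭 : 𝔭 ∈ Supp M ∩ V(𝔞)}`. -/
noncomputable def heightM (A : Type) [CommRing A] (M : Type) [AddCommGroup M] [Module A M]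
    (𝔞 : Ideal A) : WithBot ℕ∞ :=
  ⨅ 𝔭 ∈ {𝔭 : PrimeSpectrum A | 𝔭 ∈ Module.support A M ∧ 𝔞 ≤ 𝔭.asIdeal},
    moduleDimAt A M 𝔭.asIdeal 𝔭.isPrime

/-- A module which is `x`-power torsion and whose `x`-torsion is Artinian is Artinian. -/
lemma isArtinian_of_pow_smul_eq_zero {R H : Type*} [CommRing R] [AddCommGroup H] [Module R H]
    (x : R) (hx : ∀ y : H, ∃ n : ℕ, x ^ n • y = 0)
    (hker : IsArtinian R (LinearMap.ker (LinearMap.lsmul R H x))) : IsArtinian R H := by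
  rw [← monotone_stabilizes_iff_artinian]
  intro f
  let K : ℕ → Submodule R H := fun m ↦ OrderDual.ofDual (f m)
  have hK : Antitone K := fun m n hmn ↦ f.monotone hmn
  let T := LinearMap.ker (LinearMap.lsmul R H x)
  let g : ℕ → ℕ → Submodule R T := fun m n ↦
    ((K m).map (LinearMap.lsmul R H (x ^ n))).comap T.subtype
  have mem_g {m n : ℕ} {t : T} : t ∈ g m n ↔ ∃ y ∈ K m, x ^ n • y = t := Iff.rfl
  have hg₁ {n : ℕ} : Antitone (fun m ↦ g m n) := by
    rintro m m' hm t ⟨y, hy, hyt⟩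
    exact ⟨y, hK hm hy, hyt⟩
  have hg₂ {m : ℕ} : Antitone (g m) := by
    rintro n n' hn t ⟨y, hy, hyt⟩
    refine ⟨x ^ (n' - n) • y, (K m).smul_mem _ hy, ?_⟩
    rw [← hyt]
    simp [← mul_smul, ← pow_add, hn]
  obtain ⟨-, ⟨⟨m₀, n₀⟩, rfl⟩, hmin⟩ := IsArtinian.set_has_minimal
    (Set.range fun p : ℕ × ℕ ↦ g p.1 p.2) (Set.range_nonempty _)
  have hst : ∀ n, ∃ m, ∀ m' ≥ m, g m' n = g m n := by
    intro n
    obtain ⟨-, ⟨m, rfl⟩, hm⟩ := IsArtinian.set_has_minimal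
      (Set.range fun m : ℕ ↦ g m n) (Set.range_nonempty _)
    exact ⟨m, fun m' hm' ↦ (hg₁ hm').eq_of_not_lt (hm _ ⟨m', rfl⟩)⟩
  choose μ hμ using hst
  let m₁ := max m₀ ((Finset.range n₀).sup μ)
  have key : ∀ m ≥ m₁, ∀ n, g m n = g m₁ n := by
    intro m hm n
    rcases lt_or_ge n n₀ with hn | hn
    · have h1 : μ n ≤ m₁ :=
        (Finset.le_sup (f := μ) (Finset.mem_range.2 hn)).trans (le_max_right _ _)
      rw [hμ n m (h1.trans hm), hμ n m₁ h1]
    · have h2 : ∀ m' ≥ m₀, g m' n = g m₀ n₀ := fun m' hm' ↦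
        ((hg₁ hm').trans (hg₂ hn)).eq_of_not_lt (hmin _ ⟨(m', n), rfl⟩)
      have h3 : m₀ ≤ m₁ := le_max_left _ _
      rw [h2 m (h3.trans hm), h2 m₁ h3]
  refine ⟨m₁, fun m hm ↦ ?_⟩
  have hle : K m₁ ≤ K m := by
    have : ∀ n, ∀ y ∈ K m₁, x ^ n • y = 0 → y ∈ K m := by
      intro n
      induction n with
      | zero =>
        intro y _ hy0
        rw [pow_zero, one_smul] at hy0
        exact hy0 ▸ (K m).zero_mem
      | succ n ih =>
        intro y hy hy0
        have ht : x ^ n • y ∈ T := by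
          change x • x ^ n • y = 0
          rw [← mul_smul, ← pow_succ', hy0]
        have h4 : (⟨x ^ n • y, ht⟩ : T) ∈ g m₁ n := ⟨y, hy, rfl⟩
        rw [← key m hm n] at h4
        obtain ⟨y', hy', hyy⟩ := h4
        have h5 := ih (y - y') (sub_mem hy (hK hm hy')) (by
          rw [smul_sub, sub_eq_zero]; exact hyy.symm)
        simpa using add_mem h5 hy'
    intro y hy
    obtain ⟨n, hn⟩ := hx y
    exact this n y hy hn
  exact le_antisymm (α := Submodule R H) hle (hK hm)

namespace PowerExt

open CategoryTheory.Abelian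

section

variable {A : Type} [CommRing A] (𝔞 : Ideal A)

/-- The quotient map `A ⧸ 𝔞 ^ t ⟶ A ⧸ 𝔞 ^ s` for `s ≤ t`. -/
noncomputable def proj {s t : ℕ} (hst : s ≤ t) :
    ModuleCat.of A (A ⧸ 𝔞 ^ t) ⟶ ModuleCat.of A (A ⧸ 𝔞 ^ s) :=
  ModuleCat.ofHom (Submodule.mapQ _ _ LinearMap.id (Ideal.pow_le_pow_right hst))

lemma proj_refl (s : ℕ) : proj 𝔞 (le_refl s) = 𝟙 _ := by
  ext
  rfl

lemma proj_comp {s t u : ℕ} (hst : s ≤ t) (htu : t ≤ u) :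
    proj 𝔞 htu ≫ proj 𝔞 hst = proj 𝔞 (hst.trans htu) := by
  ext
  rfl

/-- The transition maps of the direct system `Ext (A ⧸ 𝔞 ^ t, N)`. -/
noncomputable def trans (N : ModuleCat.{0} A) (i : ℕ) (s t : ℕ) (hst : s ≤ t) :
    Ext (ModuleCat.of A (A ⧸ 𝔞 ^ s)) N i →ₗ[A] Ext (ModuleCat.of A (A ⧸ 𝔞 ^ t)) N i :=
  Ext.precompOfLinear (Ext.mk₀ (proj 𝔞 hst)) A N (zero_add i)

lemma trans_apply {N : ModuleCat.{0} A} {i s t : ℕ} (hst : s ≤ t)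
    (e : Ext (ModuleCat.of A (A ⧸ 𝔞 ^ s)) N i) :
    trans 𝔞 N i s t hst e = (Ext.mk₀ (proj 𝔞 hst)).comp e (zero_add i) := rfl

instance (N : ModuleCat.{0} A) (i : ℕ) :
    DirectedSystem (fun t : ℕ ↦ Ext (ModuleCat.of A (A ⧸ 𝔞 ^ t)) N i)
      (fun s t h ↦ trans 𝔞 N i s t h) where
  map_self s x := by
    rw [trans_apply, proj_refl, Ext.mk₀_id_comp]
  map_map {s t u} hst htu x := by
    rw [trans_apply, trans_apply, trans_apply, ← proj_comp 𝔞 hst htu, Ext.mk₀_comp_mk₀_assoc]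

/-- The module `colim_t Ext^i (A ⧸ 𝔞 ^ t, N)`. -/
abbrev LC (N : ModuleCat.{0} A) (i : ℕ) : Type :=
  Module.DirectLimit (fun t : ℕ ↦ Ext (ModuleCat.of A (A ⧸ 𝔞 ^ t)) N i) (trans 𝔞 N i)

/-- The canonical map from a stage of the direct system. -/
noncomputable abbrev LC.of (N : ModuleCat.{0} A) (i t : ℕ) :
    Ext (ModuleCat.of A (A ⧸ 𝔞 ^ t)) N i →ₗ[A] LC 𝔞 N i :=
  Module.DirectLimit.of A ℕ _ (trans 𝔞 N i) t

variable {𝔞}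

lemma LC.of_eq_zero {N : ModuleCat.{0} A} {i s : ℕ}
    {e : Ext (ModuleCat.of A (A ⧸ 𝔞 ^ s)) N i} (he : LC.of 𝔞 N i s e = 0) :
    ∃ t, ∃ hst : s ≤ t, (Ext.mk₀ (proj 𝔞 hst)).comp e (zero_add i) = 0 :=
  Module.DirectLimit.of.zero_exact he

lemma LC.of_proj {N : ModuleCat.{0} A} {i s t : ℕ} (hst : s ≤ t)
    (e : Ext (ModuleCat.of A (A ⧸ 𝔞 ^ s)) N i) :
    LC.of 𝔞 N i t ((Ext.mk₀ (proj 𝔞 hst)).comp e (zero_add i)) = LC.of 𝔞 N i s e :=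
  Module.DirectLimit.of_f (f := trans 𝔞 N i) (hij := hst) (x := e)

variable (𝔞)

/-- Composition with an extension class, on direct limits. -/
noncomputable def LC.comp {N N' : ModuleCat.{0} A} {j : ℕ} (β : Ext N N' j) {i k : ℕ}
    (h : i + j = k) : LC 𝔞 N i →ₗ[A] LC 𝔞 N' k :=
  Module.DirectLimit.map (fun t ↦ Ext.postcompOfLinear β A (ModuleCat.of A (A ⧸ 𝔞 ^ t)) h)
    (fun s t hst ↦ by
      ext e
      exact Ext.comp_assoc _ _ _ (zero_add i) h (by lia))

variable {𝔞}

lemma LC.comp_of {N N' : ModuleCat.{0} A} {j : ℕ} (β : Ext N N' j) {i k : ℕ}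
    (h : i + j = k) (t : ℕ) (e : Ext (ModuleCat.of A (A ⧸ 𝔞 ^ t)) N i) :
    LC.comp 𝔞 β h (LC.of 𝔞 N i t e) = LC.of 𝔞 N' k t (e.comp β h) :=
  Module.DirectLimit.map_apply_of _ _ _

lemma LC.exact_comp {N N' N'' : ModuleCat.{0} A} {j j' : ℕ} (β : Ext N N' j) (β' : Ext N' N'' j')
    {i k l : ℕ} (h : i + j = k) (h' : k + j' = l) (hβ : β.comp β' rfl = 0)
    (H : ∀ (X : ModuleCat.{0} A) (e : Ext X N' k), e.comp β' h' = 0 →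
      ∃ e' : Ext X N i, e'.comp β h = e) :
    Function.Exact (LC.comp 𝔞 β h) (LC.comp 𝔞 β' h') := by
  intro y
  constructor
  · intro hy
    obtain ⟨s, e, rfl⟩ := Module.DirectLimit.exists_of y
    rw [LC.comp_of] at hy
    obtain ⟨t, hst, ht⟩ := LC.of_eq_zero hy
    rw [← Ext.comp_assoc _ _ _ (zero_add k) h' (by lia)] at ht
    obtain ⟨e', he'⟩ := H _ _ ht
    exact ⟨LC.of 𝔞 N i t e', by rw [LC.comp_of, he', LC.of_proj]⟩
  · rintro ⟨x, rfl⟩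
    obtain ⟨s, e, rfl⟩ := Module.DirectLimit.exists_of x
    rw [LC.comp_of, LC.comp_of, Ext.comp_assoc _ _ _ h rfl (by lia), hβ, Ext.comp_zero, map_zero]

/-- The map on `LC` induced by a linear map. -/
noncomputable def LC.map (𝔞 : Ideal A) {N N' : Type} [AddCommGroup N] [Module A N] [AddCommGroup N']
    [Module A N'] (f : N →ₗ[A] N') (i : ℕ) :
    LC 𝔞 (ModuleCat.of A N) i →ₗ[A] LC 𝔞 (ModuleCat.of A N') i :=
  LC.comp 𝔞 (Ext.mk₀ (ModuleCat.ofHom f)) (add_zero i)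

lemma LC.map_smul_id {N : Type} [AddCommGroup N] [Module A N] (r : A) (i : ℕ) :
    LC.map 𝔞 (r • LinearMap.id : N →ₗ[A] N) i = r • LinearMap.id := by
  ext t e
  simp only [LinearMap.comp_apply, LC.map]
  erw [LC.comp_of]
  have : (Ext.mk₀ (ModuleCat.ofHom (r • LinearMap.id : N →ₗ[A] N))) =
    Ext.mk₀ (r • 𝟙 (ModuleCat.of A N)) := rfl
  rw [this, ← Ext.smul_eq_comp_mk₀, map_smul]
  rfl

section

variable {N₁ N₂ N₃ : Type} [AddCommGroup N₁] [AddCommGroup N₂] [AddCommGroup N₃]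
  [Module A N₁] [Module A N₂] [Module A N₃] {f : N₁ →ₗ[A] N₂} {g : N₂ →ₗ[A] N₃}

lemma shortExact_mk (hf : Function.Injective f) (hfg : Function.Exact f g)
    (hg : Function.Surjective g) :
    (ShortComplex.moduleCatMk f g hfg.linearMap_comp_eq_zero).ShortExact where
  exact := by
    rw [ShortComplex.ShortExact.moduleCat_exact_iff_function_exact]
    exact hfg
  mono_f := (ModuleCat.mono_iff_injective _).2 hf
  epi_g := (ModuleCat.epi_iff_surjective _).2 hg

lemma LC.exists_exact (𝔞 : Ideal A) (hf : Function.Injective f) (hfg : Function.Exact f g)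
    (hg : Function.Surjective g) (i : ℕ) :
    ∃ δ : LC 𝔞 (ModuleCat.of A N₃) i →ₗ[A] LC 𝔞 (ModuleCat.of A N₁) (i + 1),
      Function.Exact (LC.map 𝔞 f i) (LC.map 𝔞 g i) ∧ Function.Exact (LC.map 𝔞 g i) δ ∧
      Function.Exact δ (LC.map 𝔞 f (i + 1)) := by
  have hS := shortExact_mk hf hfg hg
  refine ⟨LC.comp 𝔞 hS.extClass rfl, LC.exact_comp _ _ _ _ ?_ ?_, LC.exact_comp _ _ _ _ ?_ ?_,
    LC.exact_comp _ _ _ _ ?_ ?_⟩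
  · exact (Ext.mk₀_comp_mk₀ _ _).trans ((congrArg Ext.mk₀
      (ShortComplex.moduleCatMk f g hfg.linearMap_comp_eq_zero).zero).trans (Ext.mk₀_zero _ _))
  · exact fun X e he ↦ Ext.covariant_sequence_exact₂ X hS e he
  · exact hS.comp_extClass
  · exact fun X e he ↦ Ext.covariant_sequence_exact₃ X hS e rfl he
  · exact hS.extClass_comp
  · exact fun X e he ↦ Ext.covariant_sequence_exact₁ X hS e he rfl

lemma LC.injective_map_zero (𝔞 : Ideal A) (hf : Function.Injective f) :
    Function.Injective (LC.map 𝔞 f 0) := by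
  rw [injective_iff_map_eq_zero]
  intro y hy
  obtain ⟨s, e, rfl⟩ := Module.DirectLimit.exists_of y
  erw [LC.comp_of] at hy
  obtain ⟨t, hst, ht⟩ := LC.of_eq_zero hy
  rw [← Ext.comp_assoc _ _ _ (zero_add 0) (add_zero 0) (by lia)] at ht
  have : Mono (ModuleCat.ofHom f) := (ModuleCat.mono_iff_injective _).2 hf
  have h0 := Ext.postcomp_mk₀_injective_of_mono (ModuleCat.of A (A ⧸ 𝔞 ^ t)) (ModuleCat.ofHom f)
  rw [← LC.of_proj hst e, h0 (a₁ := (Ext.mk₀ (proj 𝔞 hst)).comp e (zero_add 0)) (a₂ := 0)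
    (by simpa using ht), map_zero]

end

lemma LC.pow_smul_eq_zero {N : ModuleCat.{0} A} {x : A} (hx : x ∈ 𝔞) {i : ℕ} (y : LC 𝔞 N i) :
    ∃ n : ℕ, x ^ n • y = 0 := by
  obtain ⟨t, e, rfl⟩ := Module.DirectLimit.exists_of y
  refine ⟨t, ?_⟩
  rw [← map_smul]
  have : x ^ t • e = (Ext.mk₀ (x ^ t • 𝟙 (ModuleCat.of A (A ⧸ 𝔞 ^ t)))).comp e (zero_add i) := by
    rw [Ext.mk₀_smul, Ext.smul_comp, Ext.mk₀_id_comp]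
  rw [this]
  have h0 : x ^ t • 𝟙 (ModuleCat.of A (A ⧸ 𝔞 ^ t)) = 0 := by
    ext
    change x ^ t • (1 : A ⧸ 𝔞 ^ t) = 0
    rw [Algebra.smul_def, mul_one]
    exact Ideal.Quotient.eq_zero_iff_mem.2 (Ideal.pow_mem_pow hx t)
  rw [h0, Ext.mk₀_zero, Ext.zero_comp, map_zero]

end

section

variable {A : Type} [CommRing A] {𝔞 : Ideal A}

section

variable {N₁ N₂ N₃ : Type} [AddCommGroup N₁] [AddCommGroup N₂] [AddCommGroup N₃]
  [Module A N₁] [Module A N₂] [Module A N₃] {f : N₁ →ₗ[A] N₂} {g : N₂ →ₗ[A] N₃}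

lemma comp_eq_zero_of_shortExact {S' S : ShortComplex (ModuleCat.{0} A)} (hS' : S'.ShortExact)
    (hS : S.ShortExact) (φ : S' ⟶ S) {K : ModuleCat.{0} A} {j k : ℕ} (hj : 1 + j = k)
    (u : Ext S.X₁ K j) (hu : (Ext.mk₀ φ.τ₁).comp u (zero_add j) = 0) :
    (Ext.mk₀ φ.τ₃).comp (hS.extClass.comp u hj) (zero_add k) = 0 := by
  rw [← Ext.comp_assoc _ _ _ (zero_add 1) hj (by lia),
    ← ShortComplex.ShortExact.extClass_naturality hS' hS φ,
    Ext.comp_assoc _ _ _ (add_zero 1) (zero_add j) (by lia), hu, Ext.comp_zero]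

/-- A class in positive degree comes from the first syzygy, compatibly with restriction. -/
lemma exists_ext_syzygy [Module.Projective A N₂] (hf : Function.Injective f)
    (hfg : Function.Exact f g) (hg : Function.Surjective g) {K : ModuleCat.{0} A} {j : ℕ}
    (e : Ext (ModuleCat.of A N₃) K (j + 1)) :
    ∃ u : Ext (ModuleCat.of A N₁) K j,
      ∀ {N₁' N₂' N₃' : Type} [AddCommGroup N₁'] [AddCommGroup N₂'] [AddCommGroup N₃']
        [Module A N₁'] [Module A N₂'] [Module A N₃'] {f' : N₁' →ₗ[A] N₂'} {g' : N₂' →ₗ[A] N₃'}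
        (_ : Function.Injective f') (_ : Function.Exact f' g') (_ : Function.Surjective g')
        (τ₁ : N₁' →ₗ[A] N₁) (τ₂ : N₂' →ₗ[A] N₂) (τ₃ : N₃' →ₗ[A] N₃)
        (_ : f ∘ₗ τ₁ = τ₂ ∘ₗ f') (_ : g ∘ₗ τ₂ = τ₃ ∘ₗ g')
        (_ : (Ext.mk₀ (ModuleCat.ofHom τ₁)).comp u (zero_add j) = 0),
        (Ext.mk₀ (ModuleCat.ofHom τ₃)).comp e (zero_add (j + 1)) = 0 := by
  have hS := shortExact_mk hf hfg hg
  have : Projective (ModuleCat.of A N₂) := ModuleCat.projective_of_categoryTheory_projective _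
  obtain ⟨u, rfl⟩ := Ext.contravariant_sequence_exact₃ hS K e
    (Ext.eq_zero_of_projective (P := ModuleCat.of A N₂) _) (add_comm 1 j)
  refine ⟨u, fun hf' hfg' hg' τ₁ τ₂ τ₃ h₁ h₂ hu ↦ ?_⟩
  exact comp_eq_zero_of_shortExact (shortExact_mk hf' hfg' hg') hS
    { τ₁ := ModuleCat.ofHom τ₁
      τ₂ := ModuleCat.ofHom τ₂
      τ₃ := ModuleCat.ofHom τ₃
      comm₁₂ := ModuleCat.hom_ext h₁
      comm₂₃ := ModuleCat.hom_ext h₂ } _ u hu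

end

/-- Restriction of a class along a linear map which factors through a submodule on which it
vanishes. -/
lemma comp_eq_zero_of_range_le {P P' : Type} [AddCommGroup P] [Module A P] [AddCommGroup P']
    [Module A P'] {K : ModuleCat.{0} A} {j : ℕ} {u : Ext (ModuleCat.of A P) K j}
    {W : Submodule A P}
    (hu : (Ext.mk₀ (ModuleCat.ofHom W.subtype)).comp u (zero_add j) = 0)
    (τ : P' →ₗ[A] P) (hτ : ∀ x, τ x ∈ W) :
    (Ext.mk₀ (ModuleCat.ofHom τ)).comp u (zero_add j) = 0 := by
  have : ModuleCat.ofHom τ = ModuleCat.ofHom (τ.codRestrict W hτ) ≫ ModuleCat.ofHom W.subtype := rfl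
  rw [this, ← Ext.mk₀_comp_mk₀_assoc, hu, Ext.comp_zero]

variable [IsNoetherianRing A]

/-- Classes with values in a module killed by `𝔞` vanish on `𝔞 ^ s P` for some `s`. -/
lemma exists_restrict_eq_zero {K : Type} [AddCommGroup K] [Module A K]
    (hK : ∀ a ∈ 𝔞, ∀ x : K, a • x = 0) (j : ℕ) :
    ∀ {P : Type} [AddCommGroup P] [Module A P] [Module.Finite A P]
      (e : Ext (ModuleCat.of A P) (ModuleCat.of A K) j),
      ∃ s : ℕ, (Ext.mk₀ (ModuleCat.ofHom (𝔞 ^ s • ⊤ : Submodule A P).subtype)).comp e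
        (zero_add j) = 0 := by
  induction j with
  | zero =>
    intro P _ _ _ e
    refine ⟨1, ?_⟩
    obtain ⟨φ, rfl⟩ := (Ext.linearEquiv₀ (R := A)).symm.surjective e
    simp only [Ext.linearEquiv₀_symm_apply]
    rw [Ext.mk₀_comp_mk₀]
    have : ModuleCat.ofHom (𝔞 ^ 1 • ⊤ : Submodule A P).subtype ≫ φ = 0 := by
      ext ⟨x, hx⟩
      change φ.hom x = 0
      rw [pow_one] at hx
      induction hx using Submodule.smul_induction_on' with
      | smul a ha n _ => rw [map_smul]; exact hK a ha _
      | add x _ y _ hx hy => rw [map_add, hx, hy, add_zero]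
    rw [this, Ext.mk₀_zero]
  | succ j ih =>
    intro P _ _ _ e
    obtain ⟨n, π, hπ⟩ := Module.Finite.exists_fin' A P
    let L := LinearMap.ker π
    obtain ⟨u, hu⟩ := exists_ext_syzygy (f := L.subtype) (g := π) L.injective_subtype
      (LinearMap.exact_subtype_ker_map π) hπ e
    obtain ⟨c, hc⟩ := ih u
    obtain ⟨k, hk⟩ := Ideal.exists_pow_inf_eq_pow_smul 𝔞 L
    refine ⟨k + c, ?_⟩
    have hle : (𝔞 ^ (k + c) • ⊤ : Submodule A (Fin n → A)) ⊓ L ≤ (𝔞 ^ c • ⊤ : Submodule A L).map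
        L.subtype := by
      rw [hk _ (Nat.le_add_right k c), Submodule.map_smul'', Submodule.map_top,
        Submodule.range_subtype, Nat.add_sub_cancel_left]
      exact Submodule.smul_mono le_rfl inf_le_right
    have hmap : (𝔞 ^ (k + c) • ⊤ : Submodule A (Fin n → A)).map π = 𝔞 ^ (k + c) • ⊤ := by
      rw [Submodule.map_smul'', Submodule.map_top, LinearMap.range_eq_top.2 hπ]
    have hmaps : ∀ x ∈ (𝔞 ^ (k + c) • ⊤ : Submodule A (Fin n → A)),
        π x ∈ (𝔞 ^ (k + c) • ⊤ : Submodule A P) := fun x hx ↦ hmap ▸ Submodule.mem_map_of_mem hx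
    let U : Submodule A L := (𝔞 ^ (k + c) • ⊤ : Submodule A (Fin n → A)).comap L.subtype
    refine hu (N₁' := U) (N₂' := (𝔞 ^ (k + c) • ⊤ : Submodule A (Fin n → A)))
      (N₃' := (𝔞 ^ (k + c) • ⊤ : Submodule A P))
      (f' := (L.subtype.restrict (p := U) (q := (𝔞 ^ (k + c) • ⊤)) fun x hx ↦ hx))
      (g' := π.restrict hmaps) ?_ ?_ ?_ U.subtype
      (𝔞 ^ (k + c) • ⊤ : Submodule A (Fin n → A)).subtype
      (𝔞 ^ (k + c) • ⊤ : Submodule A P).subtype ?_ ?_ ?_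
    · intro x y hxy
      have h := congrArg Subtype.val hxy
      exact Subtype.ext (Subtype.ext h)
    · intro y
      constructor
      · intro hy
        exact ⟨⟨⟨y.1, congrArg Subtype.val hy⟩, y.2⟩, rfl⟩
      · rintro ⟨x, rfl⟩
        exact Subtype.ext x.1.2
    · rintro ⟨y, hy⟩
      rw [← hmap] at hy
      obtain ⟨x, hx, rfl⟩ := hy
      exact ⟨⟨x, hx⟩, rfl⟩
    · rfl
    · rfl
    · refine comp_eq_zero_of_range_le hc _ fun x ↦ ?_
      obtain ⟨y, hy, hyx⟩ := hle ⟨x.2, x.1.2⟩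
      rwa [show y = x.1 from Subtype.ext hyx] at hy

lemma LC.subsingleton_of_smul_eq_zero {K : Type} [AddCommGroup K] [Module A K]
    (hK : ∀ a ∈ 𝔞, ∀ x : K, a • x = 0) {j : ℕ} (hj : 0 < j) :
    Subsingleton (LC 𝔞 (ModuleCat.of A K) j) := by
  obtain ⟨j, rfl⟩ : ∃ i, j = i + 1 := ⟨j - 1, by lia⟩
  refine subsingleton_of_forall_eq 0 fun y ↦ ?_
  obtain ⟨t, e, rfl⟩ := Module.DirectLimit.exists_of y
  obtain ⟨u, hu⟩ := exists_ext_syzygy (f := (𝔞 ^ t).subtype) (g := (𝔞 ^ t).mkQ)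
    (Submodule.injective_subtype _) (LinearMap.exact_subtype_mkQ _) (Submodule.mkQ_surjective _) e
  obtain ⟨s, hs⟩ := exists_restrict_eq_zero hK _ u
  have hts : t ≤ s + t := Nat.le_add_left t s
  rw [← LC.of_proj hts e]
  refine (congrArg (LC.of 𝔞 _ _ _) ?_).trans (map_zero _)
  refine hu (f' := (𝔞 ^ (s + t)).subtype) (g' := (𝔞 ^ (s + t)).mkQ)
    (Submodule.injective_subtype _) (LinearMap.exact_subtype_mkQ _) (Submodule.mkQ_surjective _)
    (Submodule.inclusion (Ideal.pow_le_pow_right hts)) LinearMap.id _ rfl rfl ?_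
  refine comp_eq_zero_of_range_le hs _ fun x ↦ ?_
  have hx : (x : A) ∈ (𝔞 ^ s • ⊤ : Submodule A (𝔞 ^ t : Ideal A)).map (𝔞 ^ t).subtype := by
    rw [Submodule.map_smul'', Submodule.map_top, Submodule.range_subtype, smul_eq_mul, ← pow_add]
    exact x.2
  obtain ⟨y, hy, hyx⟩ := hx
  rwa [show y = Submodule.inclusion (Ideal.pow_le_pow_right hts) x from Subtype.ext hyx] at hy

end

section

lemma exists_mk_eq {R M : Type*} [CommSemiring R] {S : Submonoid R} [AddCommMonoid M] [Module R M]
    (y : LocalizedModule S M) : ∃ m s, LocalizedModule.mk m s = y := by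
  induction y using LocalizedModule.induction_on with
  | h m s => exact ⟨m, s, rfl⟩

lemma smul_quotient_eq_zero {R : Type*} [CommRing R] {I : Ideal R} {a : R} (ha : a ∈ I)
    (x : R ⧸ I) : a • x = 0 := by
  rw [Algebra.smul_def, Ideal.Quotient.algebraMap_eq, Ideal.Quotient.eq_zero_iff_mem.2 ha, zero_mul]

variable {A : Type} [CommRing A] (𝔞 : Ideal A)

/-- Evaluation at `1` of classes in degree zero. -/
noncomputable def LC.eval (N : Type) [AddCommGroup N] [Module A N] :
    LC 𝔞 (ModuleCat.of A N) 0 →ₗ[A] N :=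
  Module.DirectLimit.lift A ℕ _ _
    (fun t ↦ ((LinearMap.applyₗ (1 : A ⧸ 𝔞 ^ t)).comp ModuleCat.homLinearEquiv.toLinearMap).comp
      Ext.linearEquiv₀.toLinearMap)
    (by
      intro s t hst e
      obtain ⟨φ, rfl⟩ := (Ext.linearEquiv₀ (R := A)).symm.surjective e
      rw [trans_apply]
      simp only [Ext.linearEquiv₀_symm_apply, Ext.mk₀_comp_mk₀]
      simp only [LinearMap.comp_apply, LinearEquiv.coe_coe, ← Ext.linearEquiv₀_symm_apply (R := A),
        LinearEquiv.apply_symm_apply]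
      rfl)

lemma LC.bijective_eval {N : Type} [AddCommGroup N] [Module A N]
    (hN : ∀ a ∈ 𝔞, ∀ x : N, a • x = 0) : Function.Bijective (LC.eval 𝔞 N) := by
  constructor
  · rw [injective_iff_map_eq_zero]
    intro y hy
    obtain ⟨t, e, rfl⟩ := Module.DirectLimit.exists_of y
    obtain ⟨φ, rfl⟩ := (Ext.linearEquiv₀ (R := A)).symm.surjective e
    rw [LC.eval, Module.DirectLimit.lift_of] at hy
    simp only [LinearMap.comp_apply, LinearEquiv.coe_coe, LinearEquiv.apply_symm_apply] at hy
    have hφ : φ = 0 := by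
      ext
      exact hy
    rw [hφ, map_zero, map_zero]
  · intro n
    let φ : (A ⧸ 𝔞 ^ 1) →ₗ[A] N := (𝔞 ^ 1).liftQ (LinearMap.toSpanSingleton A N n) (by
      intro a ha
      rw [pow_one] at ha
      exact hN a ha n)
    refine ⟨LC.of 𝔞 _ 0 1 (Ext.linearEquiv₀ (R := A).symm (ModuleCat.ofHom φ)), ?_⟩
    rw [LC.eval, Module.DirectLimit.lift_of]
    simp only [LinearMap.comp_apply, LinearEquiv.coe_coe, LinearEquiv.apply_symm_apply]
    change φ 1 = n
    exact (Submodule.liftQ_apply _ _ _).trans (one_smul A n)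

variable (q : Ideal A) [q.IsPrime]

/-- The localization at `q` of `LC`. -/
abbrev LLC (N : Type) [AddCommGroup N] [Module A N] (i : ℕ) : Type :=
  LocalizedModule q.primeCompl (LC 𝔞 (ModuleCat.of A N) i)

/-- The map on `LLC` induced by a linear map. -/
noncomputable def LLC.map {N N' : Type} [AddCommGroup N] [Module A N] [AddCommGroup N']
    [Module A N'] (f : N →ₗ[A] N') (i : ℕ) :
    LLC 𝔞 q N i →ₗ[Localization q.primeCompl] LLC 𝔞 q N' i :=
  LocalizedModule.map q.primeCompl (LC.map 𝔞 f i)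

variable {𝔞 q}

lemma LLC.map_smul_id {N : Type} [AddCommGroup N] [Module A N] (r : A) (i : ℕ)
    (y : LLC 𝔞 q N i) : LLC.map 𝔞 q (r • LinearMap.id : N →ₗ[A] N) i y = r • y := by
  obtain ⟨y, s, rfl⟩ := exists_mk_eq y
  rw [LLC.map, LocalizedModule.map_mk, LC.map_smul_id, LocalizedModule.smul'_mk]
  rfl

lemma LLC.exists_exact {N₁ N₂ N₃ : Type} [AddCommGroup N₁] [AddCommGroup N₂] [AddCommGroup N₃]
    [Module A N₁] [Module A N₂] [Module A N₃] {f : N₁ →ₗ[A] N₂} {g : N₂ →ₗ[A] N₃}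
    (hf : Function.Injective f) (hfg : Function.Exact f g) (hg : Function.Surjective g) (i : ℕ) :
    ∃ δ : LLC 𝔞 q N₃ i →ₗ[Localization q.primeCompl] LLC 𝔞 q N₁ (i + 1),
      Function.Exact (LLC.map 𝔞 q f i) (LLC.map 𝔞 q g i) ∧ Function.Exact (LLC.map 𝔞 q g i) δ ∧
      Function.Exact δ (LLC.map 𝔞 q f (i + 1)) := by
  obtain ⟨δ, h₁, h₂, h₃⟩ := LC.exists_exact 𝔞 hf hfg hg i
  exact ⟨LocalizedModule.map _ δ, LocalizedModule.map_exact _ _ _ h₁,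
    LocalizedModule.map_exact _ _ _ h₂, LocalizedModule.map_exact _ _ _ h₃⟩

lemma LLC.injective_map_zero {N₁ N₂ : Type} [AddCommGroup N₁] [AddCommGroup N₂]
    [Module A N₁] [Module A N₂] {f : N₁ →ₗ[A] N₂} (hf : Function.Injective f) :
    Function.Injective (LLC.map 𝔞 q f 0) :=
  IsLocalizedModule.map_injective q.primeCompl (LocalizedModule.mkLinearMap _ _)
    (LocalizedModule.mkLinearMap _ _) _ (LC.injective_map_zero 𝔞 hf)

lemma LC.smul_eq_zero {N : Type} [AddCommGroup N] [Module A N] {s : A}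
    (hs : ∀ n : N, s • n = 0) {i : ℕ} (y : LC 𝔞 (ModuleCat.of A N) i) : s • y = 0 := by
  have h0 : (s • LinearMap.id : N →ₗ[A] N) = (0 : A) • LinearMap.id := by
    ext n
    simpa using hs n
  have h1 : LC.map 𝔞 (s • LinearMap.id : N →ₗ[A] N) i y = s • y := by rw [LC.map_smul_id]; rfl
  rw [← h1, h0, LC.map_smul_id]
  exact zero_smul A y

lemma LLC.subsingleton_of_smul_eq_zero {N : Type} [AddCommGroup N] [Module A N] {s : A}
    (hsq : s ∉ q) (hs : ∀ n : N, s • n = 0) (i : ℕ) : Subsingleton (LLC 𝔞 q N i) :=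
  LocalizedModule.subsingleton_iff.2 fun y ↦ ⟨s, hsq, LC.smul_eq_zero hs y⟩

lemma LLC.pow_smul_eq_zero {N : Type} [AddCommGroup N] [Module A N] {x : A} (hx : x ∈ 𝔞) {i : ℕ}
    (y : LLC 𝔞 q N i) : ∃ n : ℕ, x ^ n • y = 0 := by
  obtain ⟨y, s, rfl⟩ := exists_mk_eq y
  obtain ⟨n, hn⟩ := LC.pow_smul_eq_zero hx y
  exact ⟨n, by rw [LocalizedModule.smul'_mk, hn, LocalizedModule.zero_mk]⟩

lemma isSimpleModule_localized_quotient :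
    IsSimpleModule (Localization q.primeCompl) (LocalizedModule q.primeCompl (A ⧸ q)) := by
  rw [isSimpleModule_iff_toSpanSingleton_surjective]
  constructor
  · rw [← not_subsingleton_iff_nontrivial, LocalizedModule.subsingleton_iff]
    intro h
    obtain ⟨r, hr, h0⟩ := h 1
    rw [Algebra.smul_def, mul_one] at h0
    exact hr (Ideal.Quotient.eq_zero_iff_mem.1 h0)
  · intro m hm m'
    obtain ⟨a, s, rfl⟩ := exists_mk_eq m
    obtain ⟨b, t, rfl⟩ := exists_mk_eq m'
    obtain ⟨a, rfl⟩ := Ideal.Quotient.mk_surjective a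
    obtain ⟨b, rfl⟩ := Ideal.Quotient.mk_surjective b
    have ha : a ∉ q := fun ha ↦ hm (by
      rw [Ideal.Quotient.eq_zero_iff_mem.2 ha, LocalizedModule.zero_mk])
    refine ⟨Localization.mk (b * s) (t * ⟨a, ha⟩), ?_⟩
    rw [LinearMap.toSpanSingleton_apply, LocalizedModule.mk_smul_mk, LocalizedModule.mk_eq]
    refine ⟨1, ?_⟩
    simp only [one_smul, Submonoid.smul_def, Algebra.smul_def, Submonoid.coe_mul, map_mul]
    simp only [Ideal.Quotient.algebraMap_eq]
    ring

/-- `LLC (A ⧸ q)` in degree zero is the residue field. -/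
lemma LLC.isSimpleModule_quotient (h𝔞q : 𝔞 ≤ q) :
    IsSimpleModule (Localization q.primeCompl) (LLC 𝔞 q (A ⧸ q) 0) := by
  have hb := LC.bijective_eval 𝔞 (N := A ⧸ q) fun a ha x ↦ smul_quotient_eq_zero (h𝔞q ha) x
  have hb' : Function.Bijective (LocalizedModule.map q.primeCompl (LC.eval 𝔞 (A ⧸ q))) :=
    ⟨IsLocalizedModule.map_injective q.primeCompl (LocalizedModule.mkLinearMap _ _)
      (LocalizedModule.mkLinearMap _ _) _ hb.1,
    IsLocalizedModule.map_surjective q.primeCompl (LocalizedModule.mkLinearMap _ _)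
      (LocalizedModule.mkLinearMap _ _) _ hb.2⟩
  have := isSimpleModule_localized_quotient (q := q)
  exact (LinearEquiv.ofBijective _ hb').isSimpleModule_iff.2 this

lemma LLC.subsingleton_quotient [IsNoetherianRing A] (h𝔞q : 𝔞 ≤ q) {i : ℕ} (hi : 0 < i) :
    Subsingleton (LLC 𝔞 q (A ⧸ q) i) := by
  have := LC.subsingleton_of_smul_eq_zero (𝔞 := 𝔞) (K := A ⧸ q)
    (fun a ha x ↦ smul_quotient_eq_zero (h𝔞q ha) x) hi
  exact LocalizedModule.subsingleton_iff.2 fun y ↦ ⟨1, q.primeCompl.one_mem, Subsingleton.elim _ _⟩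

end

section

section

variable {A : Type} [CommRing A] (Y : ModuleCat.{0} A) (n : ℕ)

/-- The functor `Hom(-, Y)` to the opposite category of modules. -/
noncomputable abbrev homOp : ModuleCat.{0} A ⥤ (ModuleCat.{0} A)ᵒᵖ :=
  ((linearYoneda A (ModuleCat.{0} A)).obj Y).rightOp

variable {Y n} {X : ModuleCat.{0} A} (P : ProjectiveResolution X)

/-- The complex `Hom(P, Y)` in the opposite category of modules. -/
noncomputable abbrev homComplex (Y : ModuleCat.{0} A) : ChainComplex (ModuleCat.{0} A)ᵒᵖ ℕ :=
  ((homOp Y).mapHomologicalComplex _).obj P.complex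

/-- A morphism `P_n ⟶ Y` as a map out of the degree `n` term of `homComplex`. -/
noncomputable def homPoint (f : P.complex.X n ⟶ Y) :
    (homComplex P Y).X n ⟶ Opposite.op (ModuleCat.of A A) :=
  (ModuleCat.ofHom (LinearMap.toSpanSingleton A (P.complex.X n ⟶ Y) f)).op

lemma d_homPoint (f : P.complex.X n ⟶ Y) (m : ℕ) (hf : P.complex.d m n ≫ f = 0) :
    (homComplex P Y).d m n ≫ homPoint P f = 0 := by
  apply Quiver.Hom.unop_inj
  ext : 1
  refine LinearMap.ext_ring ?_
  change P.complex.d m n ≫ ((1 : A) • f) = 0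
  rw [one_smul, hf]

/-- The point of the homology of `homComplex` given by a cocycle. -/
noncomputable def homologyPoint (f : P.complex.X n ⟶ Y) (m : ℕ) (hm : n + 1 = m)
    (hf : P.complex.d m n ≫ f = 0) :
    (homComplex P Y).homology n ⟶ Opposite.op (ModuleCat.of A A) :=
  (homComplex P Y).homologyι n ≫ (homComplex P Y).descOpcycles (homPoint P f) m
    (by simp [← hm]) (d_homPoint P f m hf)

lemma homologyPoint_smul (r : A) (f : P.complex.X n ⟶ Y) (m : ℕ) (hm : n + 1 = m)
    (hf : P.complex.d m n ≫ f = 0) :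
    homologyPoint P (r • f) m hm (by simp [hf]) =
      homologyPoint P f m hm hf ≫ (r • 𝟙 (ModuleCat.of A A)).op := by
  have h1 : homPoint P (r • f) = homPoint P f ≫ (r • 𝟙 (ModuleCat.of A A)).op := by
    apply Quiver.Hom.unop_inj
    ext : 1
    refine LinearMap.ext_ring ?_
    change (1 : A) • r • f = (r • (1 : A)) • f
    simp
  unfold homologyPoint
  rw [Category.assoc]
  congr 1
  rw [← cancel_epi ((homComplex P Y).pOpcycles n), HomologicalComplex.p_descOpcycles,
    HomologicalComplex.p_descOpcycles_assoc, h1]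

lemma homologyMap_homologyPoint {X' : ModuleCat.{0} A} (P' : ProjectiveResolution X')
    (φ : P'.complex ⟶ P.complex) (f : P.complex.X n ⟶ Y) (m : ℕ) (hm : n + 1 = m)
    (hf : P.complex.d m n ≫ f = 0) :
    HomologicalComplex.homologyMap (((homOp Y).mapHomologicalComplex _).map φ) n ≫
      homologyPoint P f m hm hf =
        homologyPoint P' (φ.f n ≫ f) m hm (by simp [← φ.comm_assoc, hf]) := by
  have h1 : homPoint P' (φ.f n ≫ f) =
      (((homOp Y).mapHomologicalComplex _).map φ).f n ≫ homPoint P f := by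
    apply Quiver.Hom.unop_inj
    ext : 1
    refine LinearMap.ext_ring ?_
    change (1 : A) • (φ.f n ≫ f) = φ.f n ≫ ((1 : A) • f)
    simp
  unfold homologyPoint
  rw [HomologicalComplex.homologyι_naturality_assoc]
  congr 1
  rw [← cancel_epi ((homComplex P' Y).pOpcycles n), HomologicalComplex.p_descOpcycles,
    HomologicalComplex.p_opcyclesMap_assoc, HomologicalComplex.p_descOpcycles, h1]

/-- The derived functor of `homOp`, computed by a projective resolution. -/
noncomputable def derivedIso (Y : ModuleCat.{0} A) (n : ℕ) :
    ((homOp Y).leftDerived n).obj X ≅ (homComplex P Y).homology n :=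
  P.isoLeftDerivedObj (homOp Y) n

lemma derivedIso_naturality {X' : ModuleCat.{0} A} (P' : ProjectiveResolution X') (g : X' ⟶ X)
    (φ : ProjectiveResolution.Hom P' P g) :
    ((homOp Y).leftDerived n).map g ≫ (derivedIso P Y n).hom = (derivedIso P' Y n).hom ≫
      HomologicalComplex.homologyMap (((homOp Y).mapHomologicalComplex _).map φ.hom) n :=
  ProjectiveResolution.isoLeftDerivedObj_hom_naturality g P' P φ.hom
    (by simpa using φ.hom_f_zero_comp_π_f_zero) (homOp Y) n

/-- The class in the derived functor `Ext` of a cocycle. -/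
noncomputable def derivedClass (f : P.complex.X n ⟶ Y) (m : ℕ) (hm : n + 1 = m)
    (hf : P.complex.d m n ≫ f = 0) :
    ((Ext A (ModuleCat.{0} A) n).obj (Opposite.op X)).obj Y :=
  ((derivedIso P Y n).hom ≫ homologyPoint P f m hm hf).unop.hom (1 : A)

lemma smul_derivedClass (r : A) (f : P.complex.X n ⟶ Y) (m : ℕ) (hm : n + 1 = m)
    (hf : P.complex.d m n ≫ f = 0) :
    r • derivedClass P f m hm hf = derivedClass P (r • f) m hm (by simp [hf]) := by
  unfold derivedClass
  rw [homologyPoint_smul P r f m hm hf, ← Category.assoc]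
  exact (map_smul _ r (1 : A)).symm

lemma map_derivedClass {X' : ModuleCat.{0} A} (P' : ProjectiveResolution X') (g : X' ⟶ X)
    (φ : ProjectiveResolution.Hom P' P g) (f : P.complex.X n ⟶ Y) (m : ℕ) (hm : n + 1 = m)
    (hf : P.complex.d m n ≫ f = 0) :
    (((Ext A (ModuleCat.{0} A) n).map g.op).app Y).hom (derivedClass P f m hm hf) =
      derivedClass P' (φ.hom.f n ≫ f) m hm (by simp [← φ.hom.comm_assoc, hf]) := by
  have h1 := congrArg (· ≫ homologyPoint P f m hm hf) (derivedIso_naturality (Y := Y) (n := n)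
    P P' g φ)
  simp only [Category.assoc, homologyMap_homologyPoint] at h1
  exact congrArg (fun k ↦ k.unop.hom (1 : A)) h1

lemma extMk_eq_zero_of_derivedClass (f : P.complex.X n ⟶ Y) (m : ℕ) (hm : n + 1 = m)
    (hf : P.complex.d m n ≫ f = 0) (h0 : derivedClass P f m hm hf = 0) :
    P.extMk f m hm hf = 0 := by
  have h1 : homologyPoint P f m hm hf = 0 := by
    rw [← cancel_epi (derivedIso P Y n).hom, Limits.comp_zero]
    apply Quiver.Hom.unop_inj
    ext : 1
    exact LinearMap.ext_ring h0
  have : Projective (ModuleCat.of A A) := ModuleCat.projective_of_categoryTheory_projective _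
  have hex := ShortComplex.exact_of_f_is_kernel
    (ShortComplex.mk _ _ ((homComplex P Y).homologyι_comp_fromOpcycles n _))
    ((homComplex P Y).homologyIsKernel n _ rfl)
  let l := hex.descToInjective _ h1
  have hl := hex.comp_descToInjective _ h1
  have h2 : homPoint P f = (homComplex P Y).d n _ ≫ l := by
    rw [← HomologicalComplex.p_fromOpcycles, Category.assoc]
    erw [hl]
    rw [HomologicalComplex.p_descOpcycles]
  obtain ⟨g, h3⟩ : ∃ g : P.complex.X ((ComplexShape.down ℕ).next n) ⟶ Y,
      f = P.complex.d n _ ≫ g :=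
    ⟨l.unop.hom (1 : A), (one_smul A f).symm.trans (congrArg (fun k ↦ k.unop.hom (1 : A)) h2)⟩
  cases n with
  | zero =>
    have hf0 : f = 0 := by rw [h3, P.complex.shape _ _ (by simp), Limits.zero_comp]
    subst hf0
    exact P.extMk_zero m hm
  | succ p =>
    rw [P.extMk_eq_zero_iff f m hm hf p rfl]
    have hp : (ComplexShape.down ℕ).next (p + 1) = p := by simp
    rw [h3]
    clear h3
    revert g
    rw [hp]
    exact fun g ↦ ⟨g, rfl⟩

end

variable {A : Type} [CommRing A] {𝔞 : Ideal A}

lemma smul_extMk {X Y : ModuleCat.{0} A} {n : ℕ} (P : ProjectiveResolution X) (r : A)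
    (f : P.complex.X n ⟶ Y) (m : ℕ) (hm : n + 1 = m) (hf : P.complex.d m n ≫ f = 0) :
    r • P.extMk f m hm hf = P.extMk (r • f) m hm (by simp [hf]) := by
  rw [Ext.smul_eq_comp_mk₀, ProjectiveResolution.extMk_comp_mk₀]
  simp

/-- An element killing local cohomology kills the direct limit of the `Ext` modules. -/
lemma LC.smul_eq_zero_of_localCohomology {N : ModuleCat.{0} A} {i : ℕ} {r : A}
    (hr : ∀ y : (localCohomology 𝔞 i).obj N, r • y = 0) (y : LC 𝔞 N i) : r • y = 0 := by
  obtain ⟨s, e, rfl⟩ := Module.DirectLimit.exists_of y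
  let R : ∀ t : ℕ, ProjectiveResolution (ModuleCat.of A (A ⧸ 𝔞 ^ t)) :=
    fun t ↦ projectiveResolution _
  obtain ⟨f, hf, rfl⟩ := (R s).extMk_surjective e (i + 1) rfl
  let D := localCohomology.diagram (localCohomology.idealPowersDiagram 𝔞) i
  let ev := (evaluation (ModuleCat.{0} A) (ModuleCat.{0} A)).obj N
  have hD : Limits.IsColimit (ev.mapCocone (Limits.colimit.cocone D)) :=
    Limits.isColimitOfPreserves ev (Limits.colimit.isColimit D)
  let z : (D ⋙ ev).obj (Opposite.op (Opposite.op s)) := derivedClass (R s) f (i + 1) rfl hf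
  obtain ⟨k, u, v, huv⟩ := Limits.Concrete.isColimit_exists_of_rep_eq (D ⋙ ev) hD (r • z)
    (0 : (D ⋙ ev).obj (Opposite.op (Opposite.op s))) (by
      rw [map_zero, map_smul]
      exact hr _)
  rw [map_zero] at huv
  obtain ⟨⟨t⟩⟩ := k
  have hst : s ≤ t := u.unop.unop.down.down
  let φ : ProjectiveResolution.Hom (R t) (R s) (proj 𝔞 hst) :=
    { hom := ProjectiveResolution.lift _ _ _
      hom_f_zero_comp_π_f_zero := by
        simpa using ProjectiveResolution.lift_commutes_zero (proj 𝔞 hst) (R t) (R s) }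
  have h1 : (((Ext A (ModuleCat.{0} A) i).map (proj 𝔞 hst).op).app N).hom (r • z) = 0 := huv
  have h2 : r • z = derivedClass (R s) (r • f) (i + 1) rfl (by simp [hf]) :=
    smul_derivedClass _ _ _ _ _ _
  rw [h2, map_derivedClass (R s) (R t) _ φ] at h1
  have h3 := extMk_eq_zero_of_derivedClass _ _ _ _ _ h1
  rw [← map_smul, smul_extMk, ← LC.of_proj hst, ProjectiveResolution.mk₀_comp_extMk (φ := φ), h3,
    map_zero]

end

section

variable {A : Type} [CommRing A] {𝔞 : Ideal A}

section Exact

variable {q : Ideal A} [q.IsPrime] {N₁ N₂ N₃ : Type} [AddCommGroup N₁] [AddCommGroup N₂]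
  [AddCommGroup N₃] [Module A N₁] [Module A N₂] [Module A N₃] {f : N₁ →ₗ[A] N₂} {g : N₂ →ₗ[A] N₃}

lemma LLC.surjective_map_of_subsingleton_left (hf : Function.Injective f)
    (hfg : Function.Exact f g) (hg : Function.Surjective g) {i : ℕ}
    (h : Subsingleton (LLC 𝔞 q N₁ (i + 1))) : Function.Surjective (LLC.map 𝔞 q g i) := by
  obtain ⟨δ, -, h₂, -⟩ := LLC.exists_exact (𝔞 := 𝔞) (q := q) hf hfg hg i
  exact fun y ↦ (h₂ y).1 (Subsingleton.elim _ _)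

lemma LLC.surjective_map_of_subsingleton_right (hf : Function.Injective f)
    (hfg : Function.Exact f g) (hg : Function.Surjective g) {i : ℕ}
    (h : Subsingleton (LLC 𝔞 q N₃ i)) : Function.Surjective (LLC.map 𝔞 q f i) := by
  obtain ⟨δ, h₁, -, -⟩ := LLC.exists_exact (𝔞 := 𝔞) (q := q) hf hfg hg i
  exact fun y ↦ (h₁ y).1 (Subsingleton.elim _ _)

lemma LLC.subsingleton_of_exact (hf : Function.Injective f)
    (hfg : Function.Exact f g) (hg : Function.Surjective g) {i : ℕ}
    (h : Subsingleton (LLC 𝔞 q N₁ i)) (h' : Subsingleton (LLC 𝔞 q N₃ i)) :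
    Subsingleton (LLC 𝔞 q N₂ i) :=
  (LLC.surjective_map_of_subsingleton_right hf hfg hg h').subsingleton

lemma LLC.isArtinian_of_exact (hf : Function.Injective f)
    (hfg : Function.Exact f g) (hg : Function.Surjective g) {i : ℕ}
    (h : IsArtinian (Localization q.primeCompl) (LLC 𝔞 q N₁ i))
    (h' : IsArtinian (Localization q.primeCompl) (LLC 𝔞 q N₃ i)) :
    IsArtinian (Localization q.primeCompl) (LLC 𝔞 q N₂ i) := by
  obtain ⟨δ, h₁, -, -⟩ := LLC.exists_exact (𝔞 := 𝔞) (q := q) hf hfg hg i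
  exact isArtinian_of_range_eq_ker _ _ h₁.linearMap_ker_eq.symm

lemma exact_smul_mkQ (N : Type) [AddCommGroup N] [Module A N] (x : A) :
    Function.Exact (x • LinearMap.id : N →ₗ[A] N)
      (LinearMap.range (x • LinearMap.id : N →ₗ[A] N)).mkQ :=
  LinearMap.exact_map_mkQ_range _

variable {N : Type} [AddCommGroup N] [Module A N] {x : A}

lemma LLC.smul_surjective_of_subsingleton
    (hx : Function.Injective (x • LinearMap.id : N →ₗ[A] N)) {i : ℕ}
    (h : Subsingleton (LLC 𝔞 q (N ⧸ LinearMap.range (x • LinearMap.id : N →ₗ[A] N)) i))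
    (y : LLC 𝔞 q N i) : ∃ z : LLC 𝔞 q N i, x • z = y := by
  obtain ⟨z, hz⟩ := LLC.surjective_map_of_subsingleton_right hx (exact_smul_mkQ N x)
    (Submodule.mkQ_surjective _) h y
  exact ⟨z, by rw [← hz, LLC.map_smul_id]⟩

lemma LLC.subsingleton_of_subsingleton_quotient (hxa : x ∈ 𝔞)
    (hx : Function.Injective (x • LinearMap.id : N →ₗ[A] N)) (i : ℕ)
    (h : ∀ j, i = j + 1 →
      Subsingleton (LLC 𝔞 q (N ⧸ LinearMap.range (x • LinearMap.id : N →ₗ[A] N)) j)) :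
    Subsingleton (LLC 𝔞 q N i) := by
  have hinj : ∀ y : LLC 𝔞 q N i, x • y = 0 → y = 0 := by
    cases i with
    | zero =>
      intro y hy
      rw [← LLC.map_smul_id] at hy
      exact LLC.injective_map_zero hx (hy.trans (map_zero _).symm)
    | succ j =>
      obtain ⟨δ, -, -, h₃⟩ := LLC.exists_exact (𝔞 := 𝔞) (q := q) hx (exact_smul_mkQ N x)
        (Submodule.mkQ_surjective _) j
      have := h j rfl
      intro y hy
      rw [← LLC.map_smul_id] at hy
      obtain ⟨z, rfl⟩ := (h₃ y).1 hy
      rw [Subsingleton.elim z 0, map_zero]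
  refine subsingleton_of_forall_eq 0 fun y ↦ ?_
  obtain ⟨n, hn⟩ := LLC.pow_smul_eq_zero hxa y
  induction n with
  | zero => simpa using hn
  | succ n ih => exact ih (hinj _ (by rw [← mul_smul, ← pow_succ', hn]))

lemma LLC.isArtinian_of_isArtinian_quotient (hxa : x ∈ 𝔞)
    (hx : Function.Injective (x • LinearMap.id : N →ₗ[A] N)) (i : ℕ)
    (h : ∀ j, IsArtinian (Localization q.primeCompl)
      (LLC 𝔞 q (N ⧸ LinearMap.range (x • LinearMap.id : N →ₗ[A] N)) j)) :
    IsArtinian (Localization q.primeCompl) (LLC 𝔞 q N i) := by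
  cases i with
  | zero =>
    have := LLC.subsingleton_of_subsingleton_quotient (𝔞 := 𝔞) (q := q) hxa hx 0 (by simp)
    infer_instance
  | succ j =>
    obtain ⟨δ, -, -, h₃⟩ := LLC.exists_exact (𝔞 := 𝔞) (q := q) hx (exact_smul_mkQ N x)
      (Submodule.mkQ_surjective _) j
    refine isArtinian_of_pow_smul_eq_zero (algebraMap A (Localization q.primeCompl) x)
      (fun y ↦ ?_) ?_
    · obtain ⟨n, hn⟩ := LLC.pow_smul_eq_zero hxa y
      exact ⟨n, by rw [← map_pow, algebraMap_smul, hn]⟩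
    · have h4 : LinearMap.ker (LinearMap.lsmul (Localization q.primeCompl) (LLC 𝔞 q N (j + 1))
          (algebraMap A (Localization q.primeCompl) x)) = LinearMap.range δ := by
        rw [← h₃.linearMap_ker_eq]
        ext y
        rw [LinearMap.mem_ker, LinearMap.mem_ker, LLC.map_smul_id, LinearMap.lsmul_apply,
          algebraMap_smul]
      rw [h4]
      infer_instance

end Exact

section Devissage

lemma lt_of_mem_support_quotient {P P' : PrimeSpectrum A} {I : Submodule A (A ⧸ P.asIdeal)}
    (hI : I ≠ ⊥) (h : P' ∈ Module.support A ((A ⧸ P.asIdeal) ⧸ I)) : P < P' := by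
  have h1 := Module.annihilator_le_of_mem_support h
  have h2 : P ≤ P' := fun a ha ↦ h1 (Module.mem_annihilator.2 fun y ↦ by
    obtain ⟨y, rfl⟩ := Submodule.mkQ_surjective _ y
    rw [← map_smul, smul_quotient_eq_zero ha, map_zero])
  obtain ⟨b, hb, hb0⟩ := I.ne_bot_iff.1 hI
  obtain ⟨b, rfl⟩ := Ideal.Quotient.mk_surjective b
  refine lt_of_le_of_ne h2 ?_
  rintro rfl
  refine hb0 (Ideal.Quotient.eq_zero_iff_mem.2 (h1 (Module.mem_annihilator.2 fun y ↦ ?_)))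
  obtain ⟨y, rfl⟩ := Submodule.mkQ_surjective _ y
  obtain ⟨c, rfl⟩ := Ideal.Quotient.mk_surjective y
  rw [← map_smul, Submodule.mkQ_apply, Submodule.Quotient.mk_eq_zero]
  have : b • Ideal.Quotient.mk P.asIdeal c = c • Ideal.Quotient.mk P.asIdeal b := by
    simp only [Algebra.smul_def, Ideal.Quotient.algebraMap_eq, mul_comm]
  rw [this]
  exact I.smul_mem _ hb

lemma injective_smul_quotient {P : PrimeSpectrum A} {x : A} (hx : x ∉ P.asIdeal) :
    Function.Injective (x • LinearMap.id : (A ⧸ P.asIdeal) →ₗ[A] (A ⧸ P.asIdeal)) := by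
  rw [injective_iff_map_eq_zero]
  intro y hy
  have hy : x • y = 0 := hy
  rw [Algebra.smul_def, mul_eq_zero, Ideal.Quotient.algebraMap_eq,
    Ideal.Quotient.eq_zero_iff_mem] at hy
  exact hy.resolve_left hx

lemma lt_of_mem_support_quotient_smul {P P' : PrimeSpectrum A} {x : A} (hx : x ∉ P.asIdeal)
    (h : P' ∈ Module.support A ((A ⧸ P.asIdeal) ⧸
      LinearMap.range (x • LinearMap.id : (A ⧸ P.asIdeal) →ₗ[A] (A ⧸ P.asIdeal)))) : P < P' := by
  refine lt_of_mem_support_quotient (fun h0 ↦ ?_) h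
  rw [LinearMap.range_eq_bot] at h0
  have := injective_smul_quotient hx ((LinearMap.congr_fun h0 1).trans (map_zero _).symm)
  exact one_ne_zero this

variable [IsNoetherianRing A]

/-- Dévissage to quotients by the primes of the support contained in a fixed prime. -/
lemma devissage (Q : PrimeSpectrum A) (C : (N : Type) → [AddCommGroup N] → [Module A N] → Prop)
    (kill : ∀ (N : Type) [AddCommGroup N] [Module A N] (s : A), s ∉ Q.asIdeal →
      (∀ n : N, s • n = 0) → C N)
    (exact : ∀ (N₁ N₂ N₃ : Type) [AddCommGroup N₁] [AddCommGroup N₂] [AddCommGroup N₃]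
      [Module A N₁] [Module A N₂] [Module A N₃] (f : N₁ →ₗ[A] N₂) (g : N₂ →ₗ[A] N₃),
      Function.Injective f → Function.Exact f g → Function.Surjective g → C N₁ → C N₃ → C N₂)
    (N : Type) [AddCommGroup N] [Module A N] (hN : Module.Finite A N)
    (quot : ∀ P ∈ Module.support A N, P ≤ Q → C (A ⧸ P.asIdeal)) : C N := by
  revert quot
  induction hN using IsNoetherianRing.induction_on_isQuotientEquivQuotientPrime A with
  | subsingleton N =>
    exact fun _ ↦ kill N 1 (fun h ↦ Q.isPrime.ne_top ((Ideal.eq_top_iff_one _).2 h))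
      fun n ↦ Subsingleton.elim _ _
  | quotient N P e =>
    intro h
    by_cases hP : P ≤ Q
    · have hPs : P ∈ Module.support A N := by
        rw [e.support_eq, Module.mem_support_iff_of_finite, Ideal.annihilator_quotient]
      exact exact _ _ PUnit e.symm.toLinearMap 0 e.symm.injective
        ((e.symm.exact_zero_iff_surjective _).2 e.symm.surjective)
        (Function.surjective_to_subsingleton _) (h P hPs hP)
        (kill _ 1 (fun h ↦ Q.isPrime.ne_top ((Ideal.eq_top_iff_one _).2 h))
          fun n ↦ Subsingleton.elim _ _)
    · obtain ⟨s, hsP, hsQ⟩ := SetLike.not_le_iff_exists.1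
        (show ¬ P.asIdeal ≤ Q.asIdeal from hP)
      refine kill N s hsQ fun n ↦ e.injective ?_
      rw [map_smul, smul_quotient_eq_zero hsP, map_zero]
  | exact N₁ N₂ N₃ f g hf hg hfg h₁ h₃ =>
    intro h
    rw [Module.support_of_exact hfg hf hg] at h
    exact exact _ _ _ f g hf hfg hg (h₁ fun P hP ↦ h P (Or.inl hP))
      (h₃ fun P hP ↦ h P (Or.inr hP))

variable {Q : PrimeSpectrum A}

lemma LLC.subsingleton_of_support {i : ℕ} (N : Type) [AddCommGroup N] [Module A N]
    [hN : Module.Finite A N]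
    (h : ∀ P ∈ Module.support A N, P ≤ Q → Subsingleton (LLC 𝔞 Q.asIdeal (A ⧸ P.asIdeal) i)) :
    Subsingleton (LLC 𝔞 Q.asIdeal N i) :=
  devissage Q (fun N _ _ ↦ Subsingleton (LLC 𝔞 Q.asIdeal N i))
    (fun _ _ _ _ hs hs' ↦ LLC.subsingleton_of_smul_eq_zero hs hs' i)
    (fun _ _ _ _ _ _ _ _ _ _ _ hf hfg hg ↦ LLC.subsingleton_of_exact hf hfg hg) N hN h

lemma LLC.isArtinian_of_support {i : ℕ} (N : Type) [AddCommGroup N] [Module A N]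
    [hN : Module.Finite A N]
    (h : ∀ P ∈ Module.support A N, P ≤ Q → IsArtinian (Localization Q.asIdeal.primeCompl)
      (LLC 𝔞 Q.asIdeal (A ⧸ P.asIdeal) i)) :
    IsArtinian (Localization Q.asIdeal.primeCompl) (LLC 𝔞 Q.asIdeal N i) :=
  devissage Q (fun N _ _ ↦ IsArtinian (Localization Q.asIdeal.primeCompl) (LLC 𝔞 Q.asIdeal N i))
    (fun _ _ _ _ hs hs' ↦ by
      have := LLC.subsingleton_of_smul_eq_zero (𝔞 := 𝔞) hs hs' i
      infer_instance)
    (fun _ _ _ _ _ _ _ _ _ _ _ hf hfg hg ↦ LLC.isArtinian_of_exact hf hfg hg) N hN h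

end Devissage

end

section

variable {A : Type} [CommRing A] [IsNoetherianRing A] {𝔞 J : Ideal A} {Q : PrimeSpectrum A}

instance : WellFoundedGT (Set.Iic Q) :=
  ⟨InvImage.wf (fun P : Set.Iic Q ↦ P.1.asIdeal) (wellFounded_gt (α := Ideal A))⟩

lemma LLC.subsingleton_of_coheight_lt (h𝔞 : 𝔞 ≤ Q.asIdeal)
    (hQ : ∀ P ≤ Q, J ≤ P.asIdeal → 𝔞 ≤ P.asIdeal → P = Q) (P : Set.Iic Q)
    (hJ : J ≤ P.1.asIdeal) (i : ℕ) (hi : Order.coheight P < i) :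
    Subsingleton (LLC 𝔞 Q.asIdeal (A ⧸ P.1.asIdeal) i) := by
  induction P using WellFoundedGT.induction generalizing i with
  | ind P ih =>
    by_cases h : 𝔞 ≤ P.1.asIdeal
    · rw [hQ P.1 P.2 hJ h]
      refine LLC.subsingleton_quotient h𝔞 (Nat.pos_of_ne_zero ?_)
      rintro rfl
      simp at hi
    · obtain ⟨x, hxa, hxP⟩ := SetLike.not_le_iff_exists.1 h
      refine LLC.subsingleton_of_subsingleton_quotient hxa (injective_smul_quotient hxP) i ?_
      rintro j rfl
      refine LLC.subsingleton_of_support _ fun P' hP' hPQ ↦ ?_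
      have hlt : P.1 < P' := lt_of_mem_support_quotient_smul hxP hP'
      have hlt' : P < ⟨P', hPQ⟩ := hlt
      refine ih ⟨P', hPQ⟩ hlt (hJ.trans hlt.le) j ?_
      have := (Order.coheight_add_one_le hlt').trans_lt hi
      rw [Nat.cast_add, Nat.cast_one] at this
      exact lt_of_add_lt_add_right this

lemma LLC.isArtinian_quotient (h𝔞 : 𝔞 ≤ Q.asIdeal)
    (hQ : ∀ P ≤ Q, J ≤ P.asIdeal → 𝔞 ≤ P.asIdeal → P = Q) (P : Set.Iic Q)
    (hJ : J ≤ P.1.asIdeal) (i : ℕ) :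
    IsArtinian (Localization Q.asIdeal.primeCompl) (LLC 𝔞 Q.asIdeal (A ⧸ P.1.asIdeal) i) := by
  induction P using WellFoundedGT.induction generalizing i with
  | ind P ih =>
    by_cases h : 𝔞 ≤ P.1.asIdeal
    · rw [hQ P.1 P.2 hJ h]
      cases i with
      | zero =>
        have := LLC.isSimpleModule_quotient h𝔞
        infer_instance
      | succ i =>
        have := LLC.subsingleton_quotient h𝔞 i.succ_pos
        infer_instance
    · obtain ⟨x, hxa, hxP⟩ := SetLike.not_le_iff_exists.1 h
      refine LLC.isArtinian_of_isArtinian_quotient hxa (injective_smul_quotient hxP) i fun j ↦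
        LLC.isArtinian_of_support _ fun P' hP' hPQ ↦ ?_
      have hlt : P.1 < P' := lt_of_mem_support_quotient_smul hxP hP'
      exact ih ⟨P', hPQ⟩ hlt (hJ.trans hlt.le) j

lemma not_mem_minimalPrimes_of_lt_of_lt {P P₁ P₂ : Ideal A} [P.IsPrime] [P₁.IsPrime] (h₁ : P < P₁)
    (h₂ : P₁ < P₂) (y : A) : P₂ ∉ (P ⊔ Ideal.span {y}).minimalPrimes := by
  intro h
  have := h.1.1
  have h3 := Ideal.map_height_le_one_of_mem_minimalPrimes h
  have hmap {I K : Ideal A} (hPI : P ≤ I) (hIK : I < K) :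
      I.map (Ideal.Quotient.mk P) < K.map (Ideal.Quotient.mk P) := by
    refine lt_of_le_not_ge (Ideal.map_mono hIK.le) fun hle ↦ hIK.not_ge ?_
    have := Ideal.comap_mono (f := Ideal.Quotient.mk P) hle
    rwa [Ideal.comap_map_of_surjective' _ Ideal.Quotient.mk_surjective,
      Ideal.comap_map_of_surjective' _ Ideal.Quotient.mk_surjective, Ideal.mk_ker,
      sup_eq_left.2 hPI, sup_eq_left.2 (hPI.trans hIK.le)] at this
  have p₁ : (P₁.map (Ideal.Quotient.mk P)).IsPrime :=
    Ideal.map_isPrime_of_surjective Ideal.Quotient.mk_surjective (by rw [Ideal.mk_ker]; exact h₁.le)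
  have p₂ : (P₂.map (Ideal.Quotient.mk P)).IsPrime :=
    Ideal.map_isPrime_of_surjective Ideal.Quotient.mk_surjective
      (by rw [Ideal.mk_ker]; exact (h₁.trans h₂).le)
  have p₀ : (P.map (Ideal.Quotient.mk P)).IsPrime :=
    Ideal.map_isPrime_of_surjective Ideal.Quotient.mk_surjective (by rw [Ideal.mk_ker])
  have h4 := (Ideal.height_le_iff (n := 1)).1 h3 _ p₁ (hmap h₁.le h₂)
  have h5 := (Ideal.height_le_iff (n := 0)).1 (Order.lt_one_iff.1 h4).le _ p₀ (hmap le_rfl h₁)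
  exact absurd h5 (by simp)

/-- Above a prime `P` of coheight at least two there are infinitely many primes of coheight one
less. -/
lemma exists_coheight_eq_of_finset {n : ℕ} {P : Set.Iic Q} (hP : Order.coheight P = (n + 2 : ℕ))
    (S : Finset (Set.Iic Q)) (hS : ∀ P' ∈ S, P < P' ∧ Order.coheight P' = (n + 1 : ℕ)) :
    ∃ P', P < P' ∧ Order.coheight P' = (n + 1 : ℕ) ∧ P' ∉ S := by
  obtain ⟨-, ⟨P₁, hP₁, hP₁n⟩, hmax⟩ := Order.coheight_eq_coe_add_one_iff.1
    (hP.trans (Nat.cast_succ (n + 1)))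
  obtain ⟨-, ⟨P₂, hP₂, hP₂n⟩, -⟩ := Order.coheight_eq_coe_add_one_iff.1
    (hP₁n.trans (Nat.cast_succ n))
  classical
  have havoid : ¬ ((P₂.1.asIdeal : Set A) ⊆
      ⋃ R ∈ ((insert P S : Finset (Set.Iic Q)) : Set (Set.Iic Q)), (R.1.asIdeal : Set A)) := by
    rw [Ideal.subset_union_prime P P (fun R _ _ _ ↦ R.1.isPrime)]
    rintro ⟨R, hR, hle⟩
    rcases Finset.mem_insert.1 hR with rfl | hR
    · exact absurd (hP₁.trans hP₂) (not_lt_of_ge hle)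
    · have h1 := (hS R hR).2.symm.le.trans (Order.coheight_anti (show P₂ ≤ R from hle))
      rw [hP₂n] at h1
      exact absurd h1 (by norm_cast; omega)
  obtain ⟨y, hy₂, hy⟩ := Set.not_subset.1 havoid
  simp only [Set.mem_iUnion, not_exists] at hy
  have hyP : y ∉ P.1.asIdeal := fun h ↦ hy P (Finset.mem_insert_self _ _) h
  have hle₂ : P.1.asIdeal ⊔ Ideal.span {y} ≤ P₂.1.asIdeal :=
    sup_le (hP₁.trans hP₂).le ((Ideal.span_singleton_le_iff_mem _).2 hy₂)
  obtain ⟨I, hI, hI₂⟩ := Ideal.exists_minimalPrimes_le hle₂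
  have hIprime : I.IsPrime := hI.1.1
  have hyI : y ∈ I := hI.1.2 (Ideal.mem_sup_right (Ideal.mem_span_singleton_self y))
  let P' : Set.Iic Q := ⟨⟨I, hIprime⟩, (show I ≤ Q.asIdeal from hI₂.trans P₂.2)⟩
  have hPI : P.1.asIdeal ≤ I := le_sup_left.trans hI.1.2
  have hPP' : P < P' := by
    refine lt_of_le_of_ne hPI fun h ↦ hyP ?_
    rw [h]
    exact hyI
  have hP'₂ : P' < P₂ := by
    refine lt_of_le_of_ne hI₂ fun h ↦ ?_
    have h' : I = P₂.1.asIdeal := congrArg (fun R : Set.Iic Q ↦ R.1.asIdeal) h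
    exact not_mem_minimalPrimes_of_lt_of_lt (P₁ := P₁.1.asIdeal) hP₁ hP₂ y (h' ▸ hI)
  refine ⟨P', hPP', le_antisymm (hmax _ hPP') ?_, fun h ↦ hy P' (Finset.mem_insert_of_mem h) hyI⟩
  refine le_trans ?_ (Order.coheight_add_one_le hP'₂)
  rw [hP₂n]
  norm_cast

end

section

variable {A : Type} [CommRing A] {𝔞 J : Ideal A} {Q : PrimeSpectrum A}

lemma coheight_lt_of_lt {α : Type*} [Preorder α] {a b : α} {n : ℕ} (hab : a < b)
    (ha : Order.coheight a ≤ n) : Order.coheight b < n := by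
  have h := (Order.coheight_add_one_le hab).trans ha
  refine (ENat.add_one_le_iff ?_).1 h
  rintro h0
  rw [h0] at h
  exact absurd h (by simp)

lemma LLC.smul_eq_zero {N : Type} [AddCommGroup N] [Module A N] {s : A} {q : Ideal A} [q.IsPrime]
    (hs : ∀ n : N, s • n = 0) {i : ℕ} (y : LLC 𝔞 q N i) : s • y = 0 := by
  obtain ⟨y, t, rfl⟩ := exists_mk_eq y
  rw [LocalizedModule.smul'_mk, LC.smul_eq_zero hs, LocalizedModule.zero_mk]

lemma LLC.subsingleton_zero_of_not_le {P : Set.Iic Q} (h : ¬ 𝔞 ≤ P.1.asIdeal) :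
    Subsingleton (LLC 𝔞 Q.asIdeal (A ⧸ P.1.asIdeal) 0) := by
  obtain ⟨x, hxa, hxP⟩ := SetLike.not_le_iff_exists.1 h
  exact LLC.subsingleton_of_subsingleton_quotient hxa (injective_smul_quotient hxP) 0 (by simp)

/-- The canonical surjection between quotients by primes. -/
def factor {P P' : PrimeSpectrum A} (h : P ≤ P') : (A ⧸ P.asIdeal) →ₗ[A] (A ⧸ P'.asIdeal) :=
  Submodule.factor h

lemma factor_surjective {P P' : PrimeSpectrum A} (h : P ≤ P') : Function.Surjective (factor h) :=
  Submodule.factor_surjective h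

variable [IsNoetherianRing A]

lemma LLC.exists_smul_eq (h𝔞 : 𝔞 ≤ Q.asIdeal)
    (hQ : ∀ P ≤ Q, J ≤ P.asIdeal → 𝔞 ≤ P.asIdeal → P = Q) {P : Set.Iic Q}
    (hJ : J ≤ P.1.asIdeal) {i : ℕ} (hi : Order.coheight P ≤ i) {z : A} (hz : z ∉ P.1.asIdeal)
    (y : LLC 𝔞 Q.asIdeal (A ⧸ P.1.asIdeal) i) :
    ∃ w : LLC 𝔞 Q.asIdeal (A ⧸ P.1.asIdeal) i, z • w = y := by
  refine LLC.smul_surjective_of_subsingleton (injective_smul_quotient hz)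
    (LLC.subsingleton_of_support _ fun P' hP' hPQ ↦ ?_) y
  have hlt := lt_of_mem_support_quotient_smul hz hP'
  exact LLC.subsingleton_of_coheight_lt h𝔞 hQ ⟨P', hPQ⟩ (hJ.trans hlt.le) i
    (coheight_lt_of_lt (a := P) hlt hi)

/-- If the top `LLC` of `A ⧸ P` vanishes, then the previous one surjects onto those of its
quotients. -/
lemma LLC.surjective_map_factor (h𝔞 : 𝔞 ≤ Q.asIdeal)
    (hQ : ∀ P ≤ Q, J ≤ P.asIdeal → 𝔞 ≤ P.asIdeal → P = Q) {P : Set.Iic Q}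
    (hJ : J ≤ P.1.asIdeal) {n : ℕ} (hP : Order.coheight P ≤ (n + 1 : ℕ))
    (h0 : Subsingleton (LLC 𝔞 Q.asIdeal (A ⧸ P.1.asIdeal) (n + 1))) {P' : PrimeSpectrum A}
    (h : P.1 ≤ P') : Function.Surjective (LLC.map 𝔞 Q.asIdeal (factor h) n) := by
  refine LLC.surjective_map_of_subsingleton_left (LinearMap.ker (factor h)).injective_subtype
    (LinearMap.exact_subtype_ker_map _) (factor_surjective h)
    (LLC.subsingleton_of_support _ fun P'' hP'' hPQ ↦ ?_)
  have h1 := Module.support_subset_of_injective _ (LinearMap.ker (factor h)).injective_subtype hP''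
  rw [Module.mem_support_iff_of_finite, Ideal.annihilator_quotient] at h1
  have h2 : P.1 ≤ P'' := h1
  rcases h2.eq_or_lt with rfl | h3
  · exact h0
  · exact LLC.subsingleton_of_coheight_lt h𝔞 hQ ⟨P'', hPQ⟩ (hJ.trans h1) _
      (coheight_lt_of_lt (a := P) h3 hP)

/-- The top `LLC` of `A ⧸ P` does not vanish. -/
theorem LLC.nontrivial_of_coheight_eq (h𝔞 : 𝔞 ≤ Q.asIdeal)
    (hQ : ∀ P ≤ Q, J ≤ P.asIdeal → 𝔞 ≤ P.asIdeal → P = Q) (n : ℕ) (P : Set.Iic Q)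
    (hJ : J ≤ P.1.asIdeal) (hP : Order.coheight P = n) :
    Nontrivial (LLC 𝔞 Q.asIdeal (A ⧸ P.1.asIdeal) n) := by
  induction n generalizing P with
  | zero =>
    have h1 : IsMax P := Order.coheight_eq_zero.1 (by simpa using hP)
    have h2 : P.1 = Q := congrArg Subtype.val (h1.eq_of_le (b := ⟨Q, le_refl Q⟩) P.2)
    rw [h2]
    exact (LLC.isSimpleModule_quotient h𝔞).nontrivial
  | succ n ih =>
    by_contra hns
    rw [not_nontrivial_iff_subsingleton] at hns
    have hsurj := fun P' h ↦ LLC.surjective_map_factor h𝔞 hQ hJ hP.le hns (P' := P') h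
    cases n with
    | zero =>
      obtain ⟨-, ⟨P₁, hP₁, hP₁n⟩, -⟩ := Order.coheight_eq_coe_add_one_iff.1
        (hP.trans (Nat.cast_succ 0))
      have := LLC.subsingleton_zero_of_not_le (𝔞 := 𝔞) (P := P) fun h ↦
        (hQ P.1 P.2 hJ h).not_lt ((show P.1 < P₁.1 from hP₁).trans_le P₁.2)
      have h1 := (hsurj P₁.1 hP₁.le).subsingleton
      exact not_subsingleton_iff_nontrivial.2 (ih P₁ (hJ.trans hP₁.le) hP₁n) h1
    | succ k =>
      let T := {P' : Set.Iic Q // P < P' ∧ Order.coheight P' = (k + 1 : ℕ)}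
      let U : T → Submodule (Localization Q.asIdeal.primeCompl)
          (LLC 𝔞 Q.asIdeal (A ⧸ P.1.asIdeal) (k + 1)) := fun t ↦
        LinearMap.ker (LLC.map 𝔞 Q.asIdeal (factor (P := P.1) t.2.1.le) (k + 1))
      have := LLC.isArtinian_quotient h𝔞 hQ P hJ (k + 1)
      obtain ⟨-, ⟨S, rfl⟩, hmin⟩ := IsArtinian.set_has_minimal
        (Set.range fun S : Finset T ↦ S.inf U) (Set.range_nonempty _)
      obtain ⟨P', hPP', hcP', hSP'⟩ := exists_coheight_eq_of_finset hP
        (S.map (Function.Embedding.subtype _)) (by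
          intro R hR
          obtain ⟨t, -, rfl⟩ := Finset.mem_map.1 hR
          exact t.2)
      let t : T := ⟨P', hPP', hcP'⟩
      have htS : t ∉ S := fun h ↦ hSP' (Finset.mem_map.2 ⟨t, h, rfl⟩)
      classical
      have hle : S.inf U ≤ U t := by
        have h1 : (insert t S).inf U ≤ S.inf U := by
          rw [Finset.inf_insert]
          exact inf_le_right
        have h2 := h1.eq_of_not_lt (hmin _ ⟨_, rfl⟩)
        rw [Finset.inf_insert] at h2
        exact inf_eq_right.1 h2
      have hnle : ¬ S.inf (fun s : T ↦ s.1.1.asIdeal) ≤ P'.1.asIdeal := by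
        rw [P'.1.isPrime.inf_le']
        rintro ⟨s, hs, hsP⟩
        rcases (show s.1 ≤ P' from hsP).eq_or_lt with h | h
        · exact htS ((show s = t from Subtype.ext h) ▸ hs)
        · have := coheight_lt_of_lt h s.2.2.le
          rw [hcP'] at this
          exact lt_irrefl _ this
      obtain ⟨z, hzS, hzP⟩ := SetLike.not_le_iff_exists.1 hnle
      have hz0 : ∀ y : LLC 𝔞 Q.asIdeal (A ⧸ P.1.asIdeal) (k + 1), z • y ∈ S.inf U := by
        intro y
        rw [Submodule.mem_finsetInf]
        intro s hs
        rw [LinearMap.mem_ker, LinearMap.map_smul_of_tower]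
        exact LLC.smul_eq_zero (fun x ↦ smul_quotient_eq_zero
          (Finset.inf_le (f := fun s : T ↦ s.1.1.asIdeal) hs hzS) x) _
      refine not_subsingleton_iff_nontrivial.2 (ih P' (hJ.trans hPP'.le) hcP')
        (subsingleton_of_forall_eq 0 fun y ↦ ?_)
      obtain ⟨w, rfl⟩ := LLC.exists_smul_eq h𝔞 hQ (hJ.trans hPP'.le) hcP'.le hzP y
      obtain ⟨v, rfl⟩ := hsurj P'.1 hPP'.le w
      rw [← LinearMap.map_smul_of_tower]
      exact hle (hz0 v)

end

section

variable {A : Type} [CommRing A] [IsNoetherianRing A] {𝔞 : Ideal A} {Q : PrimeSpectrum A}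

/-- A finitely generated module has a nonzero map to `A ⧸ p` for `p` minimal in its support. -/
lemma exists_linearMap_ne_zero (p : PrimeSpectrum A) (M : Type) [AddCommGroup M] [Module A M]
    (hM : Module.Finite A M) (hp : p ∈ Module.support A M)
    (hmin : ∀ P ∈ Module.support A M, P ≤ p → P = p) : ∃ f : M →ₗ[A] (A ⧸ p.asIdeal), f ≠ 0 := by
  revert hp hmin
  induction hM using IsNoetherianRing.induction_on_isQuotientEquivQuotientPrime A with
  | subsingleton N => simp [Module.support_eq_empty]
  | quotient N P e =>
    intro hp hmin
    have hs {R : PrimeSpectrum A} : R ∈ Module.support A N ↔ P ≤ R := by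
      rw [e.support_eq, Module.mem_support_iff_of_finite, Ideal.annihilator_quotient]
      rfl
    obtain rfl := hmin P (hs.2 le_rfl) (hs.1 hp)
    refine ⟨e.toLinearMap, fun h ↦ ?_⟩
    have : e (e.symm 1) = 0 := LinearMap.congr_fun h _
    rw [e.apply_symm_apply] at this
    exact one_ne_zero this
  | exact N₁ N₂ N₃ f g hf hg hfg h₁ h₃ =>
    intro hp hmin
    rw [Module.support_of_exact hfg hf hg] at hp hmin
    by_cases hp₃ : p ∈ Module.support A N₃
    · obtain ⟨φ, hφ⟩ := h₃ hp₃ fun P hP ↦ hmin P (Or.inr hP)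
      refine ⟨φ ∘ₗ g, fun h ↦ hφ ?_⟩
      rwa [← LinearMap.cancel_right hg, LinearMap.zero_comp]
    · obtain ⟨φ, hφ⟩ := h₁ (hp.resolve_right hp₃) fun P hP ↦ hmin P (Or.inl hP)
      rw [Module.mem_support_iff_of_finite, SetLike.not_le_iff_exists] at hp₃
      obtain ⟨s, hs, hsp⟩ := hp₃
      let e := LinearEquiv.ofInjective f hf
      have hran : LinearMap.range f = LinearMap.ker g := hfg.linearMap_ker_eq.symm
      let ψ : N₂ →ₗ[A] LinearMap.range f := (s • LinearMap.id).codRestrict _ fun n ↦ by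
        rw [hran, LinearMap.mem_ker, LinearMap.smul_apply, map_smul]
        exact Module.mem_annihilator.1 hs _
      refine ⟨φ ∘ₗ e.symm.toLinearMap ∘ₗ ψ, fun h ↦ hφ ?_⟩
      ext n
      have h1 : ψ (f n) = s • e n := rfl
      have h2 : φ (e.symm (ψ (f n))) = 0 := LinearMap.congr_fun h (f n)
      rw [h1, map_smul, e.symm_apply_apply, map_smul] at h2
      exact injective_smul_quotient hsp (h2.trans (map_zero _).symm)

/-- An element outside a prime `p` of maximal coheight of the support does not kill the top
`LLC`. -/
theorem LLC.exists_smul_ne_zero {M : Type} [AddCommGroup M] [Module A M] [Module.Finite A M]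
    (h𝔞 : 𝔞 ≤ Q.asIdeal) (hQ : ∀ P ≤ Q, P ∈ Module.support A M → 𝔞 ≤ P.asIdeal → P = Q) {h : ℕ}
    (hle : ∀ P : Set.Iic Q, P.1 ∈ Module.support A M → Order.coheight P ≤ h) (p : Set.Iic Q)
    (hp : p.1 ∈ Module.support A M) (hmin : ∀ P ∈ Module.support A M, P ≤ p.1 → P = p.1)
    (hph : Order.coheight p = h) {r : A} (hr : r ∉ p.1.asIdeal) :
    ∃ y : LLC 𝔞 Q.asIdeal M h, r • y ≠ 0 := by
  by_contra! h0
  simp only [Module.mem_support_iff_of_finite] at hQ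
  obtain ⟨f, hf⟩ := exists_linearMap_ne_zero p.1 M ‹_› hp hmin
  have hpJ := Module.annihilator_le_of_mem_support hp
  have hs₁ : Function.Surjective (LLC.map 𝔞 Q.asIdeal f.rangeRestrict h) := by
    refine LLC.surjective_map_of_subsingleton_left (LinearMap.ker f.rangeRestrict).injective_subtype
      (LinearMap.exact_subtype_ker_map _) f.surjective_rangeRestrict
      (LLC.subsingleton_of_support _ fun P hP hPQ ↦ ?_)
    have hPM := Module.support_subset_of_injective _
      (LinearMap.ker f.rangeRestrict).injective_subtype hP
    exact LLC.subsingleton_of_coheight_lt h𝔞 hQ ⟨P, hPQ⟩ (Module.annihilator_le_of_mem_support hPM)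
      _ ((hle ⟨P, hPQ⟩ hPM).trans_lt (by norm_cast; omega))
  have hs₂ : Function.Surjective (LLC.map 𝔞 Q.asIdeal (LinearMap.range f).subtype h) := by
    refine LLC.surjective_map_of_subsingleton_right (LinearMap.range f).injective_subtype
      (LinearMap.exact_subtype_mkQ _) (Submodule.mkQ_surjective _)
      (LLC.subsingleton_of_support _ fun P hP hPQ ↦ ?_)
    have hlt := lt_of_mem_support_quotient (by rwa [ne_eq, LinearMap.range_eq_bot]) hP
    exact LLC.subsingleton_of_coheight_lt h𝔞 hQ ⟨P, hPQ⟩ (hpJ.trans hlt.le) _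
      (coheight_lt_of_lt (a := p) hlt hph.le)
  refine not_subsingleton_iff_nontrivial.2
    (LLC.nontrivial_of_coheight_eq h𝔞 hQ h p hpJ hph) (subsingleton_of_forall_eq 0 fun y ↦ ?_)
  obtain ⟨w, rfl⟩ := LLC.exists_smul_eq h𝔞 hQ hpJ hph.le hr y
  obtain ⟨v, rfl⟩ := hs₂ w
  obtain ⟨u, rfl⟩ := hs₁ v
  rw [← LinearMap.map_smul_of_tower, ← LinearMap.map_smul_of_tower, h0, map_zero, map_zero]

end

section

variable {A : Type} [CommRing A] {M : Type} [AddCommGroup M] [Module A M]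

lemma mem_support_localizedModule {q : Ideal A} [q.IsPrime]
    {P : PrimeSpectrum (Localization.AtPrime q)} :
    P ∈ Module.support (Localization.AtPrime q) (LocalizedModule q.primeCompl M) ↔
      P.comap (algebraMap A (Localization.AtPrime q)) ∈ Module.support A M := by
  simp only [Module.mem_support_iff', PrimeSpectrum.comap_asIdeal, Ideal.mem_comap]
  constructor
  · rintro ⟨y, hy⟩
    obtain ⟨m, s, rfl⟩ := exists_mk_eq y
    refine ⟨m, fun r hr h0 ↦ hy _ hr ?_⟩
    rw [algebraMap_smul, LocalizedModule.smul'_mk, h0, LocalizedModule.zero_mk]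
  · rintro ⟨m, hm⟩
    refine ⟨LocalizedModule.mk m 1, fun b hb h0 ↦ ?_⟩
    obtain ⟨a, t, rfl⟩ := IsLocalization.exists_mk'_eq q.primeCompl b
    have h1 : algebraMap A (Localization.AtPrime q) a • LocalizedModule.mk m
        (1 : q.primeCompl) = 0 := by
      rw [← IsLocalization.mk'_spec' (Localization.AtPrime q) a t, mul_smul, h0, smul_zero]
    rw [algebraMap_smul, LocalizedModule.smul'_mk, ← LocalizedModule.zero_mk 1,
      LocalizedModule.mk_eq] at h1
    obtain ⟨u, hu⟩ := h1
    refine hm (u * a) (fun h ↦ ?_) (by simpa [mul_smul, Submonoid.smul_def] using hu)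
    rw [map_mul, P.isPrime.mul_mem_iff_mem_or_mem] at h
    rcases h with h | h
    · exact P.isPrime.ne_top (P.asIdeal.eq_top_of_isUnit_mem h (IsLocalization.map_units _ u))
    · rw [← IsLocalization.mk'_spec' (Localization.AtPrime q) a t,
        P.isPrime.mul_mem_iff_mem_or_mem] at h
      exact P.isPrime.ne_top (P.asIdeal.eq_top_of_isUnit_mem (h.resolve_right hb)
        (IsLocalization.map_units _ t))

lemma le_moduleDimAt_iff {Q : PrimeSpectrum A} {n : ℕ} :
    n ≤ moduleDimAt A M Q.asIdeal Q.isPrime ↔ ∃ l : LTSeries (PrimeSpectrum A),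
      l.length = n ∧ l.head ∈ Module.support A M ∧ l.last ≤ Q := by
  let e := IsLocalization.AtPrime.primeSpectrumOrderIso (Localization.AtPrime Q.asIdeal) Q.asIdeal
  have he (P) : (e P).1 = P.comap (algebraMap A (Localization.AtPrime Q.asIdeal)) := rfl
  rw [moduleDimAt, Order.le_krullDim_iff]
  constructor
  · rintro ⟨l, rfl⟩
    refine ⟨l.map (fun P ↦ (e P.1).1) (fun P P' h ↦ e.strictMono h), rfl, ?_, ?_⟩
    · exact mem_support_localizedModule.1 l.head.2
    · exact (e l.last.1).2
  · rintro ⟨l, rfl, hl, hlQ⟩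
    refine ⟨LTSeries.mk l.length
      (fun i ↦ ⟨e.symm ⟨l i, (l.monotone (Fin.le_last i)).trans hlQ⟩, ?_⟩)
      (fun i j hij ↦ e.symm.strictMono (l.strictMono hij)), rfl⟩
    rw [mem_support_localizedModule, ← he, e.apply_symm_apply]
    exact Module.mem_support_mono (l.monotone (Fin.zero_le i)) hl

variable {Q : PrimeSpectrum A} {h : ℕ}

lemma coheight_le_of_moduleDimAt (hQ : moduleDimAt A M Q.asIdeal Q.isPrime = (h : ℕ∞))
    (P : Set.Iic Q) (hP : P.1 ∈ Module.support A M) : Order.coheight P ≤ h := by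
  refine Order.coheight_le fun l hl ↦ ?_
  have h1 := le_moduleDimAt_iff.2 ⟨l.map (fun P ↦ P.1) (fun _ _ h ↦ h), rfl,
    (show l.head.1 ∈ Module.support A M from hl ▸ hP), l.last.2⟩
  rw [hQ] at h1
  exact_mod_cast h1

lemma exists_coheight_eq_of_moduleDimAt (hQ : moduleDimAt A M Q.asIdeal Q.isPrime = (h : ℕ∞)) :
    ∃ p : Set.Iic Q, p.1 ∈ Module.support A M ∧ Order.coheight p = h := by
  obtain ⟨l, hlh, hl, hlQ⟩ := le_moduleDimAt_iff.1 hQ.symm.le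
  let l' : LTSeries (Set.Iic Q) := LTSeries.mk l.length
    (fun i ↦ ⟨l i, (l.monotone (Fin.le_last i)).trans hlQ⟩) (fun _ _ hij ↦ l.strictMono hij)
  refine ⟨l'.head, hl, le_antisymm (coheight_le_of_moduleDimAt hQ _ hl) ?_⟩
  rw [← hlh]
  exact Order.length_le_coheight_head (p := l')

lemma eq_of_moduleDimAt_le {P : PrimeSpectrum A}
    (hQ : moduleDimAt A M Q.asIdeal Q.isPrime = (h : ℕ∞))
    (hle : moduleDimAt A M Q.asIdeal Q.isPrime ≤ moduleDimAt A M P.asIdeal P.isPrime)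
    (hPQ : P ≤ Q) : P = Q := by
  by_contra hne
  rw [hQ] at hle
  obtain ⟨l, hlh, hl, hlP⟩ := le_moduleDimAt_iff.1 hle
  have h1 := (le_moduleDimAt_iff (M := M) (Q := Q)).2
    ⟨l.snoc Q (hlP.trans_lt (lt_of_le_of_ne hPQ hne)), rfl, by simpa using hl, by simp⟩
  rw [hQ] at h1
  have h2 : l.length + 1 ≤ h := by exact_mod_cast h1
  omega

end

lemma exists_heightM_eq {A : Type} [CommRing A] {M : Type} [AddCommGroup M] [Module A M]
    {𝔞 : Ideal A} {h : ℕ} (hh : heightM A M 𝔞 = (h : ℕ∞)) :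
    ∃ Q : PrimeSpectrum A, Q ∈ Module.support A M ∧ 𝔞 ≤ Q.asIdeal ∧
      moduleDimAt A M Q.asIdeal Q.isPrime = heightM A M 𝔞 := by
  unfold heightM at *
  rw [iInf_subtype'] at *
  rcases isEmpty_or_nonempty
    {P : PrimeSpectrum A // P ∈ {P | P ∈ Module.support A M ∧ 𝔞 ≤ P.asIdeal}} with hE | hE
  · rw [iInf_of_isEmpty, sInf_empty] at hh
    exact absurd (WithBot.coe_injective (hh : ((⊤ : ℕ∞) : WithBot ℕ∞) = _)) (ENat.top_ne_natCast h)
  · obtain ⟨Q, hQ⟩ := ciInf_mem (fun P : {P : PrimeSpectrum A //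
      P ∈ {P | P ∈ Module.support A M ∧ 𝔞 ≤ P.asIdeal}} ↦
        moduleDimAt A M P.1.asIdeal P.1.isPrime)
    exact ⟨Q.1, Q.2.1, Q.2.2, hQ⟩

end PowerExt

/-- The annihilator of `H^{ht_M 𝔞}_𝔞(M)` is contained in the union of the minimal primes of
`Supp M`. -/
theorem stmt11 (A : Type) [CommRing A] [IsNoetherianRing A]
    (M : Type) [AddCommGroup M] [Module A M] [Module.Finite A M]
    (𝔞 : Ideal A) (h𝔞M : 𝔞 • (⊤ : Submodule A M) ≠ ⊤)
    (h : ℕ) (hh : heightM A M 𝔞 = ((h : ℕ∞) : WithBot ℕ∞)) :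
    (↑(Module.annihilator A ((localCohomology 𝔞 h).obj (ModuleCat.of A M))) : Set A) ⊆
      ⋃ 𝔭 ∈ (Module.annihilator A M).minimalPrimes, (𝔭 : Set A) := by
  intro r hr
  obtain ⟨Q, -, h𝔞, hQ⟩ := PowerExt.exists_heightM_eq hh
  have hQh := hQ.trans hh
  obtain ⟨p, hp, hph⟩ := PowerExt.exists_coheight_eq_of_moduleDimAt hQh
  have hle := PowerExt.coheight_le_of_moduleDimAt hQh
  have hmin : ∀ P ∈ Module.support A M, P ≤ p.1 → P = p.1 := by
    intro P hP hPp
    by_contra hne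
    have h1 := PowerExt.coheight_lt_of_lt (a := (⟨P, hPp.trans p.2⟩ : Set.Iic Q)) (b := p)
      (show P < p.1 from lt_of_le_of_ne hPp hne) (hle ⟨P, hPp.trans p.2⟩ hP)
    exact h1.ne hph
  have hgood : ∀ P ≤ Q, P ∈ Module.support A M → 𝔞 ≤ P.asIdeal → P = Q := fun P hPQ hP hP𝔞 ↦
    PowerExt.eq_of_moduleDimAt_le hQh (hQ.le.trans (iInf₂_le P ⟨hP, hP𝔞⟩)) hPQ
  refine Set.mem_biUnion (x := p.1.asIdeal)
    ⟨⟨p.1.isPrime, Module.annihilator_le_of_mem_support hp⟩, fun I hI hIp ↦ ?_⟩ ?_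
  · have h1 := hmin ⟨I, hI.1⟩ (Module.mem_support_iff_of_finite.2 hI.2) hIp
    exact (congrArg PrimeSpectrum.asIdeal h1).ge
  · by_contra hrp
    obtain ⟨y, hy⟩ := PowerExt.LLC.exists_smul_ne_zero h𝔞 hgood hle p hp hmin hph hrp
    obtain ⟨y, s, rfl⟩ := PowerExt.exists_mk_eq y
    refine hy ?_
    rw [LocalizedModule.smul'_mk, PowerExt.LC.smul_eq_zero_of_localCohomology
      (Module.mem_annihilator.1 hr), LocalizedModule.zero_mk]
end

section
/- Let A be a Noetherian ring, M a finitely generated A-module, and suppose there exists x outside all minimal primes of Supp(M) such that for every maximal ideal 𝔪, x · H^i_𝔪(M) = 0 for all i < dim_{A_𝔪}(M_𝔪). Then for every maximal ideal 𝔪 ∈ Supp(M) and every pair of minimal primes 𝔭, 𝔮 of Supp(M) contained in 𝔪, one has dim(A_𝔪/𝔭A_𝔪) = dim(A_𝔪/𝔮A_𝔪) = dim_{A_𝔪}(M_𝔪). -/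
open CategoryTheory

/-- The Krull dimension of `A_𝔪 / 𝔭 A_𝔪`. -/
noncomputable def locQuotDim (A : Type) [CommRing A] (𝔪 𝔭 : Ideal A) (h𝔪 : 𝔪.IsPrime) :
    WithBot ℕ∞ :=
  letI := h𝔪
  ringKrullDim (Localization.AtPrime 𝔪 ⧸ 𝔭.map (algebraMap A (Localization.AtPrime 𝔪)))

section LocalCohomologyExt
open Limits Opposite HomologicalComplex

namespace HomologicalComplex

variable {D : Type*} [Category* D] [Abelian D] {K L : ChainComplex D ℕ} {J : D} {n : ℕ}

/-- The morphism out of the homology of a chain complex induced by a morphism vanishing on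
boundaries. -/
noncomputable def homologyDesc (f : K.X n ⟶ J) (hf : K.d (n + 1) n ≫ f = 0) : K.homology n ⟶ J :=
  K.homologyι n ≫ K.descOpcycles f (n + 1) (by simp) hf

lemma homologyMap_comp_homologyDesc (φ : K ⟶ L) (f : L.X n ⟶ J) (hf : L.d (n + 1) n ≫ f = 0) :
    homologyMap φ n ≫ homologyDesc f hf =
      homologyDesc (φ.f n ≫ f) (by rw [← φ.comm_assoc, hf, comp_zero]) := by
  unfold homologyDesc
  rw [homologyι_naturality_assoc]
  congr 1
  rw [← cancel_epi (pOpcycles _ n), p_opcyclesMap_assoc, p_descOpcycles, p_descOpcycles]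

lemma homologyDesc_comp {J' : D} (f : K.X n ⟶ J) (hf : K.d (n + 1) n ≫ f = 0) (g : J ⟶ J') :
    homologyDesc (f ≫ g) (by rw [reassoc_of% hf, zero_comp]) = homologyDesc f hf ≫ g := by
  unfold homologyDesc
  rw [Category.assoc]
  congr 1
  rw [← cancel_epi (pOpcycles _ n), p_descOpcycles, p_descOpcycles_assoc]

lemma exists_of_homologyDesc_eq_zero [Injective J] (f : K.X n ⟶ J)
    (hf : K.d (n + 1) n ≫ f = 0) (h : homologyDesc f hf = 0) :
    ∃ w : K.X ((ComplexShape.down ℕ).next n) ⟶ J,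
      K.d n ((ComplexShape.down ℕ).next n) ≫ w = f := by
  have hex : (ShortComplex.mk _ _ (K.homologyι_comp_fromOpcycles n _)).Exact :=
    ShortComplex.exact_of_f_is_kernel _ (K.homologyIsKernel n _ rfl)
  refine ⟨hex.descToInjective _ h, ?_⟩
  have h1 := congrArg (fun u => K.pOpcycles n ≫ u) (hex.comp_descToInjective _ h)
  dsimp only at h1
  rwa [p_descOpcycles, p_fromOpcycles_assoc] at h1

end HomologicalComplex

section LeftDerived

variable {C D : Type*} [Category* C] [Abelian C] [EnoughProjectives C] [Category* D] [Abelian D]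
  {X X' : C} {F : C ⥤ D} [F.Additive] {J : D} {n : ℕ}

/-- The morphism out of a left derived functor induced by a morphism vanishing on boundaries. -/
noncomputable def leftDerivedDesc (P : ProjectiveResolution X)
    (f : ((F.mapHomologicalComplex (ComplexShape.down ℕ)).obj P.complex).X n ⟶ J)
    (hf : ((F.mapHomologicalComplex (ComplexShape.down ℕ)).obj P.complex).d (n + 1) n ≫ f = 0) :
    (F.leftDerived n).obj X ⟶ J :=
  (P.isoLeftDerivedObj F n).hom ≫ homologyDesc f hf

lemma leftDerived_map_comp_leftDerivedDesc (P : ProjectiveResolution X)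
    (P' : ProjectiveResolution X') {g : X' ⟶ X} (φ : ProjectiveResolution.Hom P' P g)
    (f : ((F.mapHomologicalComplex (ComplexShape.down ℕ)).obj P.complex).X n ⟶ J)
    (hf : ((F.mapHomologicalComplex (ComplexShape.down ℕ)).obj P.complex).d (n + 1) n ≫ f = 0) :
    (F.leftDerived n).map g ≫ leftDerivedDesc P f hf =
      leftDerivedDesc P'
        (((F.mapHomologicalComplex (ComplexShape.down ℕ)).map φ.hom).f n ≫ f)
        (by rw [← Hom.comm_assoc, hf, comp_zero]) := by
  have h1 := P'.isoLeftDerivedObj_hom_naturality g P φ.hom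
    (by simpa using φ.hom_f_zero_comp_π_f_zero) F n
  refine ((Category.assoc _ _ _).symm.trans (congrArg (· ≫ homologyDesc f hf) h1)).trans
    ((Category.assoc _ _ _).trans ?_)
  exact congrArg ((P'.isoLeftDerivedObj F n).hom ≫ ·) (homologyMap_comp_homologyDesc _ f hf)

lemma leftDerivedDesc_comp {J' : D} (P : ProjectiveResolution X)
    (f : ((F.mapHomologicalComplex (ComplexShape.down ℕ)).obj P.complex).X n ⟶ J)
    (hf : ((F.mapHomologicalComplex (ComplexShape.down ℕ)).obj P.complex).d (n + 1) n ≫ f = 0)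
    (g : J ⟶ J') :
    leftDerivedDesc P (f ≫ g) (by rw [reassoc_of% hf, zero_comp]) =
      leftDerivedDesc P f hf ≫ g :=
  (congrArg ((P.isoLeftDerivedObj F n).hom ≫ ·) (homologyDesc_comp f hf g)).trans
    (Category.assoc _ _ _).symm

lemma exists_of_leftDerivedDesc_eq_zero [Injective J] (P : ProjectiveResolution X)
    (f : ((F.mapHomologicalComplex (ComplexShape.down ℕ)).obj P.complex).X n ⟶ J)
    (hf : ((F.mapHomologicalComplex (ComplexShape.down ℕ)).obj P.complex).d (n + 1) n ≫ f = 0)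
    (h : leftDerivedDesc P f hf = 0) :
    ∃ w : ((F.mapHomologicalComplex (ComplexShape.down ℕ)).obj P.complex).X
        ((ComplexShape.down ℕ).next n) ⟶ J,
      ((F.mapHomologicalComplex (ComplexShape.down ℕ)).obj P.complex).d n
        ((ComplexShape.down ℕ).next n) ≫ w = f := by
  refine exists_of_homologyDesc_eq_zero _ hf ?_
  have h1 := congrArg ((P.isoLeftDerivedObj F n).inv ≫ ·) h
  exact ((P.isoLeftDerivedObj F n).inv_hom_id_assoc _).symm.trans (h1.trans comp_zero)

end LeftDerived

variable {A : Type} [CommRing A] {X X' M : ModuleCat.{0} A}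

/-- The functor `Hom(-, M)` as a covariant functor to the opposite category. -/
noncomputable abbrev homOp (M : ModuleCat.{0} A) : ModuleCat.{0} A ⥤ (ModuleCat.{0} A)ᵒᵖ :=
  ((linearYoneda A (ModuleCat.{0} A)).obj M).rightOp

/-- A morphism `f : N ⟶ M` viewed as a map from the free module of rank one to `Hom(N, M)`. -/
noncomputable def homOpPoint {N : ModuleCat.{0} A} (f : N ⟶ M) :
    (homOp M).obj N ⟶ op (ModuleCat.of A A) :=
  Quiver.Hom.op (ModuleCat.ofHom (LinearMap.toSpanSingleton A (N ⟶ M) f))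

lemma homOp_map_comp_point {N N' : ModuleCat.{0} A} (g : N ⟶ N') (f : N' ⟶ M) :
    (homOp M).map g ≫ homOpPoint f = homOpPoint (g ≫ f) := by
  refine Quiver.Hom.unop_inj (ModuleCat.hom_ext (LinearMap.ext_ring ?_))
  change g ≫ ((1 : A) • f) = (1 : A) • (g ≫ f)
  simp

lemma homOpPoint_smul {N : ModuleCat.{0} A} (x : A) (f : N ⟶ M) :
    homOpPoint (x • f) = homOpPoint f ≫ (x • 𝟙 (ModuleCat.of A A)).op := by
  refine Quiver.Hom.unop_inj (ModuleCat.hom_ext (LinearMap.ext_ring ?_))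
  change (1 : A) • (x • f) = (x • (1 : A)) • f
  simp

lemma homOpPoint_zero {N : ModuleCat.{0} A} : homOpPoint (0 : N ⟶ M) = 0 := by
  refine Quiver.Hom.unop_inj (ModuleCat.hom_ext (LinearMap.ext_ring ?_))
  change (1 : A) • (0 : N ⟶ M) = 0
  simp

lemma exists_homOpPoint {N : ModuleCat.{0} A} (w : (homOp M).obj N ⟶ op (ModuleCat.of A A)) :
    ∃ g : N ⟶ M, homOpPoint g = w :=
  ⟨w.unop.hom (1 : A),
    Quiver.Hom.unop_inj (ModuleCat.hom_ext (LinearMap.ext_ring (one_smul A (w.unop.hom (1 : A)))))⟩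

lemma homOpPoint_injective {N : ModuleCat.{0} A} {f g : N ⟶ M} (h : homOpPoint f = homOpPoint g) :
    f = g := by
  have h1 : (1 : A) • f = (1 : A) • g := congrArg (fun w => w.unop.hom (1 : A)) h
  simpa using h1

lemma mapHomologicalComplex_d_comp_homOpPoint (P : ProjectiveResolution X) {n : ℕ}
    (f : P.complex.X n ⟶ M) (hf : P.complex.d (n + 1) n ≫ f = 0) :
    (((homOp M).mapHomologicalComplex _).obj P.complex).d (n + 1) n ≫ homOpPoint f = 0 := by
  refine (homOp_map_comp_point _ _).trans ?_
  rw [hf, homOpPoint_zero]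
  rfl

/-- The class, in the derived functor version of `Ext`, of a cocycle on a projective resolution. -/
noncomputable def cocycleClass (P : ProjectiveResolution X) {n : ℕ} (f : P.complex.X n ⟶ M)
    (hf : P.complex.d (n + 1) n ≫ f = 0) :
    ((homOp M).leftDerived n).obj X ⟶ op (ModuleCat.of A A) :=
  leftDerivedDesc P (homOpPoint f) (mapHomologicalComplex_d_comp_homOpPoint P f hf)

lemma leftDerived_map_comp_cocycleClass (P : ProjectiveResolution X)
    (P' : ProjectiveResolution X') {g : X' ⟶ X} (φ : ProjectiveResolution.Hom P' P g)
    {n : ℕ} (f : P.complex.X n ⟶ M) (hf : P.complex.d (n + 1) n ≫ f = 0) :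
    ((homOp M).leftDerived n).map g ≫ cocycleClass P f hf =
      cocycleClass P' (φ.hom.f n ≫ f) (by simp [← φ.hom.comm_assoc, hf]) := by
  refine (leftDerived_map_comp_leftDerivedDesc P P' φ _ _).trans ?_
  unfold cocycleClass
  congr 1

lemma cocycleClass_smul (P : ProjectiveResolution X) {n : ℕ} (x : A) (f : P.complex.X n ⟶ M)
    (hf : P.complex.d (n + 1) n ≫ f = 0) :
    cocycleClass P (x • f) (by simp [hf]) =
      cocycleClass P f hf ≫ (x • 𝟙 (ModuleCat.of A A)).op := by
  refine Eq.trans ?_ (leftDerivedDesc_comp P _ _ _)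
  unfold cocycleClass
  congr 1
  exact homOpPoint_smul x f

lemma exists_of_cocycleClass_eq_zero (P : ProjectiveResolution X) {n : ℕ}
    (f : P.complex.X n ⟶ M) (hf : P.complex.d (n + 1) n ≫ f = 0)
    (h : cocycleClass P f hf = 0) :
    ∃ g : P.complex.X ((ComplexShape.down ℕ).next n) ⟶ M,
      P.complex.d n ((ComplexShape.down ℕ).next n) ≫ g = f := by
  obtain ⟨w, hw⟩ := exists_of_leftDerivedDesc_eq_zero P _ _ h
  obtain ⟨g, rfl⟩ := exists_homOpPoint w
  exact ⟨g, homOpPoint_injective ((homOp_map_comp_point _ _).symm.trans hw)⟩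

lemma extMk_eq_zero_of_cocycleClass_eq_zero (P : ProjectiveResolution X) {n : ℕ}
    (f : P.complex.X n ⟶ M) (hf : P.complex.d (n + 1) n ≫ f = 0)
    (h : cocycleClass P f hf = 0) : P.extMk f (n + 1) rfl hf = 0 := by
  obtain ⟨g, hg⟩ := exists_of_cocycleClass_eq_zero P f hf h
  obtain _ | p := n
  · have : f = 0 := by
      rw [← hg, P.complex.shape _ _ (by simp), zero_comp]
    subst this
    exact P.extMk_zero _ _
  · have e : (ComplexShape.down ℕ).next (p + 1) = p := ComplexShape.next_eq' _ (by simp)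
    rw [P.extMk_eq_zero_iff _ _ _ _ p rfl]
    revert g hg
    rw [e]
    exact fun g hg => ⟨g, hg⟩

lemma smul_mk₀_comp_extMk_eq_zero (P : ProjectiveResolution X) {n : ℕ} (f : P.complex.X n ⟶ M)
    (hf : P.complex.d (n + 1) n ≫ f = 0) (g : X' ⟶ X) (x : A)
    (h : ((homOp M).leftDerived n).map g ≫ cocycleClass P (x • f) (by simp [hf]) = 0) :
    (Abelian.Ext.mk₀ g).comp (x • P.extMk f (n + 1) rfl hf) (zero_add n) = 0 := by
  let P' := projectiveResolution X'
  let φ : ProjectiveResolution.Hom P' P g :=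
    ⟨ProjectiveResolution.lift g P' P, ProjectiveResolution.lift_commutes_zero g P' P⟩
  have e : x • P.extMk f (n + 1) rfl hf = P.extMk (x • f) (n + 1) rfl (by simp [hf]) := by
    rw [Abelian.Ext.smul_eq_comp_mk₀, P.extMk_comp_mk₀]
    congr 1
  rw [e, P.mk₀_comp_extMk _ _ _ _ φ]
  rw [leftDerived_map_comp_cocycleClass P P' φ] at h
  exact extMk_eq_zero_of_cocycleClass_eq_zero _ _ _ h

lemma comp_comp_op_smul_eq_zero {Y Z : (ModuleCat.{0} A)ᵒᵖ} (u : Y ⟶ Z)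
    (c : Z ⟶ op (ModuleCat.of A A)) (x : A) (h : u.unop.hom (x • c.unop.hom (1 : A)) = 0) :
    u ≫ c ≫ (x • 𝟙 (ModuleCat.of A A)).op = 0 := by
  refine Quiver.Hom.unop_inj (ModuleCat.hom_ext (LinearMap.ext_ring ?_))
  have h1 : c.unop.hom (x • (1 : A)) = x • c.unop.hom (1 : A) := map_smul _ _ _
  refine Eq.trans ?_ h
  rw [← h1]
  rfl

lemma unop_leftDerived_map_cocycleClass_smul (P : ProjectiveResolution X) {n : ℕ}
    (f : P.complex.X n ⟶ M) (hf : P.complex.d (n + 1) n ≫ f = 0) (g : X' ⟶ X) (x : A)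
    (h : (((homOp M).leftDerived n).map g).unop.hom
      (x • (cocycleClass P f hf).unop.hom (1 : A)) = 0) :
    (Abelian.Ext.mk₀ g).comp (x • P.extMk f (n + 1) rfl hf) (zero_add n) = 0 := by
  refine smul_mk₀_comp_extMk_eq_zero P f hf g x ?_
  rw [cocycleClass_smul P x f hf]
  exact comp_comp_op_smul_eq_zero _ _ x h

/-- If `x` kills the `i`-th local cohomology of `M` with support in `I`, then every class in
`Ext^i(A / I ^ k, M)` becomes killed by `x` in `Ext^i(A / I ^ l, M)` for some `l ≥ k`. -/
lemma exists_mk₀_comp_smul_eq_zero_of_mem_annihilator_localCohomology {I : Ideal A} {i : ℕ} {x : A}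
    (hx : x ∈ Module.annihilator A ((localCohomology I i).obj M)) (k : ℕ)
    (α : Abelian.Ext (ModuleCat.of A (A ⧸ I ^ k)) M i) :
    ∃ (l : ℕ) (hl : k ≤ l),
      (Abelian.Ext.mk₀ (ModuleCat.ofHom (Submodule.mapQ (I ^ l) (I ^ k) LinearMap.id
        (Ideal.pow_le_pow_right hl)))).comp (x • α) (zero_add i) = 0 := by
  let F := localCohomology.diagram (localCohomology.idealPowersDiagram I) i
  have hcol := isColimitOfPreserves ((evaluation _ _).obj M) (colimit.isColimit F)
  let P := projectiveResolution (ModuleCat.of A (A ⧸ I ^ k))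
  obtain ⟨f, hf, rfl⟩ := P.extMk_surjective α (i + 1) rfl
  have hx' : ∀ v : (localCohomology I i).obj M, x • v = 0 := Module.mem_annihilator.mp hx
  let a : (F ⋙ (evaluation _ _).obj M).obj (op (op k)) := (cocycleClass P f hf).unop.hom (1 : A)
  have h0 := hx' ((((evaluation _ _).obj M).mapCocone (colimit.cocone F)).ι.app (op (op k)) a)
  obtain ⟨j, u, v, huv⟩ := Concrete.isColimit_exists_of_rep_eq
    (F ⋙ (evaluation _ _).obj M) hcol (i := op (op k)) (j := op (op k)) (x • a) 0
      (by rw [map_zero]; exact (map_smul _ _ _).trans h0)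
  rw [map_zero] at huv
  have hl : k ≤ j.unop.unop := u.unop.unop.down.down
  refine ⟨j.unop.unop, hl, unop_leftDerived_map_cocycleClass_smul P f hf _ x ?_⟩
  exact huv

end LocalCohomologyExt

/-- Every class in `Ext^i(A / I ^ k, M)` is killed by `x` after restriction to `A / I ^ l` for
some `l ≥ k`, i.e. `x` kills the colimit of these `Ext` modules. -/
def EventuallyKillsExt {A : Type} [CommRing A] (I : Ideal A) (x : A) (M : Type) [AddCommGroup M]
    [Module A M] (i : ℕ) : Prop :=
  ∀ (k : ℕ) (α : Abelian.Ext (ModuleCat.of A (A ⧸ I ^ k)) (ModuleCat.of A M) i),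
    ∃ (l : ℕ) (hl : k ≤ l),
      (Abelian.Ext.mk₀ (ModuleCat.ofHom (Submodule.mapQ (I ^ l) (I ^ k) LinearMap.id
        (Ideal.pow_le_pow_right hl)))).comp (x • α) (zero_add i) = 0

lemma eventuallyKillsExt_of_mem_annihilator_localCohomology {A : Type} [CommRing A] {M : Type}
    [AddCommGroup M] [Module A M] {I : Ideal A} {i : ℕ} {x : A}
    (hx : x ∈ Module.annihilator A ((localCohomology I i).obj (ModuleCat.of A M))) :
    EventuallyKillsExt I x M i :=
  exists_mk₀_comp_smul_eq_zero_of_mem_annihilator_localCohomology hx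

section ExtAnnihilation
open Abelian

variable {A : Type} [CommRing A] {N N' N'' M : Type}
  [AddCommGroup N] [Module A N] [AddCommGroup N'] [Module A N'] [AddCommGroup N''] [Module A N'']
  [AddCommGroup M] [Module A M]

lemma smul_ext_eq_zero_of_forall_smul_eq_zero {i : ℕ} {s : A} (hs : ∀ n : N, s • n = 0)
    (α : Ext (ModuleCat.of A N) (ModuleCat.of A M) i) : s • α = 0 := by
  have h : s • 𝟙 (ModuleCat.of A N) = 0 := by
    ext n
    exact hs n
  rw [← Ext.mk₀_id_comp α, ← Ext.smul_comp, ← Ext.mk₀_smul, h, Ext.mk₀_zero, Ext.zero_comp]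

lemma mk₀_sum_comp_comp_eq_zero {ι : Type} (s : Finset ι) (p : ι → N →ₗ[A] N')
    (g : ι → N' →ₗ[A] N'') {i : ℕ} (α : Ext (ModuleCat.of A N'') (ModuleCat.of A M) i)
    (h : ∀ j ∈ s, (Ext.mk₀ (ModuleCat.ofHom (g j))).comp α (zero_add i) = 0) :
    (Ext.mk₀ (ModuleCat.ofHom (∑ j ∈ s, g j ∘ₗ p j))).comp α (zero_add i) = 0 := by
  classical
  induction s using Finset.induction_on with
  | empty =>
    rw [Finset.sum_empty]
    exact (congrArg (fun z => Ext.comp z α (zero_add i)) (Ext.mk₀_zero _ _)).trans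
      (Ext.zero_comp _ _ _ _ _)
  | insert a t ha ih =>
    rw [Finset.sum_insert ha, ModuleCat.ofHom_add, Ext.mk₀_add, Ext.add_comp,
      ih fun j hj => h j (Finset.mem_insert_of_mem hj), ModuleCat.ofHom_comp,
      ← Ext.mk₀_comp_mk₀, Ext.comp_assoc_of_second_deg_zero, h a (Finset.mem_insert_self _ _)]
    simp

lemma exists_surjective_comp_smul_eq_zero {I : Ideal A} {x : A} {i : ℕ}
    (H : EventuallyKillsExt I x M i) [Module.Finite A N] {k : ℕ}
    (hN : ∀ a ∈ I ^ k, ∀ n : N, a • n = 0)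
    (α : Abelian.Ext (ModuleCat.of A N) (ModuleCat.of A M) i) :
    ∃ (r l : ℕ) (F : (Fin r → A ⧸ I ^ l) →ₗ[A] N), Function.Surjective F ∧
      (Ext.mk₀ (ModuleCat.ofHom F)).comp (x • α) (zero_add i) = 0 := by
  obtain ⟨r, v, hv⟩ := Module.Finite.exists_fin (R := A) (M := N)
  have hle (l : ℕ) (hl : k ≤ l) (j : Fin r) :
      I ^ l ≤ LinearMap.ker (LinearMap.toSpanSingleton A N (v j)) := fun a ha =>
    hN a (Ideal.pow_le_pow_right hl ha) (v j)
  let g (l : ℕ) (hl : k ≤ l) (j : Fin r) : (A ⧸ I ^ l) →ₗ[A] N :=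
    Submodule.liftQ (I ^ l) (LinearMap.toSpanSingleton A N (v j)) (hle l hl j)
  choose l hkl hl using fun j =>
    H k ((Ext.mk₀ (ModuleCat.ofHom (g k le_rfl j))).comp α (zero_add i))
  let L := Finset.univ.sup l + k
  have hlL (j : Fin r) : l j ≤ L :=
    (Finset.le_sup (f := l) (Finset.mem_univ j)).trans (Nat.le_add_right _ _)
  have hkL : k ≤ L := Nat.le_add_left _ _
  refine ⟨r, L, ∑ j, g L hkL j ∘ₗ LinearMap.proj j, ?_, ?_⟩
  · rw [← LinearMap.range_eq_top, eq_top_iff, ← hv, Submodule.span_le]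
    rintro _ ⟨j, rfl⟩
    refine ⟨Pi.single j (Submodule.Quotient.mk 1), ?_⟩
    rw [LinearMap.sum_apply, Finset.sum_eq_single j]
    · simp only [LinearMap.comp_apply, LinearMap.proj_apply, Pi.single_eq_same]
      exact one_smul A (v j)
    · intro b _ hb
      simp [hb]
    · simp
  · refine mk₀_sum_comp_comp_eq_zero _ _ _ _ fun j _ => ?_
    have e : g L hkL j = g k le_rfl j ∘ₗ (Submodule.mapQ (I ^ l j) (I ^ k) LinearMap.id
        (Ideal.pow_le_pow_right (hkl j))) ∘ₗ (Submodule.mapQ (I ^ L) (I ^ l j) LinearMap.id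
        (Ideal.pow_le_pow_right (hlL j))) := by
      refine Submodule.linearMap_qext _ (LinearMap.ext fun a => ?_)
      rfl
    have h1 := hl j
    rw [← Ext.comp_smul, Ext.mk₀_comp_mk₀_assoc, ← ModuleCat.ofHom_comp] at h1
    rw [e, ← LinearMap.comp_assoc, ModuleCat.ofHom_comp, ← Ext.mk₀_comp_mk₀_assoc, h1,
      Ext.comp_zero]

/-- If `x` kills the colimits of `Ext^j(A / I ^ k, M)` for `j ≤ i`, then `x ^ (i + 1)` kills
`Ext^i(N, M)` for finite modules `N` killed by a power of `I`. -/
lemma pow_smul_ext_eq_zero [IsNoetherianRing A] {I : Ideal A} {x : A} (i : ℕ)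
    (H : ∀ j ≤ i, EventuallyKillsExt I x M j)
    (N : Type) [AddCommGroup N] [Module A N] [Module.Finite A N] (k : ℕ)
    (hN : ∀ a ∈ I ^ k, ∀ n : N, a • n = 0)
    (α : Abelian.Ext (ModuleCat.of A N) (ModuleCat.of A M) i) : x ^ (i + 1) • α = 0 := by
  induction i generalizing N k with
  | zero =>
    obtain ⟨r, l, F, hF, h⟩ := exists_surjective_comp_smul_eq_zero (H 0 le_rfl) hN α
    have : Epi (ModuleCat.ofHom F) := (ModuleCat.epi_iff_surjective _).mpr hF
    have h1 : x • α = 0 := Ext.precomp_mk₀_injective_of_epi _ (ModuleCat.ofHom F)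
      (h.trans (map_zero _).symm)
    simpa using h1
  | succ i ih =>
    obtain ⟨r, l, F, hF, h⟩ := exists_surjective_comp_smul_eq_zero (H (i + 1) le_rfl) hN α
    obtain ⟨β, hβ⟩ := Ext.contravariant_sequence_exact₃ (LinearMap.shortExact_shortComplexKer hF)
      _ (x • α) h (add_comm 1 i)
    have hker : ∀ a ∈ I ^ l, ∀ n : LinearMap.ker F, a • n = 0 := fun a ha n => by
      refine Subtype.ext (funext fun j => ?_)
      obtain ⟨b, hb⟩ := Ideal.Quotient.mk_surjective (n.1 j)
      change a • n.1 j = 0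
      rw [← hb]
      exact Ideal.Quotient.eq_zero_iff_mem.mpr (Ideal.mul_mem_right b _ ha)
    have h2 := ih (fun j hj => H j (hj.trans i.le_succ)) (LinearMap.ker F) l hker β
    rw [pow_succ, mul_smul, ← hβ, ← Ext.comp_smul, h2, Ext.comp_zero]

end ExtAnnihilation

section LocallyKills

variable {A : Type} [CommRing A]

/-- The element `y` kills the localization of `E` at `𝔪`, stated elementwise. -/
def LocallyKills (𝔪 : Ideal A) (y : A) (E : Type*) [AddCommGroup E] [Module A E] : Prop :=
  ∀ e : E, ∃ s ∉ 𝔪, (s * y) • e = 0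

lemma LocallyKills.mul_left {𝔪 : Ideal A} {y : A} {E : Type*} [AddCommGroup E] [Module A E]
    (h : LocallyKills 𝔪 y E) (z : A) : LocallyKills 𝔪 (z * y) E := fun e => by
  obtain ⟨s, hs, hse⟩ := h e
  exact ⟨s, hs, by rw [mul_left_comm, mul_smul, hse, smul_zero]⟩

lemma exists_smul_eq_zero_of_forall_pow {𝔪 : Ideal A} [IsNoetherianRing A] [h𝔪 : 𝔪.IsMaximal]
    {E : Type*} [AddCommGroup E] [Module A E] [Module.Finite A E] {e : E}
    (h : ∀ n : ℕ, ∃ s ∉ 𝔪, s • e ∈ (𝔪 ^ n • ⊤ : Submodule A E)) :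
    ∃ s ∉ 𝔪, s • e = 0 := by
  have h1 : e ∈ (⨅ n : ℕ, 𝔪 ^ n • ⊤ : Submodule A E) := by
    rw [Submodule.mem_iInf]
    intro n
    obtain ⟨s, hs, hse⟩ := h n
    have hco : IsCoprime (Ideal.span {s}) (𝔪 ^ n) := by
      refine IsCoprime.pow_right (Ideal.isCoprime_iff_codisjoint.mpr ?_)
      rw [codisjoint_comm, codisjoint_iff]
      exact h𝔪.1.2 _ (lt_of_le_of_ne le_sup_left fun he => hs
        (he ▸ Ideal.mem_sup_right (Ideal.mem_span_singleton_self s)))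
    obtain ⟨a, ha, b, hb, hab⟩ := Ideal.isCoprime_iff_exists.mp hco
    obtain ⟨c, rfl⟩ := Ideal.mem_span_singleton'.mp ha
    rw [← one_smul A e, ← hab, add_smul, mul_smul]
    exact Submodule.add_mem _ (Submodule.smul_mem _ _ hse)
      (Submodule.smul_mem_smul hb Submodule.mem_top)
  obtain ⟨r, hr⟩ := (Ideal.mem_iInf_smul_pow_eq_bot_iff 𝔪 e).mp h1
  refine ⟨1 - r, fun hmem => h𝔪.ne_top ((Ideal.eq_top_iff_one _).mpr ?_), ?_⟩
  · simpa using add_mem hmem r.2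
  · rw [sub_smul, one_smul, sub_eq_zero]
    exact hr.symm

open Abelian
open scoped Pointwise

variable {𝔪 : Ideal A} {N N' M : Type} [AddCommGroup N] [Module A N] [AddCommGroup N']
  [Module A N'] [AddCommGroup M] [Module A M] {i : ℕ}

lemma LocallyKills.ext_of_surjective [𝔪.IsPrime] {y z : A} {f : N →ₗ[A] N'}
    (hf : Function.Surjective f)
    (h₁ : LocallyKills 𝔪 y (Abelian.Ext (ModuleCat.of A (LinearMap.ker f)) (ModuleCat.of A M) i))
    (h₂ : LocallyKills 𝔪 z (Abelian.Ext (ModuleCat.of A N') (ModuleCat.of A M) i)) :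
    LocallyKills 𝔪 (z * y) (Abelian.Ext (ModuleCat.of A N) (ModuleCat.of A M) i) := by
  intro α
  obtain ⟨s, hs, hsα⟩ := h₁ ((Ext.mk₀ (ModuleCat.ofHom (LinearMap.ker f).subtype)).comp α
    (zero_add i))
  rw [← Ext.comp_smul] at hsα
  obtain ⟨β, hβ⟩ := Ext.contravariant_sequence_exact₂ (LinearMap.shortExact_shortComplexKer hf)
    _ _ hsα
  obtain ⟨t, ht, htβ⟩ := h₂ β
  refine ⟨t * s, fun h => (Ideal.IsPrime.mem_or_mem ‹_› h).elim ht hs, ?_⟩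
  rw [mul_mul_mul_comm, mul_smul, ← hβ, ← Ext.comp_smul, htβ, Ext.comp_zero]

lemma LocallyKills.ext_of_forall_quotient [𝔪.IsMaximal] [IsNoetherianRing A] [Module.Finite A N]
    [Module.Finite A M] {y z : A} (hy𝔪 : y ∈ 𝔪) (hy : IsSMulRegular N y)
    (h : ∀ n : ℕ, LocallyKills 𝔪 z (Abelian.Ext
      (ModuleCat.of A (N ⧸ (y ^ n • ⊤ : Submodule A N))) (ModuleCat.of A M) (i + 1))) :
    LocallyKills 𝔪 z (Abelian.Ext (ModuleCat.of A N) (ModuleCat.of A M) i) := by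
  intro α
  have key : ∀ n : ℕ, ∃ s ∉ 𝔪, s • z • α ∈
      (𝔪 ^ n • ⊤ : Submodule A (Abelian.Ext (ModuleCat.of A N) (ModuleCat.of A M) i)) := by
    intro n
    have hex := IsSMulRegular.smulShortComplex_shortExact (M := ModuleCat.of A N) (hy.pow n)
    obtain ⟨s, hs, hsα⟩ := h n (hex.extClass.comp α (add_comm 1 i))
    obtain ⟨β, hβ⟩ := Ext.contravariant_sequence_exact₁ hex _ ((s * z) • α) (add_comm 1 i)
      ((Ext.comp_smul _ _ _ _).trans hsα)
    refine ⟨s, hs, ?_⟩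
    rw [← mul_smul, ← hβ]
    have e : (Ext.mk₀ (ModuleCat.smulShortComplex (ModuleCat.of A N) (y ^ n)).f).comp β
        (zero_add i) = y ^ n • β := by
      rw [ModuleCat.smulShortComplex_f_eq_smul_id]
      exact (congrArg (fun w => Ext.comp w β (zero_add i)) (Ext.mk₀_smul _ _)).trans
        ((Ext.smul_comp _ _ _ _).trans (congrArg _ (Ext.mk₀_id_comp β)))
    rw [e]
    exact Submodule.smul_mem_smul (Ideal.pow_mem_pow hy𝔪 n) Submodule.mem_top
  obtain ⟨s, hs, h0⟩ := exists_smul_eq_zero_of_forall_pow key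
  exact ⟨s, hs, by rw [mul_smul, h0]⟩

end LocallyKills

section LocQuotDim
variable {A : Type} [CommRing A] {𝔪 : Ideal A}

lemma map_atPrime_isPrime [𝔪.IsPrime] {P : Ideal A} [P.IsPrime] (hP : P ≤ 𝔪) :
    (P.map (algebraMap A (Localization.AtPrime 𝔪))).IsPrime :=
  IsLocalization.isPrime_of_isPrime_disjoint 𝔪.primeCompl _ P ‹_›
    (Set.disjoint_left.mpr fun _ ha hb => ha (hP hb))

lemma comap_map_atPrime [𝔪.IsPrime] {P : Ideal A} [P.IsPrime] (hP : P ≤ 𝔪) :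
    (P.map (algebraMap A (Localization.AtPrime 𝔪))).comap
      (algebraMap A (Localization.AtPrime 𝔪)) = P :=
  IsLocalization.under_map_of_isPrime_disjoint 𝔪.primeCompl _ ‹_›
    (Set.disjoint_left.mpr fun _ ha hb => ha (hP hb))

lemma locQuotDim_nonneg (h𝔪 : 𝔪.IsPrime) {P : Ideal A} [P.IsPrime] (hP : P ≤ 𝔪) :
    0 ≤ locQuotDim A 𝔪 P h𝔪 := by
  have := map_atPrime_isPrime hP
  exact ringKrullDim_nonneg_of_nontrivial

lemma locQuotDim_self (h𝔪 : 𝔪.IsPrime) : locQuotDim A 𝔪 𝔪 h𝔪 = 0 := by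
  have : (𝔪.map (algebraMap A (Localization.AtPrime 𝔪))).IsMaximal := by
    rw [Localization.AtPrime.map_eq_maximalIdeal]
    infer_instance
  let := Ideal.Quotient.field (𝔪.map (algebraMap A (Localization.AtPrime 𝔪)))
  exact ringKrullDim_eq_zero_of_field _

lemma locQuotDim_add_one_le (h𝔪 : 𝔪.IsPrime) {P Q : Ideal A} [P.IsPrime] [Q.IsPrime]
    (hPQ : P < Q) (hQ : Q ≤ 𝔪) :
    locQuotDim A 𝔪 Q h𝔪 + 1 ≤ locQuotDim A 𝔪 P h𝔪 := by
  have hP := map_atPrime_isPrime (hPQ.le.trans hQ)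
  obtain ⟨y, hyQ, hyP⟩ := SetLike.exists_of_lt hPQ
  let φ := Ideal.Quotient.factor
    (Ideal.map_mono (f := algebraMap A (Localization.AtPrime 𝔪)) hPQ.le)
  let z : Localization.AtPrime 𝔪 ⧸ P.map (algebraMap A (Localization.AtPrime 𝔪)) :=
    Ideal.Quotient.mk _ (algebraMap A _ y)
  have hz : z ≠ 0 := fun h => hyP <| by
    rw [← comap_map_atPrime (hPQ.le.trans hQ)]
    exact Ideal.mem_comap.mpr (Ideal.Quotient.eq_zero_iff_mem.mp h)
  refine ringKrullDim_succ_le_of_surjective φ (Ideal.Quotient.factor_surjective _)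
    (r := z) (mem_nonZeroDivisors_of_ne_zero hz) ?_
  exact Ideal.Quotient.eq_zero_iff_mem.mpr (Ideal.mem_map_of_mem _ hyQ)

/-- A finitely generated module all of whose elements vanish in the localization at `𝔪` is killed
by a single element outside `𝔪`. -/
lemma exists_notMem_forall_smul_eq_zero [𝔪.IsPrime] {N : Type*} [AddCommGroup N] [Module A N]
    [Module.Finite A N] (h : ∀ n : N, ∃ s ∉ 𝔪, s • n = 0) : ∃ s ∉ 𝔪, ∀ n : N, s • n = 0 := by
  obtain ⟨S, hS⟩ := Module.Finite.fg_top (R := A) (M := N)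
  choose s hs hsn using h
  refine ⟨∏ n ∈ S, s n, fun hmem => ?_, fun n => ?_⟩
  · obtain ⟨n, -, hn⟩ := (Ideal.IsPrime.prod_mem_iff (p := 𝔪)).mp hmem
    exact hs n hn
  · have hn : n ∈ Submodule.span A (S : Set N) := hS ▸ Submodule.mem_top
    induction hn using Submodule.span_induction with
    | mem n hn =>
      obtain ⟨c, hc⟩ := Finset.dvd_prod_of_mem s hn
      rw [hc, mul_comm, mul_smul, hsn, smul_zero]
    | zero => exact smul_zero _
    | add a b _ _ ha hb => rw [smul_add, ha, hb, add_zero]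
    | smul a b _ hb => rw [smul_comm, hb, smul_zero]

lemma locQuotDim_le_moduleDimAt (h𝔪 : 𝔪.IsPrime) {M : Type} [AddCommGroup M] [Module A M]
    [Module.Finite A M] {P : Ideal A} (hP : Module.annihilator A M ≤ P) :
    locQuotDim A 𝔪 P h𝔪 ≤ moduleDimAt A M 𝔪 h𝔪 := by
  have hsub : PrimeSpectrum.zeroLocus
      (P.map (algebraMap A (Localization.AtPrime 𝔪)) : Set (Localization.AtPrime 𝔪)) ⊆
      Module.support (Localization.AtPrime 𝔪) (LocalizedModule 𝔪.primeCompl M) := by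
    rw [Module.support_eq_zeroLocus]
    refine PrimeSpectrum.zeroLocus_anti_mono fun b hb => ?_
    obtain ⟨⟨a, s⟩, has⟩ := IsLocalization.surj 𝔪.primeCompl b
    obtain ⟨t, ht, hta⟩ : ∃ t ∉ 𝔪, ∀ n : LinearMap.range (LinearMap.lsmul A M a), t • n = 0 := by
      refine exists_notMem_forall_smul_eq_zero ?_
      rintro ⟨_, m, rfl⟩
      have h0 : LocalizedModule.mk (a • m) (1 : 𝔪.primeCompl) = 0 := by
        rw [← one_mul (1 : 𝔪.primeCompl), ← LocalizedModule.mk_smul_mk,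
          Localization.mk_one_eq_algebraMap]
        rw [← has, mul_comm, mul_smul, Module.mem_annihilator.mp hb, smul_zero]
      rw [← LocalizedModule.zero_mk 1, LocalizedModule.mk_eq] at h0
      obtain ⟨t, ht⟩ := h0
      exact ⟨t, t.2, Subtype.ext (by simpa [Submonoid.smul_def] using ht)⟩
    have hP' : t * a ∈ P := hP <| Module.mem_annihilator.mpr fun m => by
      rw [mul_smul]
      exact congrArg Subtype.val (hta ⟨_, m, rfl⟩)
    have hu : IsUnit (algebraMap A (Localization.AtPrime 𝔪) (t * s)) :=
      IsLocalization.map_units _ (⟨t, ht⟩ * s : 𝔪.primeCompl)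
    refine (Ideal.unit_mul_mem_iff_mem _ hu).mp ?_
    rw [map_mul, mul_assoc, mul_comm _ b, has, ← map_mul]
    exact Ideal.mem_map_of_mem _ hP'
  rw [locQuotDim, ringKrullDim_quotient]
  exact Order.krullDim_le_of_strictMono (Set.inclusion hsub) fun _ _ h => h

lemma exists_pow_smul_top_smul_eq_zero [IsNoetherianRing A] [h𝔪 : 𝔪.IsPrime] {N : Type}
    [AddCommGroup N] [Module A N] [Module.Finite A N]
    (h : ∀ P : Ideal A, P.IsPrime → Module.annihilator A N ≤ P → P ≤ 𝔪 → P = 𝔪) :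
    ∃ s ∉ 𝔪, ∃ k : ℕ, ∀ a ∈ 𝔪 ^ k, ∀ n : N, s • a • n = 0 := by
  let J := (Module.annihilator A N).map (algebraMap A (Localization.AtPrime 𝔪))
  have hJ : 𝔪 ≤ (J.comap (algebraMap A (Localization.AtPrime 𝔪))).radical := by
    rw [← Ideal.comap_radical, Ideal.radical_eq_sInf]
    intro a ha
    refine Ideal.mem_comap.mpr (Ideal.mem_sInf.mpr fun {Q} hQ => ?_)
    have := hQ.2
    have hQ𝔪 := h (Q.comap (algebraMap A (Localization.AtPrime 𝔪))) inferInstance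
      (Ideal.map_le_iff_le_comap.mp hQ.1) fun b hb => by
        by_contra hb'
        exact hQ.2.ne_top (Ideal.eq_top_of_isUnit_mem _ hb
          (IsLocalization.map_units _ (⟨b, hb'⟩ : 𝔪.primeCompl)))
    exact Ideal.mem_comap.mp (hQ𝔪.ge ha)
  obtain ⟨k, hk⟩ := Ideal.exists_pow_le_of_le_radical_of_fg hJ (IsNoetherian.noetherian _)
  obtain ⟨s, hs, hsn⟩ : ∃ s ∉ 𝔪, ∀ n : (𝔪 ^ k • ⊤ : Submodule A N), s • n = 0 := by
    refine exists_notMem_forall_smul_eq_zero ?_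
    rintro ⟨n, hn⟩
    suffices ∃ s ∉ 𝔪, s • n = 0 by simpa [Subtype.ext_iff] using this
    induction hn using Submodule.smul_induction_on' with
    | smul a ha n _ =>
      obtain ⟨s, hs, hsa⟩ := (IsLocalization.algebraMap_mem_map_algebraMap_iff 𝔪.primeCompl
        (Localization.AtPrime 𝔪) _ _).mp (Ideal.mem_comap.mp (hk ha))
      exact ⟨s, hs, by rw [← mul_smul]; exact Module.mem_annihilator.mp hsa n⟩
    | add a _ b _ ha hb =>
      obtain ⟨s, hs, hsa⟩ := ha
      obtain ⟨t, ht, htb⟩ := hb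
      refine ⟨s * t, h𝔪.mul_notMem hs ht, ?_⟩
      rw [smul_add, mul_smul s t b, htb, mul_comm, mul_smul, hsa, smul_zero, smul_zero, add_zero]
  exact ⟨s, hs, k, fun a ha n =>
    congrArg Subtype.val (hsn ⟨_, Submodule.smul_mem_smul ha Submodule.mem_top⟩)⟩

end LocQuotDim

section Equidimensional
open Abelian
open scoped Pointwise

variable {A : Type} [CommRing A] [IsNoetherianRing A] {𝔪 : Ideal A} {M : Type} [AddCommGroup M]
  [Module A M]

/-- If the localization of `N` at `𝔪` has finite length, then a power of `x` kills the
localization of `Ext^i(N, M)` at `𝔪`. -/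
lemma locallyKills_ext_of_forall_prime_eq [𝔪.IsPrime] {x : A} {i : ℕ}
    (H : ∀ j ≤ i, EventuallyKillsExt 𝔪 x M j) {N : Type} [AddCommGroup N] [Module A N]
    [Module.Finite A N]
    (h : ∀ P : Ideal A, P.IsPrime → Module.annihilator A N ≤ P → P ≤ 𝔪 → P = 𝔪) :
    LocallyKills 𝔪 (x ^ (i + 1)) (Ext (ModuleCat.of A N) (ModuleCat.of A M) i) := by
  obtain ⟨s, hs, k, hk⟩ := exists_pow_smul_top_smul_eq_zero h
  let U := LinearMap.ker (LinearMap.lsmul A N s)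
  rw [← mul_one (x ^ (i + 1))]
  refine LocallyKills.ext_of_surjective (f := U.mkQ) U.mkQ_surjective ?_ ?_
  · intro α
    refine ⟨s, hs, ?_⟩
    rw [mul_one]
    refine smul_ext_eq_zero_of_forall_smul_eq_zero (fun n => Subtype.ext ?_) α
    have hn : n.1 ∈ U := U.ker_mkQ.le n.2
    exact hn
  · intro α
    refine ⟨1, (Ideal.ne_top_iff_one 𝔪).mp (Ideal.IsPrime.ne_top ‹_›), ?_⟩
    rw [one_mul]
    refine pow_smul_ext_eq_zero i H (N ⧸ U) k (fun a ha n => ?_) α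
    obtain ⟨n, rfl⟩ := U.mkQ_surjective n
    rw [← map_smul]
    exact (Submodule.Quotient.mk_eq_zero U).mpr (hk a ha n)

lemma exists_isSMulRegular_quotient_ker_pow {N : Type} [AddCommGroup N] [Module A N]
    [Module.Finite A N] (y : A) :
    ∃ (U : Submodule A N) (k : ℕ), (∀ n ∈ U, y ^ k • n = 0) ∧ IsSMulRegular (N ⧸ U) y := by
  obtain ⟨k, hk⟩ := monotone_stabilizes_iff_noetherian.mpr (inferInstanceAs (IsNoetherian A N))
    ⟨fun k => Submodule.torsionBy A N (y ^ k), fun k l hkl =>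
      Submodule.torsionBy_le_torsionBy_of_dvd _ _ (pow_dvd_pow y hkl)⟩
  refine ⟨Submodule.torsionBy A N (y ^ k), k, fun n hn => hn, ?_⟩
  refine IsSMulRegular.of_right_eq_zero_of_smul ?_
  intro n hn
  obtain ⟨n, rfl⟩ := Submodule.mkQ_surjective _ n
  have hn' : y • n ∈ Submodule.torsionBy A N (y ^ k) := (Submodule.Quotient.mk_eq_zero _).mp hn
  refine (Submodule.Quotient.mk_eq_zero _).mpr ((hk (k + 1) k.le_succ).ge ?_)
  change y ^ (k + 1) • n = 0
  rw [pow_succ, mul_smul]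
  exact hn'

theorem exists_forall_locallyKills_ext [h𝔪 : 𝔪.IsMaximal] [Module.Finite A M] {x : A} {d : ℕ}
    (H : ∀ j ≤ d, EventuallyKillsExt 𝔪 x M j) (e : ℕ) :
    ∃ c : ℕ, ∀ (N : Type) [AddCommGroup N] [Module A N] [Module.Finite A N],
      (∀ P : Ideal A, P.IsPrime → Module.annihilator A N ≤ P → P ≤ 𝔪 →
        locQuotDim A 𝔪 P h𝔪.isPrime ≤ ((e : ℕ∞) : WithBot ℕ∞)) →
      ∀ i, i + e ≤ d →
        LocallyKills 𝔪 (x ^ c) (Ext (ModuleCat.of A N) (ModuleCat.of A M) i) := by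
  induction e with
  | zero =>
    refine ⟨d + 1, fun N _ _ _ hN i hi => ?_⟩
    have h := locallyKills_ext_of_forall_prime_eq (N := N) (fun j (hj : j ≤ i) => H j (by omega))
      fun P hP hNP hP𝔪 => by
        by_contra hne
        have h1 := locQuotDim_add_one_le h𝔪.isPrime (lt_of_le_of_ne hP𝔪 hne) le_rfl
        rw [locQuotDim_self, zero_add] at h1
        have h2 := h1.trans (hN P hP hNP hP𝔪)
        exact absurd h2 (by simp)
    have h' := h.mul_left (x ^ (d - i))
    rwa [← pow_add, show d - i + (i + 1) = d + 1 by omega] at h'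
  | succ e ih =>
    obtain ⟨c, hc⟩ := ih
    refine ⟨c + c, fun N _ _ _ hN i hi => ?_⟩
    obtain ⟨y, hy𝔪, hy⟩ : ∃ y ∈ 𝔪,
        ∀ P ∈ (Module.annihilator A N).minimalPrimes, P ≠ 𝔪 → y ∉ P := by
      by_contra! hcon
      have hfin := Ideal.finite_minimalPrimes_of_isNoetherianRing A (Module.annihilator A N)
      obtain ⟨P, hP, h𝔪P⟩ := (Ideal.subset_union_prime (s := hfin.toFinset.erase 𝔪) (f := id)
        (I := 𝔪) ⊥ ⊥ fun P hP _ _ =>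
          (hfin.mem_toFinset.mp (Finset.mem_of_mem_erase hP)).1.1).mp fun y hy => by
        obtain ⟨P, hP, hne, hyP⟩ := hcon y hy
        exact Set.mem_biUnion (Finset.mem_erase.mpr ⟨hne, hfin.mem_toFinset.mpr hP⟩) hyP
      have hP' := Finset.mem_erase.mp hP
      exact hP'.1 (h𝔪.eq_of_le (hfin.mem_toFinset.mp hP'.2).1.1.ne_top h𝔪P).symm
    have hdrop : ∀ P : Ideal A, P.IsPrime → Module.annihilator A N ≤ P → y ∈ P → P ≤ 𝔪 →
        locQuotDim A 𝔪 P h𝔪.isPrime ≤ ((e : ℕ∞) : WithBot ℕ∞) := by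
      intro P hP hNP hyP hP𝔪
      by_cases hP' : P = 𝔪
      · subst hP'
        rw [locQuotDim_self]
        exact_mod_cast Nat.zero_le e
      obtain ⟨Q, hQ, hQP⟩ := Ideal.exists_minimalPrimes_le hNP
      have := hQ.1.1
      have hlt : Q < P := lt_of_le_of_ne hQP fun he => hy Q hQ (he ▸ hP') (he ▸ hyP)
      have h1 := (locQuotDim_add_one_le h𝔪.isPrime hlt hP𝔪).trans
        (hN Q hQ.1.1 hQ.1.2 (hQP.trans hP𝔪))
      exact ENat.WithBot.add_le_add_one_right_iff.mp (by exact_mod_cast h1)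
    obtain ⟨U, k, hU, hreg⟩ := exists_isSMulRegular_quotient_ker_pow (N := N) y
    rw [pow_add]
    refine LocallyKills.ext_of_surjective (f := U.mkQ) U.mkQ_surjective ?_ ?_
    · refine hc _ (fun P hP hNP hP𝔪 => hdrop P hP ?_ ?_ hP𝔪) i (by omega)
      · refine le_trans (fun a ha => ?_) hNP
        exact Module.mem_annihilator.mpr fun n => Subtype.ext (Module.mem_annihilator.mp ha n.1)
      · refine hP.mem_of_pow_mem k (hNP (Module.mem_annihilator.mpr fun n => Subtype.ext ?_))
        exact hU n.1 (U.ker_mkQ.le n.2)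
    · refine LocallyKills.ext_of_forall_quotient hy𝔪 hreg fun n => ?_
      refine hc _ (fun P hP hNP hP𝔪 => hdrop P hP ?_ ?_ hP𝔪) (i + 1) (by omega)
      · refine le_trans (fun a ha => Module.mem_annihilator.mpr fun n => ?_) hNP
        obtain ⟨n, rfl⟩ := Submodule.mkQ_surjective _ n
        obtain ⟨n, rfl⟩ := Submodule.mkQ_surjective _ n
        rw [← map_smul, ← map_smul, Module.mem_annihilator.mp ha, map_zero, map_zero]
      · refine hP.mem_of_pow_mem n (hNP (Module.mem_annihilator.mpr fun m => ?_))
        obtain ⟨m, rfl⟩ := Submodule.mkQ_surjective _ m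
        exact (Submodule.Quotient.mk_eq_zero _).mpr
          (Submodule.smul_mem_pointwise_smul _ _ _ Submodule.mem_top)

lemma locQuotDim_eq_moduleDimAt [h𝔪 : 𝔪.IsMaximal] [Module.Finite A M] {x : A}
    (H : ∀ i : ℕ, ((i : ℕ∞) : WithBot ℕ∞) < moduleDimAt A M 𝔪 h𝔪.isPrime →
      EventuallyKillsExt 𝔪 x M i)
    {𝔭 : Ideal A} (h𝔭 : 𝔭 ∈ (Module.annihilator A M).minimalPrimes) (h𝔭𝔪 : 𝔭 ≤ 𝔪) (hx : x ∉ 𝔭) :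
    locQuotDim A 𝔪 𝔭 h𝔪.isPrime = moduleDimAt A M 𝔪 h𝔪.isPrime := by
  have hprime : 𝔭.IsPrime := h𝔭.1.1
  refine le_antisymm (locQuotDim_le_moduleDimAt _ h𝔭.1.2) ?_
  by_contra! hlt
  obtain ⟨d, hd⟩ : ∃ d : ℕ, locQuotDim A 𝔪 𝔭 h𝔪.isPrime = ((d : ℕ∞) : WithBot ℕ∞) := by
    have h0 := locQuotDim_nonneg h𝔪.isPrime h𝔭𝔪
    generalize locQuotDim A 𝔪 𝔭 h𝔪.isPrime = D at *
    induction D with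
    | bot => simp at h0
    | coe D =>
      induction D with
      | top => exact absurd hlt (by simp)
      | coe d => exact ⟨d, rfl⟩
  obtain ⟨c, hc⟩ := exists_forall_locallyKills_ext (x := x) (M := M) (𝔪 := 𝔪) (d := d)
    (fun j hj => H j (lt_of_le_of_lt (by exact_mod_cast hj) (hd ▸ hlt))) d
  have hkill := hc (A ⧸ 𝔭) (fun P hP h𝔭P hP𝔪 => by
    rw [Ideal.annihilator_quotient] at h𝔭P
    rw [← hd]
    rcases h𝔭P.eq_or_lt with rfl | hlt'
    · exact le_rfl
    · exact (le_add_of_nonneg_right zero_le_one).trans (locQuotDim_add_one_le _ hlt' hP𝔪)) 0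
    (zero_add d).le
  obtain ⟨-, f, hf⟩ := (isAssociatedPrime_iff_exists_injective_linearMap 𝔭 M).mp
    (Module.associatedPrimes.minimalPrimes_annihilator_subset_associatedPrimes A M h𝔭)
  obtain ⟨s, hs, hse⟩ := hkill (Ext.mk₀ (ModuleCat.ofHom f))
  rw [← Ext.mk₀_smul, Ext.mk₀_eq_zero_iff] at hse
  have h1 : f (Ideal.Quotient.mk 𝔭 (s * x ^ c)) = 0 := by
    have h2 : (s * x ^ c) • f 1 = 0 :=
      congrArg (fun g : ModuleCat.of A (A ⧸ 𝔭) ⟶ ModuleCat.of A M => g.hom 1) hse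
    rw [← map_smul, Algebra.smul_def, mul_one] at h2
    exact h2
  have h2 := Ideal.Quotient.eq_zero_iff_mem.mp (hf (h1.trans (map_zero f).symm))
  rcases hprime.mem_or_mem h2 with h3 | h3
  · exact hs (h𝔭𝔪 h3)
  · exact hx (hprime.mem_of_pow_mem c h3)

end Equidimensional

/-- A finitely generated module with a uniform local cohomological annihilator is locally
equidimensional. -/
theorem stmt15 (A : Type) [CommRing A] [IsNoetherianRing A]
    (M : Type) [AddCommGroup M] [Module A M] [Module.Finite A M]
    (x : A)
    (hxmin : ∀ 𝔭 ∈ (Module.annihilator A M).minimalPrimes, x ∉ 𝔭)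
    (hxlc : ∀ (𝔪 : Ideal A) (h𝔪 : 𝔪.IsMaximal) (i : ℕ),
      ((i : ℕ∞) : WithBot ℕ∞) < moduleDimAt A M 𝔪 h𝔪.isPrime →
      x ∈ Module.annihilator A ((localCohomology 𝔪 i).obj (ModuleCat.of A M))) :
    ∀ (𝔪 : Ideal A) (h𝔪 : 𝔪.IsMaximal), Module.annihilator A M ≤ 𝔪 →
      ∀ 𝔭 ∈ (Module.annihilator A M).minimalPrimes,
      ∀ 𝔮 ∈ (Module.annihilator A M).minimalPrimes,
      𝔭 ≤ 𝔪 → 𝔮 ≤ 𝔪 →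
      locQuotDim A 𝔪 𝔭 h𝔪.isPrime = moduleDimAt A M 𝔪 h𝔪.isPrime ∧
      locQuotDim A 𝔪 𝔮 h𝔪.isPrime = moduleDimAt A M 𝔪 h𝔪.isPrime := by
  intro 𝔪 h𝔪 _ 𝔭 h𝔭 𝔮 h𝔮 h𝔭𝔪 h𝔮𝔪
  have H : ∀ i : ℕ, ((i : ℕ∞) : WithBot ℕ∞) < moduleDimAt A M 𝔪 h𝔪.isPrime →
      EventuallyKillsExt 𝔪 x M i := fun i hi =>
    eventuallyKillsExt_of_mem_annihilator_localCohomology (hxlc 𝔪 h𝔪 i hi)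
  exact ⟨locQuotDim_eq_moduleDimAt H h𝔭 h𝔭𝔪 (hxmin 𝔭 h𝔭),
    locQuotDim_eq_moduleDimAt H h𝔮 h𝔮𝔪 (hxmin 𝔮 h𝔮)⟩
end
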